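/- arXiv:2110.07779 — 2 statements merged into one kernel-verified Lean document; each statement's English description precedes it below -/
import Mathlib

section
/- Let n ≥ m ≥ 1 be integers, let p ≥ 1 be an integer and set c = 2p+1. If n ≥ 2p + 1, then r(S_c(n,m)) ≤ 2(n+m+p) − 1; that is, every 2-coloring of the edges of the complete graph on 2(n+m+p) − 1 vertices contains a monochromatic copy of S_c(n,m). -/
open SimpleGraph

/-- The relation generating the edges of the linked double star `S_c(n,m)`:
vertices are `a_1, …, a_c` (the link, modelled by `Fin c`), the spokes
`v_1, …, v_n` of the `n`-star at `a_1` (modelled by `Fin n`), and the spokes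
`w_1, …, w_m` of the `m`-star at `a_c` (modelled by `Fin m`). -/
def ldsRel (c n m : ℕ) : (Fin c ⊕ Fin n ⊕ Fin m) → (Fin c ⊕ Fin n ⊕ Fin m) → Prop
  | Sum.inl i, Sum.inl j => (j : ℕ) = (i : ℕ) + 1
  | Sum.inl i, Sum.inr (Sum.inl _) => (i : ℕ) = 0
  | Sum.inl i, Sum.inr (Sum.inr _) => (i : ℕ) = c - 1
  | _, _ => False

/-- The linked double star `S_c(n,m)`. -/
def LinkedDoubleStar (c n m : ℕ) : SimpleGraph (Fin c ⊕ Fin n ⊕ Fin m) :=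
  SimpleGraph.fromRel (ldsRel c n m)

/-- `G` contains a (not necessarily induced) subgraph isomorphic to `H`. -/
def HasCopy {α β : Type*} (H : SimpleGraph α) (G : SimpleGraph β) : Prop :=
  ∃ f : α → β, Function.Injective f ∧ ∀ ⦃a b⦄, H.Adj a b → G.Adj (f a) (f b)

/-- A 2-coloring of the complete graph on `β` is encoded by the graph `G` of red
edges (so `Gᶜ` is the graph of blue edges).  `HasMonoLDS G c n m` says this
coloring contains a monochromatic copy of `S_c(n,m)`. -/
def HasMonoLDS {β : Type*} (G : SimpleGraph β) (c n m : ℕ) : Prop :=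
  HasCopy (LinkedDoubleStar c n m) G ∨ HasCopy (LinkedDoubleStar c n m) Gᶜ

/-- Every 2-coloring of the edges of `K_r` contains a monochromatic `S_c(n,m)`. -/
def IsRamseyLDS (c n m r : ℕ) : Prop :=
  ∀ G : SimpleGraph (Fin r), HasMonoLDS G c n m

/-- The Ramsey number of the linked double star `S_c(n,m)`: the least positive
`r` such that every 2-coloring of the edges of `K_r` contains a monochromatic
copy of `S_c(n,m)`. -/
noncomputable def ramseyLDS (c n m : ℕ) : ℕ :=
  sInf {r | 0 < r ∧ IsRamseyLDS c n m r}

/-- `f` exhibits a cycle on `L` vertices in `G` (the vertices `f 0, f 1, …`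
arranged cyclically, consecutive ones adjacent in `G`). -/
def IsCycleMap {β : Type*} {L : ℕ} (G : SimpleGraph β) (f : ZMod L → β) : Prop :=
  Function.Injective f ∧ ∀ i : ZMod L, G.Adj (f i) (f (i + 1))

/-- For a monochromatic cycle with vertex set `C`, all of whose edges have the
color given by the graph `H`, `cycStat H C` is the maximum over vertices
`z ∉ C` of the number of `H`-edges from `z` into `C` (denoted `s(C)`). -/
noncomputable def cycStat {β : Type*} (H : SimpleGraph β) (C : Set β) : ℕ :=
  sSup ((fun z => ({w ∈ C | H.Adj z w}).ncard) '' Cᶜ)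


namespace LDS

open Classical in
/-- The neighborhood of `v` as a finset. -/
noncomputable def nb {V : Type} [Fintype V] (G : SimpleGraph V) (v : V) : Finset V :=
  Finset.univ.filter (fun w => G.Adj v w)

theorem mem_nb {V : Type} [Fintype V] {G : SimpleGraph V} {v w : V} :
    w ∈ nb G v ↔ G.Adj v w := by
  simp [nb]

/-- `v :: l` is a path of `G` whose last vertex is `x`. -/
structure IsP {V : Type} (G : SimpleGraph V) (x v : V) (l : List V) : Prop where
  chain : (v :: l).IsChain G.Adj
  nodup : (v :: l).Nodup
  last : (v :: l).getLast (by simp) = x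

theorem IsP.single {V : Type} (G : SimpleGraph V) (x : V) : IsP G x x [] :=
  ⟨by simp, by simp, by simp⟩

theorem IsP.cons {V : Type} {G : SimpleGraph V} {x v w : V} {l : List V}
    (h : IsP G x v l) (hw : G.Adj v w) (hn : w ∉ v :: l) : IsP G x w (v :: l) :=
  ⟨by
    rw [List.isChain_cons_cons]
    exact ⟨hw.symm, h.chain⟩,
   List.nodup_cons.2 ⟨hn, h.nodup⟩, by
    rw [List.getLast_cons (by simp)]
    exact h.last⟩

theorem mkS {V : Type} {G : SimpleGraph V} {p n m : ℕ} {x v : V} {l : List V}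
    (h : IsP G x v l) (hl : l.length = 2 * p) (A B : Finset V)
    (hA : A.card = n) (hB : B.card = m) (hAB : Disjoint A B)
    (hAl : ∀ a ∈ A, a ∉ v :: l) (hBl : ∀ a ∈ B, a ∉ v :: l)
    (hAx : ∀ a ∈ A, G.Adj x a) (hBv : ∀ a ∈ B, G.Adj v a) :
    HasCopy (LinkedDoubleStar (2 * p + 1) n m) G := by
  set L := (v :: l).reverse with hL
  have hlen : L.length = 2 * p + 1 := by simp [hL, hl]
  have hmem : ∀ a, a ∈ L ↔ a ∈ v :: l := by intro a; rw [hL, List.mem_reverse]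
  have hnd : L.Nodup := by rw [hL, List.nodup_reverse]; exact h.nodup
  have hch : L.IsChain G.Adj := by
    rw [hL, List.isChain_reverse]
    exact h.chain.imp (fun a b hab => hab.symm)
  have h0 : L[0]'(by omega) = x := by
    have := h.last
    rw [List.getLast_eq_getElem] at this
    simp only [hL, List.getElem_reverse]
    simpa using this
  have h2 : L[2 * p]'(by omega) = v := by
    simp only [hL, List.getElem_reverse]
    simp [hl]
  let φ : Fin n → V := fun i => ((A.equivFinOfCardEq hA).symm i : V)
  let ψ : Fin m → V := fun i => ((B.equivFinOfCardEq hB).symm i : V)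
  have hφ : ∀ i, φ i ∈ A := fun i => ((A.equivFinOfCardEq hA).symm i).2
  have hψ : ∀ i, ψ i ∈ B := fun i => ((B.equivFinOfCardEq hB).symm i).2
  let χ : Fin (2 * p + 1) → V := fun i => L[(i : ℕ)]'(by omega)
  have hχ : ∀ i, χ i ∈ L := fun i => List.getElem_mem _
  refine ⟨Sum.elim χ (Sum.elim φ ψ), ?_, ?_⟩
  · refine Function.Injective.sumElim ?_ (Function.Injective.sumElim ?_ ?_ ?_) ?_
    · intro i j hij
      have := (hnd.getElem_inj_iff).1 hij
      exact Fin.ext this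
    · exact Subtype.val_injective.comp (Equiv.injective _)
    · exact Subtype.val_injective.comp (Equiv.injective _)
    · intro a b hab
      exact Finset.disjoint_left.1 hAB (hφ a) (hab ▸ hψ b)
    · intro a b hab
      have h1 := (hmem _).1 (hχ a)
      rcases b with b | b
      · exact hAl _ (hφ b) (by simpa [hab] using h1)
      · exact hBl _ (hψ b) (by simpa [hab] using h1)
  · have key : ∀ a b, ldsRel (2 * p + 1) n m a b →
        G.Adj (Sum.elim χ (Sum.elim φ ψ) a) (Sum.elim χ (Sum.elim φ ψ) b) := by
      intro a b hab
      rcases a with a | a | a <;> rcases b with b | b | b <;> simp only [ldsRel] at hab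
      · have := (List.isChain_iff_getElem.1 hch) a (by omega)
        simp only [Sum.elim_inl, χ]
        simpa [hab] using this
      · have : χ a = x := by simp only [χ, hab]; exact h0
        simp only [Sum.elim_inl, Sum.elim_inr, this]
        exact hAx _ (hφ b)
      · have : χ a = v := by
          have hh : (a : ℕ) = 2 * p := by omega
          simp only [χ, hh]; exact h2
        simp only [Sum.elim_inl, Sum.elim_inr, this]
        exact hBv _ (hψ b)
    intro a b hab
    rw [LinkedDoubleStar, SimpleGraph.fromRel_adj] at hab
    rcases hab.2 with h | h
    · exact key _ _ h
    · exact (key _ _ h).symm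

open Classical in
theorem mkS2 {V : Type} [Fintype V] {G : SimpleGraph V} {p n m : ℕ} {x v : V} {l : List V}
    (h : IsP G x v l) (hl : l.length = 2 * p)
    (h1 : n ≤ (nb G x \ (v :: l).toFinset).card)
    (h2 : m ≤ (nb G v \ (v :: l).toFinset).card)
    (h3 : n + m ≤ ((nb G x \ (v :: l).toFinset) ∪ (nb G v \ (v :: l).toFinset)).card) :
    HasCopy (LinkedDoubleStar (2 * p + 1) n m) G := by
  set X := nb G x \ (v :: l).toFinset with hX
  set Y := nb G v \ (v :: l).toFinset with hY
  obtain ⟨B, hBY, hBm, hXB⟩ : ∃ B ⊆ Y, B.card = m ∧ n ≤ (X \ B).card := by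
    have e1 : (X ∪ Y).card = X.card + (Y \ X).card := by
      rw [← Finset.card_union_of_disjoint Finset.disjoint_sdiff, Finset.union_sdiff_self_eq_union]
    by_cases hc : m ≤ (Y \ X).card
    · obtain ⟨B, hB, hBm⟩ := Finset.exists_subset_card_eq hc
      refine ⟨B, hB.trans Finset.sdiff_subset, hBm, ?_⟩
      rw [Finset.sdiff_eq_self_of_disjoint]
      · exact h1
      · rw [Finset.disjoint_left]
        intro a ha hb
        exact (Finset.mem_sdiff.1 (hB hb)).2 ha
    · obtain ⟨B, hB1, hB2, hBm⟩ := Finset.exists_subsuperset_card_eq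
        (Finset.sdiff_subset : Y \ X ⊆ Y) (by omega) h2
      refine ⟨B, hB2, hBm, ?_⟩
      have e2 : X \ B = (X ∪ Y) \ B := by
        ext a
        simp only [Finset.mem_sdiff, Finset.mem_union]
        constructor
        · rintro ⟨h, h'⟩; exact ⟨Or.inl h, h'⟩
        · rintro ⟨h | h, h'⟩
          · exact ⟨h, h'⟩
          · by_contra hcon
            exact h' (hB1 (Finset.mem_sdiff.2 ⟨h, fun hx => hcon ⟨hx, h'⟩⟩))
      rw [e2]
      have := Finset.le_card_sdiff B (X ∪ Y)
      omega
  obtain ⟨A, hA, hAn⟩ := Finset.exists_subset_card_eq hXB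
  refine mkS h hl A B hAn hBm ?_ ?_ ?_ ?_ ?_
  · rw [Finset.disjoint_left]
    intro a ha hb
    exact (Finset.mem_sdiff.1 (hA ha)).2 hb
  · intro a ha
    have := (Finset.mem_sdiff.1 (Finset.mem_sdiff.1 (hA ha)).1).2
    simpa using this
  · intro a ha
    have := (Finset.mem_sdiff.1 (hBY ha)).2
    simpa using this
  · intro a ha
    exact mem_nb.1 (Finset.mem_sdiff.1 (Finset.mem_sdiff.1 (hA ha)).1).1
  · intro a ha
    exact mem_nb.1 (Finset.mem_sdiff.1 (hBY ha)).1

open Classical in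
theorem step {V : Type} [Fintype V] {G : SimpleGraph V} {x v w : V} {l : List V} (A : Finset V)
    (h : IsP G x v l) (hc : ((v :: l).toFinset ∩ A).card < (nb G v ∩ nb G w ∩ A).card)
    (hw : w ∉ v :: l) :
    ∃ a ∈ A, a ∉ v :: l ∧ IsP G x w (a :: v :: l) := by
  have : ∃ a ∈ nb G v ∩ nb G w ∩ A, a ∉ (v :: l).toFinset ∩ A :=
    Finset.exists_mem_notMem_of_card_lt_card hc
  obtain ⟨a, ha, hal⟩ := this
  simp only [Finset.mem_inter, mem_nb] at ha
  have hal' : a ∉ v :: l := by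
    intro hh
    exact hal (Finset.mem_inter.2 ⟨List.mem_toFinset.2 hh, ha.2⟩)
  refine ⟨a, ha.2, hal', (h.cons ha.1.1 hal').cons ha.1.2.symm ?_⟩
  rw [List.mem_cons]
  rintro (hh | hh)
  · exact G.loopless.irrefl _ (hh ▸ ha.1.2)
  · exact hw hh

open Classical in
theorem chainE {V : Type} [Fintype V] {G : SimpleGraph V} {x : V} (A D E : Finset V) (c : ℕ)
    (hED : E ⊆ D) (hAD : Disjoint A D)
    (hE : ∀ e ∈ E, ∀ e' ∈ E, e ≠ e' → c ≤ (nb G e ∩ nb G e' ∩ A).card) (j : ℕ) :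
    ∀ (v : V) (l : List V), IsP G x v l → v ∈ E → j ≤ (E \ (v :: l).toFinset).card →
      ((v :: l).toFinset ∩ A).card + j ≤ c →
      ∃ v' l', IsP G x v' l' ∧ v' ∈ E ∧ l'.length = l.length + 2 * j ∧
        ((v' :: l').toFinset ∩ A).card = ((v :: l).toFinset ∩ A).card + j ∧
        ((v' :: l').toFinset ∩ D).card = ((v :: l).toFinset ∩ D).card + j ∧
        (∀ a ∈ v' :: l', a ∈ v :: l ∨ a ∈ A ∨ a ∈ E) := by
  induction j with
  | zero =>
    intro v l h hv _ _
    exact ⟨v, l, h, hv, by simp, by simp, by simp, fun a ha => Or.inl ha⟩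
  | succ j ih =>
    intro v l h hv h1 h2
    obtain ⟨w, hw⟩ : (E \ (v :: l).toFinset).Nonempty := by
      rw [← Finset.card_pos]; omega
    rw [Finset.mem_sdiff, List.mem_toFinset] at hw
    have hne : v ≠ w := by
      rintro rfl
      exact hw.2 (by simp)
    have := hE v hv w hw.1 hne
    obtain ⟨a, haA, hal, hp⟩ := step A h (w := w) (by omega) hw.2
    have haD : a ∉ D := Finset.disjoint_left.1 hAD haA
    have hwA : w ∉ A := Finset.disjoint_right.1 hAD (hED hw.1)
    have haE : a ∉ E := fun hh => haD (hED hh)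
    have eA : ((w :: a :: v :: l).toFinset ∩ A).card = ((v :: l).toFinset ∩ A).card + 1 := by
      rw [List.toFinset_cons, List.toFinset_cons, Finset.insert_inter_of_notMem hwA,
        Finset.insert_inter_of_mem haA, Finset.card_insert_of_notMem]
      intro hh
      exact hal (List.mem_toFinset.1 (Finset.mem_inter.1 hh).1)
    have eD : ((w :: a :: v :: l).toFinset ∩ D).card = ((v :: l).toFinset ∩ D).card + 1 := by
      rw [List.toFinset_cons, List.toFinset_cons, Finset.insert_inter_of_mem (hED hw.1),
        Finset.insert_inter_of_notMem haD, Finset.card_insert_of_notMem]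
      intro hh
      exact hw.2 (List.mem_toFinset.1 (Finset.mem_inter.1 hh).1)
    have eE : (E \ (v :: l).toFinset).card ≤ (E \ (w :: a :: v :: l).toFinset).card + 1 := by
      have : E \ (w :: a :: v :: l).toFinset = (E \ (v :: l).toFinset).erase w := by
        ext b
        simp only [Finset.mem_sdiff, List.mem_toFinset, List.mem_cons, Finset.mem_erase, not_or]
        constructor
        · rintro ⟨h1, h2, h3, h4, h5⟩; exact ⟨h2, h1, h4, h5⟩
        · rintro ⟨h2, h1, h4, h5⟩
          refine ⟨h1, h2, ?_, h4, h5⟩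
          rintro rfl
          exact haE h1
      rw [this]
      have := Finset.pred_card_le_card_erase (s := E \ (v :: l).toFinset) (a := w)
      omega
    obtain ⟨v', l', q1, q2, q3, q4, q5, q6⟩ := ih w (a :: v :: l) hp hw.1 (by omega) (by omega)
    refine ⟨v', l', q1, q2, ?_, by omega, by omega, ?_⟩
    · rw [q3]; simp; omega
    · intro b hb
      rcases q6 b hb with hb | hb | hb
      · rw [List.mem_cons, List.mem_cons] at hb
        rcases hb with rfl | rfl | hb
        · exact Or.inr (Or.inr hw.1)
        · exact Or.inr (Or.inl haA)
        · exact Or.inl hb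
      · exact Or.inr (Or.inl hb)
      · exact Or.inr (Or.inr hb)

open Classical in
theorem card_list {V : Type} {G : SimpleGraph V} {x v : V} {l : List V} (h : IsP G x v l) :
    (v :: l).toFinset.card = l.length + 1 := by
  rw [List.toFinset_card_of_nodup h.nodup]; simp

/-- A large complete bipartite graph contains the linked double star. -/
theorem bip {V : Type} [Fintype V] {G : SimpleGraph V} {p n m : ℕ} (Y X : Finset V)
    (hYX : Disjoint Y X) (hY : p + 1 ≤ Y.card) (hX : n + m + p ≤ X.card)
    (h : ∀ y ∈ Y, ∀ a ∈ X, G.Adj y a) :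
    HasCopy (LinkedDoubleStar (2 * p + 1) n m) G := by
  classical
  obtain ⟨y, hy⟩ : Y.Nonempty := by rw [← Finset.card_pos]; omega
  have hsub : ∀ e ∈ Y, X ⊆ nb G e := fun e he a ha => mem_nb.2 (h e he a ha)
  have hyX : y ∉ X := Finset.disjoint_left.1 hYX hy
  have e0 : ([y].toFinset ∩ X).card = 0 := by simp [hyX]
  have e1 : p ≤ (Y \ [y].toFinset).card := by
    have := Finset.le_card_sdiff [y].toFinset Y
    simp at this
    simp
    omega
  obtain ⟨v, l, q1, q2, q3, q4, -, -⟩ := chainE X Y Y p subset_rfl hYX.symm (by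
    intro e he e' he' _
    rw [Finset.inter_eq_right.2]
    · omega
    · exact Finset.subset_inter (hsub e he) (hsub e' he')) p y [] (IsP.single G y) hy e1 (by omega)
  have e2 : n + m ≤ (X \ (v :: l).toFinset).card := by
    rw [Finset.card_sdiff]
    omega
  have s1 := Finset.sdiff_subset_sdiff (hsub y hy) (subset_rfl : (v :: l).toFinset ⊆ _)
  have s2 := Finset.sdiff_subset_sdiff (hsub v q2) (subset_rfl : (v :: l).toFinset ⊆ _)
  have c1 := Finset.card_le_card s1
  have c2 := Finset.card_le_card s2
  have c3 := Finset.card_le_card (s1.trans (Finset.subset_union_left (s₂ := nb G v \ (v :: l).toFinset)))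
  exact mkS2 q1 (by simpa using q3) (by omega) (by omega) (by omega)

theorem nb_compl {V : Type} [Fintype V] (G : SimpleGraph V) (v : V) :
    (nb G v).card + (nb Gᶜ v).card + 1 = Fintype.card V := by
  classical
  have hd : Disjoint (nb G v) (nb Gᶜ v) := by
    rw [Finset.disjoint_left]
    intro a h1 h2
    rw [mem_nb] at h1 h2
    exact ((SimpleGraph.compl_adj _ _ _).1 h2).2 h1
  have : nb G v ∪ nb Gᶜ v = Finset.univ.erase v := by
    ext a
    simp only [Finset.mem_union, mem_nb, SimpleGraph.compl_adj, Finset.mem_erase,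
      Finset.mem_univ, and_true]
    constructor
    · rintro (h | h)
      · exact h.ne'
      · exact h.1.symm
    · intro h
      by_cases hh : G.Adj v a
      · exact Or.inl hh
      · exact Or.inr ⟨h.symm, hh⟩
  rw [← Finset.card_union_of_disjoint hd, this, Finset.card_erase_of_mem (Finset.mem_univ v)]
  have : 0 < Fintype.card V := Fintype.card_pos_iff.2 ⟨v⟩
  rw [Finset.card_univ]
  omega

/-- Many vertices of small degree in `Gᶜ` give a copy in `G`. -/
theorem heavy_one {V : Type} [Fintype V] {G : SimpleGraph V} {p n m : ℕ} (hn : 2 * p + 1 ≤ n)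
    (hV : Fintype.card V + 1 = 2 * (n + m + p)) (T : Finset V) (hT : T.card = p + 1)
    (hdeg : ∀ e ∈ T, 2 * n + m ≤ (nb G e).card + 1) :
    HasCopy (LinkedDoubleStar (2 * p + 1) n m) G := by
  classical
  obtain ⟨y, hy⟩ : T.Nonempty := by rw [← Finset.card_pos]; omega
  have e1 : p ≤ (T \ [y].toFinset).card := by
    have := Finset.le_card_sdiff [y].toFinset T
    simp at this
    simp
    omega
  obtain ⟨v, l, q1, q2, q3, q4, -, -⟩ := chainE Tᶜ T T p subset_rfl
    disjoint_compl_left (by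
    intro e he e' he' _
    have c1 := hdeg e he
    have c2 := hdeg e' he'
    have c3 := Finset.card_union_add_card_inter (nb G e) (nb G e')
    have c4 : (nb G e ∪ nb G e').card ≤ Fintype.card V := Finset.card_le_univ _
    have c5 : ((nb G e ∩ nb G e') \ T).card = (nb G e ∩ nb G e' ∩ Tᶜ).card := by
      rw [Finset.sdiff_eq_inter_compl]
    have c6 := Finset.le_card_sdiff T (nb G e ∩ nb G e')
    omega) p y [] (IsP.single G y) hy e1 (by simp [hy])
  have hl : l.length = 2 * p := by simpa using q3
  have key : ∀ e ∈ T, e ∈ (v :: l).toFinset →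
      n + m ≤ (nb G e \ (v :: l).toFinset).card := by
    intro e he hel
    have c1 := hdeg e he
    have c2 : nb G e \ (v :: l).toFinset = nb G e \ ((v :: l).toFinset.erase e) := by
      ext a
      simp only [Finset.mem_sdiff, Finset.mem_erase, mem_nb]
      constructor
      · rintro ⟨h1, h2⟩; exact ⟨h1, fun h => h2 h.2⟩
      · rintro ⟨h1, h2⟩; exact ⟨h1, fun h => h2 ⟨h1.ne', h⟩⟩
    rw [c2]
    have c3 := Finset.le_card_sdiff ((v :: l).toFinset.erase e) (nb G e)
    rw [Finset.card_erase_of_mem hel, card_list q1] at c3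
    omega
  have c1 := key y hy (by
    rw [List.mem_toFinset]
    have := List.getLast_mem (l := v :: l) (by simp)
    rwa [q1.last] at this)
  have c2 := key v q2 (by simp)
  have c3 := Finset.card_le_card
    (Finset.subset_union_left (s₁ := nb G y \ (v :: l).toFinset) (s₂ := nb G v \ (v :: l).toFinset))
  exact mkS2 q1 hl (by omega) (by omega) (by omega)

theorem IsP.last_mem {V : Type} {G : SimpleGraph V} {x v : V} {l : List V} (h : IsP G x v l) :
    x ∈ v :: l := by
  have := List.getLast_mem (l := v :: l) (by simp)
  rwa [h.last] at this

open Classical in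
theorem sdiff_card {V : Type} [Fintype V] {G : SimpleGraph V} {x v e : V} {l : List V}
    (h : IsP G x v l) (he : e ∈ v :: l) :
    (nb G e).card ≤ (nb G e \ (v :: l).toFinset).card + l.length := by
  have c2 : nb G e \ (v :: l).toFinset = nb G e \ ((v :: l).toFinset.erase e) := by
    ext a
    simp only [Finset.mem_sdiff, Finset.mem_erase, mem_nb]
    constructor
    · rintro ⟨h1, h2⟩; exact ⟨h1, fun h => h2 h.2⟩
    · rintro ⟨h1, h2⟩; exact ⟨h1, fun h => h2 ⟨h1.ne', h⟩⟩
  rw [c2]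
  have c3 := Finset.le_card_sdiff ((v :: l).toFinset.erase e) (nb G e)
  rw [Finset.card_erase_of_mem (List.mem_toFinset.2 he), card_list h] at c3
  omega

/-- Rotation: the path may be re-ordered to end in the predecessor of a neighbor of its end. -/
theorem rot {V : Type} {G : SimpleGraph V} {x v g u : V} {l l1 l2 : List V}
    (h : IsP G x v l) (hl : v :: l = l1 ++ g :: u :: l2) (hvu : G.Adj v u) :
    ∃ l', IsP G x g l' ∧ l'.length = l.length ∧ ∀ a, a ∈ g :: l' ↔ a ∈ v :: l := by
  obtain ⟨hc, hnd, hlast⟩ := h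
  have hlen : l.length + 1 = l1.length + (l2.length + 1 + 1) := by
    have := congrArg List.length hl
    simpa using this
  have hmem : ∀ a, a ∈ g :: (l1.reverse ++ u :: l2) ↔ a ∈ v :: l := by
    intro a
    rw [hl]
    simp only [List.mem_cons, List.mem_append, List.mem_reverse]
    tauto
  refine ⟨l1.reverse ++ u :: l2, ⟨?_, ?_, ?_⟩, ?_, hmem⟩
  · have e1 : g :: (l1.reverse ++ u :: l2) = (l1 ++ [g]).reverse ++ u :: l2 := by simp
    have e2 : v :: l = (l1 ++ [g]) ++ u :: l2 := by rw [hl]; simp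
    rw [e1]
    rw [e2, List.isChain_append] at hc
    rw [List.isChain_append]
    refine ⟨?_, hc.2.1, ?_⟩
    · rw [List.isChain_reverse]
      exact hc.1.imp (fun a b hab => hab.symm)
    · intro a ha b hb
      have hb' : b = u := by simpa using hb.symm
      have ha' : a = v := by
        rw [List.getLast?_reverse] at ha
        cases l1 with
        | nil => simp at hl ha; rw [← ha, hl.1]
        | cons c l1 => simp at hl ha; rw [← ha, hl.1]
      rw [ha', hb']
      exact hvu
  · have : (g :: (l1.reverse ++ u :: l2)).Perm (v :: l) := by
      rw [hl]
      have : (l1.reverse ++ u :: l2).Perm (l1 ++ u :: l2) :=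
        (List.reverse_perm l1).append_right _
      exact (this.cons g).trans List.perm_middle.symm
    exact this.nodup_iff.2 hnd
  · have e3 : (v :: l).getLast (by simp) = (u :: l2).getLast (by simp) := by
      simp only [hl]
      rw [List.getLast_append_of_ne_nil (by simp) (by simp), List.getLast_cons (by simp)]
    rw [← hlast, e3, List.getLast_cons (by simp), List.getLast_append_of_ne_nil (by simp) (by simp)]
  · simp; omega

open Classical in
theorem rot_count {V : Type} [Fintype V] {G : SimpleGraph V} {x v : V} {l : List V}
    (h : IsP G x v l) :
    (nb G v ∩ (v :: l).toFinset).card ≤ (Finset.univ.filter (fun e => e ∈ v :: l ∧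
      ∃ l', IsP G x e l' ∧ l'.length = l.length ∧ ∀ a, a ∈ e :: l' ↔ a ∈ v :: l)).card := by
  have hex : ∀ u ∈ nb G v ∩ (v :: l).toFinset, ∃ g l1 l2, v :: l = l1 ++ g :: u :: l2 := by
    intro u hu
    rw [Finset.mem_inter, mem_nb, List.mem_toFinset, List.mem_cons] at hu
    have hul : u ∈ l := hu.2.resolve_left hu.1.ne'
    obtain ⟨s, t, hst⟩ := List.append_of_mem hul
    rcases List.eq_nil_or_concat s with rfl | ⟨s', b, rfl⟩
    · exact ⟨v, [], t, by simp [hst]⟩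
    · exact ⟨b, v :: s', t, by simp [hst]⟩
  choose! g l1 l2 hg using hex
  refine Finset.card_le_card_of_injOn g ?_ ?_
  · intro u hu
    have hu' := hu
    rw [Finset.mem_coe, Finset.mem_inter, mem_nb] at hu'
    have := hg u hu
    simp only [Finset.coe_filter, Finset.mem_univ, true_and, Set.mem_ofPred_eq]
    refine ⟨by rw [this]; simp, rot h this hu'.1⟩
  · intro u hu u' hu' huu
    have h1 := hg u hu
    have h2 := hg u' hu'
    have hnd := h.nodup
    rw [← huu] at h2
    rw [h1] at h2 hnd
    have k1 := (List.nodup_append.1 hnd)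
    have n1 : g u ∉ l1 u := fun hh => k1.2.2 _ hh _ (by simp) rfl
    have n2 : g u ∉ u :: l2 u := (List.nodup_cons.1 k1.2.1).1
    have := (List.append_cons_inj_of_notMem n1 n2).1 h2
    simp only [List.cons.injEq] at this
    tauto

/-- There is no vertex of very large degree. -/
theorem heavy {V : Type} [Fintype V] {G : SimpleGraph V} {p n m : ℕ} (hn : 2 * p + 1 ≤ n)
    (hm : 1 ≤ m)
    (hV : Fintype.card V + 1 = 2 * (n + m + p))
    (hG : ¬ HasCopy (LinkedDoubleStar (2 * p + 1) n m) G)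
    (hGc : ¬ HasCopy (LinkedDoubleStar (2 * p + 1) n m) Gᶜ) (x : V) :
    (nb G x).card < n + m + 2 * p := by
  classical
  by_contra hx
  push Not at hx
  set SB : Finset V := Finset.univ.filter (fun v => (nb G v).card < m + 2 * p) with hSB
  have hSBc : SB.card ≤ p := by
    by_contra hcon
    obtain ⟨T, hT, hTc⟩ := Finset.exists_subset_card_eq (show p + 1 ≤ SB.card by omega)
    refine hGc (heavy_one hn hV T hTc ?_)
    intro e he
    have h1 := (Finset.mem_filter.1 (hT he)).2
    have h2 := nb_compl G e
    omega
  have hpath : ∀ j ≤ 2 * p, ∃ v l, IsP G x v l ∧ l.length = j ∧ ∀ a ∈ v :: l, a ∉ SB := by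
    intro j
    induction j with
    | zero =>
      intro _
      refine ⟨x, [], IsP.single G x, rfl, ?_⟩
      intro a ha
      have : a = x := by simpa using ha
      subst this
      simp only [hSB, Finset.mem_filter, Finset.mem_univ, true_and]
      omega
    | succ j ih =>
      intro hj
      obtain ⟨v, l, h, hlj, hS⟩ := ih (by omega)
      by_contra hcon
      push Not at hcon
      have hstuck : ∀ e l', IsP G x e l' → l'.length = j → (∀ a, a ∈ e :: l' ↔ a ∈ v :: l) →
          ∀ w, G.Adj e w → w ∈ (v :: l).toFinset ∪ SB := by
        intro e l' h' hl' hm' w hw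
        by_contra hw2
        rw [Finset.mem_union, List.mem_toFinset, not_or] at hw2
        obtain ⟨a, ha, ha2⟩ := hcon w (e :: l') (h'.cons hw (by rw [hm']; exact hw2.1))
          (by simp [hl'])
        rw [List.mem_cons] at ha
        rcases ha with rfl | ha
        · exact hw2.2 ha2
        · exact hS a ((hm' a).1 ha) ha2
      have hvS : m + 2 * p ≤ (nb G v).card := by
        have := hS v (by simp)
        simp only [hSB, Finset.mem_filter, Finset.mem_univ, true_and] at this
        omega
      have c1 : (nb G v).card ≤ (nb G v ∩ (v :: l).toFinset).card + SB.card := by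
        refine (Finset.card_le_card ?_).trans (Finset.card_union_le _ _)
        intro w hw
        have := hstuck v l h hlj (fun a => Iff.rfl) w (mem_nb.1 hw)
        simp only [Finset.mem_union, Finset.mem_inter] at this ⊢
        tauto
      have c2 := rot_count h
      set T := (Finset.univ.filter (fun e => e ∈ v :: l ∧
        ∃ l', IsP G x e l' ∧ l'.length = l.length ∧ ∀ a, a ∈ e :: l' ↔ a ∈ v :: l)) with hT
      have c3 : ((v :: l).toFinset ∪ SB).card ≤ (j + 1) + p := by
        refine (Finset.card_union_le _ _).trans ?_
        rw [card_list h, hlj]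
        omega
      have c4 := Finset.card_add_card_compl ((v :: l).toFinset ∪ SB)
      refine hGc (bip T ((v :: l).toFinset ∪ SB)ᶜ ?_ (by omega) (by omega) ?_)
      · rw [Finset.disjoint_left]
        intro a ha hb
        have := (Finset.mem_filter.1 ha).2.1
        rw [Finset.mem_compl, Finset.mem_union, List.mem_toFinset] at hb
        exact hb (Or.inl this)
      · intro e he a ha
        obtain ⟨he1, l', h1, h2, h3⟩ := (Finset.mem_filter.1 he).2
        rw [Finset.mem_compl] at ha
        rw [SimpleGraph.compl_adj]
        refine ⟨?_, fun hh => ha (hstuck e l' h1 (by omega) h3 a hh)⟩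
        rintro rfl
        exact ha (Finset.mem_union_left _ (List.mem_toFinset.2 he1))
  obtain ⟨v, l, h, hl, hS⟩ := hpath (2 * p) le_rfl
  have hv := hS v (by simp)
  simp only [hSB, Finset.mem_filter, Finset.mem_univ, true_and] at hv
  have c1 := sdiff_card h h.last_mem
  have c2 := sdiff_card h (e := v) (by simp)
  have c3 := Finset.card_le_card
    (Finset.subset_union_left (s₁ := nb G x \ (v :: l).toFinset) (s₂ := nb G v \ (v :: l).toFinset))
  exact hG (mkS2 h hl (by omega) (by omega) (by omega))


/-- The situation around a vertex of maximum monochromatic degree. -/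
structure Ctx {V : Type} [Fintype V] (G : SimpleGraph V) (p n m t : ℕ) (x : V) : Prop where
  hn : 2 * p + 1 ≤ n
  hm : 1 ≤ m
  hp : 1 ≤ p
  noc : ¬ HasCopy (LinkedDoubleStar (2 * p + 1) n m) G
  hA : (nb G x).card + t + 1 = n + m + 2 * p
  hD : (nb Gᶜ x).card + 1 = n + m + t
  ht : t ≤ p
  deg : ∀ v, n + m + t ≤ (nb G v).card + 1
  degu : ∀ v, (nb G v).card + t + 1 ≤ n + m + 2 * p

theorem extend {V : Type} [Fintype V] {G : SimpleGraph V} {x : V} {q : ℕ}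
    (hdeg : ∀ v, q + 1 ≤ (nb G v).card) (i : ℕ) :
    ∀ (v : V) (l : List V), IsP G x v l → l.length + i = q →
      ∃ v' l', IsP G x v' l' ∧ l'.length = q ∧ ∀ a ∈ v :: l, a ∈ v' :: l' := by
  classical
  induction i with
  | zero => intro v l h hl; exact ⟨v, l, h, by omega, fun a ha => ha⟩
  | succ i ih =>
    intro v l h hl
    have h1 := sdiff_card h (e := v) (by simp)
    have h2 := hdeg v
    obtain ⟨w, hw⟩ : (nb G v \ (v :: l).toFinset).Nonempty := by
      rw [← Finset.card_pos]; omega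
    rw [Finset.mem_sdiff, mem_nb, List.mem_toFinset] at hw
    obtain ⟨v', l', k1, k2, k3⟩ := ih w (v :: l) (h.cons hw.1 hw.2) (by simp; omega)
    exact ⟨v', l', k1, k2, fun a ha => k3 a (List.mem_cons_of_mem _ ha)⟩

theorem disjAD {V : Type} [Fintype V] (G : SimpleGraph V) (x : V) :
    Disjoint (nb G x) (nb Gᶜ x) := by
  rw [Finset.disjoint_left]
  intro a h1 h2
  rw [mem_nb] at h1 h2
  exact ((SimpleGraph.compl_adj _ _ _).1 h2).2 h1

open Classical in
theorem cnt {V : Type} [Fintype V] {G : SimpleGraph V} {x v : V} {l : List V}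
    (h : IsP G x v l) :
    ((v :: l).toFinset ∩ nb G x).card + ((v :: l).toFinset ∩ nb Gᶜ x).card = l.length := by
  have h1 := card_list h
  have hx : x ∈ (v :: l).toFinset := List.mem_toFinset.2 h.last_mem
  have h2 := Finset.card_erase_of_mem hx
  have h3 : (v :: l).toFinset.erase x =
      ((v :: l).toFinset ∩ nb G x) ∪ ((v :: l).toFinset ∩ nb Gᶜ x) := by
    ext a
    simp only [Finset.mem_erase, Finset.mem_union, Finset.mem_inter, mem_nb,
      SimpleGraph.compl_adj]
    constructor
    · rintro ⟨q1, q2⟩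
      by_cases hh : G.Adj x a
      · exact Or.inl ⟨q2, hh⟩
      · exact Or.inr ⟨q2, q1.symm, hh⟩
    · rintro (⟨q1, q2⟩ | ⟨q1, q2, q3⟩)
      · exact ⟨q2.ne', q1⟩
      · exact ⟨q2.symm, q1⟩
  rw [h3, Finset.card_union_of_disjoint] at h2
  · omega
  · exact (disjAD G x).mono Finset.inter_subset_right Finset.inter_subset_right

open Classical in
theorem cntD_cons {V : Type} {v w : V} {l : List V} (D : Finset V) (hw : w ∉ v :: l)
    (hD : w ∈ D) :
    ((w :: v :: l).toFinset ∩ D).card = ((v :: l).toFinset ∩ D).card + 1 := by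
  rw [List.toFinset_cons (a := w), Finset.insert_inter_of_mem hD, Finset.card_insert_of_notMem]
  rw [Finset.mem_inter, List.mem_toFinset]
  exact fun h => hw h.1

open Classical in
theorem sdiffA {V : Type} [Fintype V] (G : SimpleGraph V) (x v : V) (l : List V) :
    (nb G x \ (v :: l).toFinset).card + ((v :: l).toFinset ∩ nb G x).card = (nb G x).card := by
  rw [Finset.inter_comm]
  exact Finset.card_sdiff_add_card_inter _ _

open Classical in
theorem star {V : Type} [Fintype V] {G : SimpleGraph V} {p n m t : ℕ} {x v : V} {l : List V}
    (C : Ctx G p n m t x) (h : IsP G x v l) (hl : l.length ≤ 2 * p)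
    (hc : t + 1 ≤ ((v :: l).toFinset ∩ nb Gᶜ x).card) : False := by
  obtain ⟨v', l', k1, k2, k3⟩ := extend (q := 2 * p)
    (fun v => by have := C.deg v; have := C.hn; have := C.hm; omega) (2 * p - l.length) v l h
    (by omega)
  have e1 := cnt k1
  have e2 := sdiffA G x v' l'
  have e3 : ((v :: l).toFinset ∩ nb Gᶜ x).card ≤ ((v' :: l').toFinset ∩ nb Gᶜ x).card := by
    apply Finset.card_le_card
    apply Finset.inter_subset_inter_right
    intro a ha
    rw [List.mem_toFinset] at ha ⊢
    exact k3 a ha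
  have e4 := sdiff_card k1 (e := v') (by simp)
  have e5 := C.deg v'
  have := C.hn
  have := C.hA
  have c3 := Finset.card_le_card (Finset.subset_union_left
    (s₁ := nb G x \ (v' :: l').toFinset) (s₂ := nb G v' \ (v' :: l').toFinset))
  exact C.noc (mkS2 k1 k2 (by omega) (by omega) (by omega))

open Classical in
theorem star2 {V : Type} [Fintype V] {G : SimpleGraph V} {p n m : ℕ} {x v f : V} {l : List V}
    (C : Ctx G p n m p x) (h : IsP G x v l) (hl : l.length = 2 * p)
    (hc : p ≤ ((v :: l).toFinset ∩ nb Gᶜ x).card) (hf : f ∈ nb Gᶜ x) (hfl : f ∉ v :: l)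
    (hvf : G.Adj v f) : False := by
  have e1 := cnt h
  have e2 := sdiffA G x v l
  have e4 := sdiff_card h (e := v) (by simp)
  have e5 := C.deg v
  have := C.hn
  have := C.hA
  have := C.hm
  have c3 : (insert f (nb G x \ (v :: l).toFinset)).card ≤
      ((nb G x \ (v :: l).toFinset) ∪ (nb G v \ (v :: l).toFinset)).card := by
    apply Finset.card_le_card
    rw [Finset.insert_subset_iff]
    refine ⟨Finset.mem_union_right _ ?_, Finset.subset_union_left⟩
    rw [Finset.mem_sdiff, mem_nb, List.mem_toFinset]
    exact ⟨hvf, hfl⟩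
  rw [Finset.card_insert_of_notMem] at c3
  · exact C.noc (mkS2 h hl (by omega) (by omega) (by omega))
  · rw [Finset.mem_sdiff]
    exact fun hh => Finset.disjoint_left.1 (disjAD G x) hh.1 hf

open Classical in
theorem splitAD {V : Type} [Fintype V] {G : SimpleGraph V} {x w : V} (hw : w ∈ nb Gᶜ x) :
    (nb G w).card = (nb G w ∩ nb G x).card + (nb G w ∩ nb Gᶜ x).card := by
  rw [← Finset.card_union_of_disjoint]
  · congr 1
    ext a
    simp only [Finset.mem_union, Finset.mem_inter, mem_nb, SimpleGraph.compl_adj]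
    rw [mem_nb, SimpleGraph.compl_adj] at hw
    constructor
    · intro h
      by_cases hh : G.Adj x a
      · exact Or.inl ⟨h, hh⟩
      · refine Or.inr ⟨h, ?_, hh⟩
        rintro rfl
        exact hw.2 h.symm
    · tauto
  · exact (disjAD G x).mono Finset.inter_subset_right Finset.inter_subset_right

open Classical in
theorem base {V : Type} [Fintype V] {G : SimpleGraph V} {p n m t : ℕ} {x w : V}
    (C : Ctx G p n m t x) (hw : w ∈ nb Gᶜ x) :
    ∃ a ∈ nb G x, IsP G x w [a, x] ∧ ((w :: [a, x]).toFinset ∩ nb Gᶜ x).card = 1 := by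
  have e1 := splitAD hw
  have e2 := C.deg w
  have e3 : (nb G w ∩ nb Gᶜ x).card ≤ ((nb Gᶜ x).erase w).card := by
    apply Finset.card_le_card
    intro a ha
    rw [Finset.mem_inter, mem_nb] at ha
    rw [Finset.mem_erase]
    exact ⟨ha.1.ne', ha.2⟩
  rw [Finset.card_erase_of_mem hw] at e3
  have := C.hD
  have := C.hn
  have := C.hm
  obtain ⟨a, ha⟩ : (nb G w ∩ nb G x).Nonempty := by rw [← Finset.card_pos]; omega
  rw [Finset.mem_inter, mem_nb] at ha
  have hax := mem_nb.1 ha.2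
  have hwx : ¬ w = x := by
    rw [mem_nb, SimpleGraph.compl_adj] at hw
    exact hw.1.symm
  have hP : IsP G x a [x] := (IsP.single G x).cons hax (by simpa using hax.ne')
  have hwn : w ∉ a :: [x] := by
    simp only [List.mem_cons, List.not_mem_nil, or_false, not_or]
    exact ⟨ha.1.ne, hwx⟩
  refine ⟨a, ha.2, hP.cons ha.1.symm hwn, ?_⟩
  rw [cntD_cons _ hwn hw]
  have : ([a, x].toFinset ∩ nb Gᶜ x) = ∅ := by
    rw [← Finset.disjoint_iff_inter_eq_empty, Finset.disjoint_left]
    intro b hb hb2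
    simp only [List.mem_toFinset, List.mem_cons, List.not_mem_nil, or_false] at hb
    rcases hb with rfl | rfl
    · exact Finset.disjoint_left.1 (disjAD G x) ha.2 hb2
    · rw [mem_nb] at hb2
      exact hb2.ne rfl
  rw [this]; simp

open Classical in
/-- Vertices of `D` with few neighbors in `D`. -/
noncomputable def eset {V : Type} [Fintype V] (G : SimpleGraph V) (t : ℕ) (x : V) : Finset V :=
  (nb Gᶜ x).filter (fun w => (nb G w ∩ nb Gᶜ x).card ≤ t)

open Classical in
theorem eset_inter {V : Type} [Fintype V] {G : SimpleGraph V} {p n m t : ℕ} {x : V}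
    (C : Ctx G p n m t x) : ∀ e ∈ eset G t x, ∀ e' ∈ eset G t x, e ≠ e' →
      t + 1 ≤ (nb G e ∩ nb G e' ∩ nb G x).card := by
  intro e he e' he' _
  rw [eset, Finset.mem_filter] at he he'
  have s1 := splitAD he.1
  have s2 := splitAD he'.1
  have d1 := C.deg e
  have d2 := C.deg e'
  have u := Finset.card_union_add_card_inter (nb G e ∩ nb G x) (nb G e' ∩ nb G x)
  have u2 : ((nb G e ∩ nb G x) ∪ (nb G e' ∩ nb G x)).card ≤ (nb G x).card :=
    Finset.card_le_card (Finset.union_subset Finset.inter_subset_right Finset.inter_subset_right)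
  have u3 : (nb G e ∩ nb G x) ∩ (nb G e' ∩ nb G x) = nb G e ∩ nb G e' ∩ nb G x := by
    ext a; simp only [Finset.mem_inter]; tauto
  rw [u3] at u
  have := C.hA
  have := C.hn
  have := C.hm
  omega

theorem eset_sub {V : Type} [Fintype V] {G : SimpleGraph V} {t : ℕ} {x : V} :
    eset G t x ⊆ nb Gᶜ x := by
  classical
  intro a ha
  rw [eset, Finset.mem_filter] at ha
  exact ha.1

open Classical in
theorem fpath {V : Type} [Fintype V] {G : SimpleGraph V} {p n m t : ℕ} {x f : V}
    (C : Ctx G p n m t x) (hf : f ∈ nb Gᶜ x) (hfE : f ∉ eset G t x) (s : ℕ) (hs : s ≤ t) :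
    (∃ v l, IsP G x v l ∧ v ∈ nb Gᶜ x ∧ l.length = s + 2 ∧
      ((v :: l).toFinset ∩ nb Gᶜ x).card = s + 1 ∧ ∀ a ∈ v :: l, a ∉ eset G t x) ∨
    (∃ v l r, r + 1 ≤ t ∧ IsP G x v l ∧ v ∈ nb Gᶜ x ∧ l.length = r + 2 ∧
      ((v :: l).toFinset ∩ nb Gᶜ x).card = r + 1 ∧ (∀ a ∈ v :: l, a ∉ eset G t x) ∧
      t + 1 ≤ (nb G v ∩ eset G t x).card + r) := by
  induction s with
  | zero =>
    left
    obtain ⟨a, ha, h, hc⟩ := base C hf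
    refine ⟨f, [a, x], h, hf, rfl, hc, ?_⟩
    intro b hb hbE
    simp only [List.mem_cons, List.not_mem_nil, or_false] at hb
    rcases hb with rfl | rfl | rfl
    · exact hfE hbE
    · exact Finset.disjoint_left.1 (disjAD G x) ha (eset_sub hbE)
    · exact (mem_nb.1 (eset_sub hbE)).ne rfl
  | succ s ih =>
    rcases ih (by omega) with ⟨v, l, h, hv, hl, hc, hE⟩ | h
    · by_cases hex : ∃ w ∈ nb G v ∩ nb Gᶜ x, w ∉ v :: l ∧ w ∉ eset G t x
      · obtain ⟨w, hw, hwl, hwE⟩ := hex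
        rw [Finset.mem_inter, mem_nb] at hw
        left
        refine ⟨w, v :: l, h.cons hw.1 hwl, hw.2, by simp [hl], ?_, ?_⟩
        · rw [cntD_cons _ hwl hw.2, hc]
        · intro a ha
          rw [List.mem_cons] at ha
          rcases ha with rfl | ha
          · exact hwE
          · exact hE a ha
      · right
        push Not at hex
        refine ⟨v, l, s, hs, h, hv, hl, hc, hE, ?_⟩
        have hvF : t < (nb G v ∩ nb Gᶜ x).card := by
          have := hE v (by simp)
          rw [eset, Finset.mem_filter] at this
          by_contra hh
          exact this ⟨hv, by omega⟩
        have h1 : (nb G v ∩ nb Gᶜ x).card ≤ (nb G v ∩ eset G t x).card +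
            (((v :: l).toFinset ∩ nb Gᶜ x).erase v).card := by
          refine (Finset.card_le_card ?_).trans (Finset.card_union_le _ _)
          intro w hw
          have hw' := Finset.mem_inter.1 hw
          rw [Finset.mem_union, Finset.mem_inter, Finset.mem_erase, Finset.mem_inter,
            List.mem_toFinset]
          by_cases hwl : w ∈ v :: l
          · exact Or.inr ⟨(mem_nb.1 hw'.1).ne', hwl, hw'.2⟩
          · exact Or.inl ⟨hw'.1, hex w hw hwl⟩
        rw [Finset.card_erase_of_mem (by simp [hv]), hc] at h1
        omega
    · exact Or.inr h

open Classical in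
/-- A long path through `F` yields a contradiction. -/
theorem few {V : Type} [Fintype V] {G : SimpleGraph V} {p n m t : ℕ} {x : V}
    (C : Ctx G p n m t x) (h2 : t + 2 ≤ 2 * p) (hE : (eset G t x).card ≤ t) : False := by
  have := C.hD
  have := C.hn
  obtain ⟨f, hf, hfE⟩ := Finset.exists_mem_notMem_of_card_lt_card
    (show (eset G t x).card < (nb Gᶜ x).card by omega)
  rcases fpath C hf hfE t le_rfl with ⟨v, l, h, hv, hl, hc, -⟩ |
    ⟨v, l, r, hr, h, hv, hl, hc, hPE, hrE⟩
  · exact star C h (by omega) (by omega)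
  · have q1 : (nb G v ∩ eset G t x).card ≤ (eset G t x).card :=
      Finset.card_le_card Finset.inter_subset_right
    obtain ⟨e, he⟩ : (nb G v ∩ eset G t x).Nonempty := by rw [← Finset.card_pos]; omega
    rw [Finset.mem_inter, mem_nb] at he
    have hel : e ∉ v :: l := fun hh => hPE e hh he.2
    have k := h.cons he.1 hel
    have kD := cntD_cons _ hel (eset_sub he.2)
    have kc := cnt k
    rw [List.length_cons] at kc
    have kE : (eset G t x).card ≤ (eset G t x \ (e :: v :: l).toFinset).card + 1 := by
      have : eset G t x \ (e :: v :: l).toFinset = (eset G t x).erase e := by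
        ext a
        rw [Finset.mem_sdiff, List.mem_toFinset, Finset.mem_erase, List.mem_cons]
        constructor
        · rintro ⟨a1, a2⟩; exact ⟨fun hh => a2 (Or.inl hh), a1⟩
        · rintro ⟨a1, a2⟩
          refine ⟨a2, ?_⟩
          rintro (hh | hh)
          · exact a1 hh
          · exact hPE a hh a2
      rw [this, Finset.card_erase_of_mem he.2]
      omega
    obtain ⟨v', l', b1, b2, b3, b4, b5, b6⟩ := chainE (nb G x) (nb Gᶜ x) (eset G t x) (t + 1)
      eset_sub (disjAD G x) (eset_inter C) (t - 1 - r) e (v :: l) k he.2 (by omega) (by omega)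
    rw [List.length_cons] at b3
    have := C.ht
    exact star C b1 (by omega) (by omega)

open Classical in
theorem caseI {V : Type} [Fintype V] {G : SimpleGraph V} {p n m t : ℕ} {x : V}
    (C : Ctx G p n m t x) (ht : t + 1 ≤ p) : False := by
  by_cases hE : (eset G t x).card ≤ t
  · exact few C (by omega) hE
  · obtain ⟨e, he⟩ : (eset G t x).Nonempty := by rw [← Finset.card_pos]; omega
    obtain ⟨a, ha, h, hc⟩ := base C (eset_sub he)
    have kc := cnt h
    have kE := Finset.le_card_sdiff [e, a, x].toFinset (eset G t x)
    have kE : (eset G t x).card ≤ (eset G t x \ [e, a, x].toFinset).card + 1 := by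
      have h1 := Finset.card_sdiff_add_card_inter (eset G t x) [e, a, x].toFinset
      have h2 : (eset G t x ∩ [e, a, x].toFinset).card ≤
          ([e, a, x].toFinset ∩ nb Gᶜ x).card := by
        apply Finset.card_le_card
        intro b hb
        rw [Finset.mem_inter] at hb ⊢
        exact ⟨hb.2, eset_sub hb.1⟩
      omega
    have hl : [a, x].length = 2 := rfl
    obtain ⟨v', l', b1, b2, b3, b4, b5, b6⟩ := chainE (nb G x) (nb Gᶜ x) (eset G t x) (t + 1)
      eset_sub (disjAD G x) (eset_inter C) t e [a, x] h he (by omega) (by omega)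
    exact star C b1 (by omega) (by omega)

open Classical in
theorem caseII {V : Type} [Fintype V] {G : SimpleGraph V} {p n m : ℕ} {x : V}
    (C : Ctx G p n m p x) : False := by
  have cD := C.hD
  have cA := C.hA
  have cn := C.hn
  have cm := C.hm
  have cp := C.hp
  -- vertices of `E` have no neighbors in `D`
  have hED : p + 1 ≤ (eset G p x).card → ∀ e ∈ eset G p x, ∀ f ∈ nb Gᶜ x, ¬ G.Adj e f := by
    intro hc e he f hf hef
    by_cases hp : p = 1
    · obtain ⟨a, ha, h, hcc⟩ := base C (eset_sub he)
      have hl : [a, x].length = 2 := rfl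
      refine star2 C h (by omega) (by omega) hf ?_ hef
      simp only [List.mem_cons, List.not_mem_nil, or_false]
      rintro (rfl | rfl | rfl)
      · exact hef.ne rfl
      · exact Finset.disjoint_left.1 (disjAD G x) ha hf
      · exact (mem_nb.1 hf).ne rfl
    · have hE' : (eset G p x).card ≤ ((eset G p x) \ {e, f}).card + 2 := by
        have := Finset.le_card_sdiff {e, f} (eset G p x)
        have := Finset.card_le_two (a := e) (b := f)
        omega
      obtain ⟨e1, he1⟩ : ((eset G p x) \ {e, f}).Nonempty := by
        rw [← Finset.card_pos]; omega
      have he1' := he1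
      rw [Finset.mem_sdiff] at he1'
      obtain ⟨a, ha, h, hcc⟩ := base C (eset_sub he1'.1)
      have hl : [a, x].length = 2 := rfl
      have kc := cnt h
      have hsub : (eset G p x) \ {e, f} ⊆ nb Gᶜ x :=
        Finset.sdiff_subset.trans eset_sub
      have kE : ((eset G p x) \ {e, f}).card ≤
          (((eset G p x) \ {e, f}) \ [e1, a, x].toFinset).card + 1 := by
        have h1 := Finset.card_sdiff_add_card_inter ((eset G p x) \ {e, f}) [e1, a, x].toFinset
        have h2 : (((eset G p x) \ {e, f}) ∩ [e1, a, x].toFinset).card ≤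
            ([e1, a, x].toFinset ∩ nb Gᶜ x).card := by
          apply Finset.card_le_card
          intro b hb
          rw [Finset.mem_inter] at hb ⊢
          exact ⟨hb.2, hsub hb.1⟩
        omega
      obtain ⟨v, l, b1, b2, b3, b4, b5, b6⟩ := chainE (nb G x) (nb Gᶜ x)
        ((eset G p x) \ {e, f}) (p + 1) hsub (disjAD G x)
        (fun u hu u' hu' => eset_inter C u (Finset.mem_sdiff.1 hu).1 u' (Finset.mem_sdiff.1 hu').1)
        (p - 2) e1 [a, x] h he1 (by omega) (by omega)
      have hnot : ∀ g ∈ nb Gᶜ x, g ∈ ({e, f} : Finset V) → g ∉ v :: l := by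
        intro g hg hgef hgl
        rcases b6 g hgl with hh | hh | hh
        · simp only [List.mem_cons, List.not_mem_nil, or_false] at hh
          rcases hh with rfl | rfl | rfl
          · exact he1'.2 hgef
          · exact Finset.disjoint_left.1 (disjAD G x) ha hg
          · exact (mem_nb.1 hg).ne rfl
        · exact Finset.disjoint_left.1 (disjAD G x) hh hg
        · exact (Finset.mem_sdiff.1 hh).2 hgef
      have hel := hnot e (eset_sub he) (by simp)
      have hfl := hnot f hf (by simp)
      have hve : v ≠ e := by
        rintro rfl
        exact hel (by simp)
      have hin := eset_inter C v (Finset.mem_sdiff.1 b2).1 e he hve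
      obtain ⟨b, hb, hbl, hP⟩ := step (nb G x) b1 (by omega) hel
      have c1 : e ∉ b :: v :: l := by
        have := hP.nodup
        exact (List.nodup_cons.1 this).1
      have c2 := cntD_cons _ c1 (eset_sub he)
      have c3 : ((v :: l).toFinset ∩ nb Gᶜ x).card ≤ ((b :: v :: l).toFinset ∩ nb Gᶜ x).card := by
        apply Finset.card_le_card
        apply Finset.inter_subset_inter_right
        intro g hg
        rw [List.mem_toFinset] at hg ⊢
        exact List.mem_cons_of_mem _ hg
      refine star2 C hP (by simp only [List.length_cons]; omega) (by omega) hf ?_ hef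
      rw [List.mem_cons, List.mem_cons]
      rintro (rfl | rfl | hh)
      · exact hef.ne rfl
      · exact Finset.disjoint_left.1 (disjAD G x) hb hf
      · exact hfl hh
  by_cases hF : nb Gᶜ x ⊆ eset G p x
  · have hc := Finset.card_le_card hF
    have hED' := hED (by omega)
    refine C.noc (bip (nb G x) (insert x (nb Gᶜ x)) ?_ (by omega) ?_ ?_)
    · rw [Finset.disjoint_left]
      intro a ha hb
      rw [Finset.mem_insert] at hb
      rcases hb with rfl | hb
      · exact (mem_nb.1 ha).ne rfl
      · exact Finset.disjoint_left.1 (disjAD G x) ha hb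
    · rw [Finset.card_insert_of_notMem]
      · omega
      · rw [mem_nb]; exact fun hh => hh.ne rfl
    · intro y hy a ha
      rw [Finset.mem_insert] at ha
      rcases ha with rfl | ha
      · exact (mem_nb.1 hy).symm
      · have s1 := splitAD ha
        have s2 : nb G a ∩ nb Gᶜ x = ∅ := by
          rw [← Finset.disjoint_iff_inter_eq_empty, Finset.disjoint_left]
          intro f hf hf2
          exact hED' a (hF ha) f hf2 (mem_nb.1 hf)
        rw [s2, Finset.card_empty] at s1
        have s3 := C.deg a
        have s4 : nb G a ∩ nb G x = nb G x :=
          Finset.eq_of_subset_of_card_le Finset.inter_subset_right (by omega)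
        rw [← s4, Finset.mem_inter, mem_nb] at hy
        exact hy.1.symm
  · obtain ⟨f, hf, hfE⟩ := Finset.not_subset.1 hF
    by_cases hp : p = 1
    · obtain ⟨a, ha, h, hcc⟩ := base C hf
      have hl : [a, x].length = 2 := rfl
      apply hfE
      rw [eset, Finset.mem_filter]
      refine ⟨hf, ?_⟩
      have : nb G f ∩ nb Gᶜ x = ∅ := by
        rw [← Finset.disjoint_iff_inter_eq_empty, Finset.disjoint_left]
        intro g hg hg2
        rw [mem_nb] at hg
        refine star2 C h (by omega) (by omega) hg2 ?_ hg
        simp only [List.mem_cons, List.not_mem_nil, or_false]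
        rintro (rfl | rfl | rfl)
        · exact hg.ne rfl
        · exact Finset.disjoint_left.1 (disjAD G x) ha hg2
        · exact (mem_nb.1 hg2).ne rfl
      rw [this]; simp
    · by_cases hE : (eset G p x).card ≤ p
      · exact few C (by omega) hE
      · rcases fpath C hf hfE p le_rfl with ⟨v, l, h, hv, hl, hc, -⟩ |
          ⟨v, l, r, hr, h, hv, hl, hc, hPE, hrE⟩
        · exact star C h (by omega) (by omega)
        · obtain ⟨e, he⟩ : (nb G v ∩ eset G p x).Nonempty := by rw [← Finset.card_pos]; omega
          rw [Finset.mem_inter, mem_nb] at he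
          exact hED (by omega) e he.2 v hv he.1.symm

theorem core {V : Type} [Fintype V] {G : SimpleGraph V} {p n m : ℕ} (hn : 2 * p + 1 ≤ n)
    (hm : 1 ≤ m) (hp : 1 ≤ p)
    (hV : Fintype.card V + 1 = 2 * (n + m + p))
    (hG : ¬ HasCopy (LinkedDoubleStar (2 * p + 1) n m) G)
    (hGc : ¬ HasCopy (LinkedDoubleStar (2 * p + 1) n m) Gᶜ) (x : V)
    (h1 : ∀ v, (nb G v).card ≤ (nb G x).card) (h2 : ∀ v, (nb Gᶜ v).card ≤ (nb G x).card) :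
    False := by
  have hh := heavy hn hm hV hG hGc x
  have hx := nb_compl G x
  have hx2 := h2 x
  have C : Ctx G p n m (n + m + 2 * p - 1 - (nb G x).card) x :=
    ⟨hn, hm, hp, hG, by omega, by omega, by omega, by
      intro v
      have := nb_compl G v
      have := h2 v
      omega, by
      intro v
      have := h1 v
      omega⟩
  rcases Nat.lt_or_ge (n + m + 2 * p - 1 - (nb G x).card) p with h | h
  · exact caseI C h
  · have e : n + m + 2 * p - 1 - (nb G x).card = p := le_antisymm C.ht h
    rw [e] at C
    exact caseII C

theorem main {V : Type} [Fintype V] {G : SimpleGraph V} {p n m : ℕ} (hn : 2 * p + 1 ≤ n)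
    (hm : 1 ≤ m) (hp : 1 ≤ p)
    (hV : Fintype.card V + 1 = 2 * (n + m + p)) :
    HasCopy (LinkedDoubleStar (2 * p + 1) n m) G ∨
      HasCopy (LinkedDoubleStar (2 * p + 1) n m) Gᶜ := by
  by_contra hcon
  rw [not_or] at hcon
  obtain ⟨hG, hGc⟩ := hcon
  have : Nonempty V := Fintype.card_pos_iff.1 (by omega)
  obtain ⟨x, -, hx⟩ := Finset.exists_max_image Finset.univ (fun v => (nb G v).card)
    Finset.univ_nonempty
  obtain ⟨y, -, hy⟩ := Finset.exists_max_image Finset.univ (fun v => (nb Gᶜ v).card)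
    Finset.univ_nonempty
  rcases le_total (nb Gᶜ y).card (nb G x).card with h | h
  · exact core hn hm hp hV hG hGc x (fun v => hx v (Finset.mem_univ v))
      (fun v => (hy v (Finset.mem_univ v)).trans h)
  · refine core (G := Gᶜ) hn hm hp hV hGc (by rwa [compl_compl]) y
      (fun v => hy v (Finset.mem_univ v)) ?_
    intro v
    rw [compl_compl]
    exact (hx v (Finset.mem_univ v)).trans h

end LDS

/-- if `n ≥ 2p + 1` then `r(S_c(n,m)) ≤ 2(n+m+p) − 1`; that is,
every 2-coloring of `K_{2(n+m+p)−1}` contains a monochromatic `S_c(n,m)`. -/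
theorem lds_upper_bound_one (n m p : ℕ) (hm : 1 ≤ m) (hmn : m ≤ n) (hp : 1 ≤ p)
    (hn : 2 * p + 1 ≤ n) :
    ramseyLDS (2 * p + 1) n m ≤ 2 * (n + m + p) - 1 ∧
    IsRamseyLDS (2 * p + 1) n m (2 * (n + m + p) - 1) := by
  have key : IsRamseyLDS (2 * p + 1) n m (2 * (n + m + p) - 1) := by
    intro G
    exact LDS.main hn hm hp (by rw [Fintype.card_fin]; omega)
  refine ⟨?_, key⟩
  unfold ramseyLDS
  exact Nat.sInf_le ⟨by omega, key⟩
end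

section
/- Let p ≥ 4 be an integer, set c = 2p+1, and let n be an integer with 2 ≤ n ≤ p − 2. Then r(S_c(n,2)) ≤ n + 3p + 3; that is, every 2-coloring of the edges of the complete graph on n + 3p + 3 vertices contains a monochromatic copy of S_c(n,2). -/
open SimpleGraph

set_option linter.all false
section ldsproof
variable {V : Type*} [Fintype V] [DecidableEq V]

/-- `PO G a S b`: there is a simple path in `G` from `a` to `b` with vertex set exactly `S`. -/
inductive PO (G : SimpleGraph V) : V → Finset V → V → Prop
  | single (a : V) : PO G a {a} a
  | cons {a b c : V} {S : Finset V} : G.Adj a b → a ∉ S → PO G b S c → PO G a (insert a S) c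

theorem PO.left_mem {G : SimpleGraph V} {a b : V} {S : Finset V} (h : PO G a S b) : a ∈ S := by
  cases h <;> simp

theorem PO.right_mem {G : SimpleGraph V} {a b : V} {S : Finset V} (h : PO G a S b) : b ∈ S := by
  induction h with
  | single a => simp
  | cons _ _ _ ih => exact Finset.mem_insert_of_mem ih

theorem PO.append {G : SimpleGraph V} {a b c d : V} {S T : Finset V} (h : PO G a S b)
    (h' : PO G c T d) (hbc : G.Adj b c) (hd : Disjoint S T) : PO G a (S ∪ T) d := by
  induction h with
  | single a =>
    rw [Finset.singleton_union]
    exact PO.cons hbc (by simpa using hd) h'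
  | @cons a b e S hab ha _ ih =>
    rw [Finset.insert_union]
    rw [Finset.disjoint_insert_left] at hd
    exact PO.cons hab (by simp [ha, hd.1]) (ih hbc hd.2)

theorem PO.rev {G : SimpleGraph V} {a b : V} {S : Finset V} (h : PO G a S b) : PO G b S a := by
  induction h with
  | single a => exact PO.single a
  | @cons a b e S hab ha h ih =>
    have := ih.append (PO.single a) hab.symm (by simpa using ha)
    rwa [Finset.union_comm, Finset.singleton_union] at this

theorem PO.mono {G H : SimpleGraph V} (hGH : G ≤ H) {a b : V} {S : Finset V} (h : PO G a S b) :
    PO H a S b := by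
  induction h with
  | single a => exact PO.single a
  | cons hab ha _ ih => exact PO.cons (hGH hab) ha ih

theorem PO.snoc {G : SimpleGraph V} {a b c : V} {S : Finset V} (h : PO G a S b)
    (hbc : G.Adj b c) (hc : c ∉ S) : PO G a (insert c S) c := by
  have := h.append (PO.single c) hbc (by simpa using hc)
  rwa [Finset.union_comm, Finset.singleton_union] at this

/-- A path as an injective sequence. -/
theorem PO.seq {G : SimpleGraph V} {a b : V} {S : Finset V} (h : PO G a S b) :
    ∃ g : ℕ → V, g 0 = a ∧ g (S.card - 1) = b ∧
      (∀ i j, i < S.card → j < S.card → g i = g j → i = j) ∧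
      (∀ i, i + 1 < S.card → G.Adj (g i) (g (i + 1))) ∧
      (∀ v, v ∈ S ↔ ∃ i, i < S.card ∧ g i = v) := by
  induction h with
  | single a => exact ⟨fun _ => a, by simp; exact fun v => eq_comm⟩
  | @cons a b c S hab ha hp ih =>
    obtain ⟨g, h0, h1, h2, h3, h4⟩ := ih
    have hc : (insert a S).card = S.card + 1 := Finset.card_insert_of_notMem ha
    have hpos : 0 < S.card := Finset.card_pos.2 ⟨_, hp.left_mem⟩
    refine ⟨fun i => if i = 0 then a else g (i - 1), by simp, ?_, ?_, ?_, ?_⟩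
    · rw [hc]
      have : S.card + 1 - 1 ≠ 0 := by omega
      simp only [this, if_false]
      rw [← h1]; congr 1
    · intro i j hi hj hij
      rw [hc] at hi hj
      by_cases hi0 : i = 0 <;> by_cases hj0 : j = 0
      · omega
      · simp only [hi0, hj0, if_true, if_false] at hij
        exact absurd ((h4 a).2 ⟨j - 1, by omega, hij.symm⟩) ha
      · simp only [hi0, hj0, if_true, if_false] at hij
        exact absurd ((h4 a).2 ⟨i - 1, by omega, hij⟩) ha
      · simp only [hi0, hj0, if_false] at hij
        have := h2 (i - 1) (j - 1) (by omega) (by omega) hij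
        omega
    · intro i hi
      rw [hc] at hi
      by_cases hi0 : i = 0
      · subst hi0; simpa [h0] using hab
      · have := h3 (i - 1) (by omega)
        have e : i - 1 + 1 = i := by omega
        rw [e] at this
        simpa [hi0] using this
    · intro v
      rw [hc, Finset.mem_insert, h4]
      constructor
      · rintro (rfl | ⟨i, hi, rfl⟩)
        · exact ⟨0, by omega, by simp⟩
        · exact ⟨i + 1, by omega, by simp⟩
      · rintro ⟨i, hi, rfl⟩
        by_cases hi0 : i = 0
        · left; simp [hi0]
        · right; exact ⟨i - 1, by omega, by simp [hi0]⟩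

/-- An injective sequence of consecutive adjacent vertices gives a path. -/
theorem PO.of_seq {G : SimpleGraph V} (s : ℤ → V) (a : ℤ) (m : ℕ)
    (hinj : ∀ i j, a ≤ i → i ≤ a + m → a ≤ j → j ≤ a + m → s i = s j → i = j)
    (hadj : ∀ i, a ≤ i → i < a + m → G.Adj (s i) (s (i + 1))) :
    PO G (s a) ((Finset.Icc a (a + m)).image s) (s (a + m)) := by
  induction m with
  | zero => simpa using PO.single (s a)
  | succ m ih =>
    have h := ih (fun i j h1 h2 h3 h4 => hinj i j h1 (by push_cast; omega) h3 (by push_cast; omega))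
      (fun i h1 h2 => hadj i h1 (by push_cast; omega))
    have e : ((m + 1 : ℕ) : ℤ) = (m : ℤ) + 1 := by push_cast; rfl
    have h' := h.snoc (c := s (a + m + 1)) (hadj _ (by omega) (by push_cast; omega)) (by
      simp only [Finset.mem_image, Finset.mem_Icc, not_exists, not_and]
      intro i hi he
      have := hinj i (a + m + 1) hi.1 (by push_cast; omega) (by omega) (by push_cast; omega) he
      omega)
    rw [← Finset.image_insert] at h'
    have e2 : insert (a + (m : ℤ) + 1) (Finset.Icc a (a + m)) = Finset.Icc a (a + (m + 1 : ℕ)) := by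
      ext x; simp only [Finset.mem_insert, Finset.mem_Icc]; push_cast; omega
    rw [e2] at h'
    convert h' using 1
    push_cast; congr 1; ring

/-- `Cyc G l f`: the `l`-periodic sequence `f` runs around a cycle of length `l` in `G`. -/
def Cyc (G : SimpleGraph V) (l : ℕ) (f : ℤ → V) : Prop :=
  3 ≤ l ∧ (∀ i j, f i = f j ↔ (l : ℤ) ∣ i - j) ∧ ∀ i, G.Adj (f i) (f (i + 1))

/-- The neighbourhood as a finset. -/
noncomputable def nb (G : SimpleGraph V) (v : V) : Finset V := by
  classical exact Finset.univ.filter (fun w => G.Adj v w)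

@[simp] theorem mem_nb {G : SimpleGraph V} {v w : V} : w ∈ nb G v ↔ G.Adj v w := by
  simp [nb]

/-- The vertex set of a periodic sequence. -/
noncomputable def rg (f : ℤ → V) : Finset V := by
  classical exact Finset.univ.filter (fun w => ∃ i, f i = w)

@[simp] theorem mem_rg {f : ℤ → V} {w : V} : w ∈ rg f ↔ ∃ i, f i = w := by
  simp [rg]

namespace Cyc
variable {G : SimpleGraph V} {l : ℕ} {f : ℤ → V}

theorem inj (h : Cyc G l f) {i j : ℤ} (hij : f i = f j) (h1 : i - j < l) (h2 : j - i < l) :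
    i = j := by
  have := (h.2.1 i j).1 hij
  obtain ⟨c, hc⟩ := this
  have hl : (0 : ℤ) < l := by have := h.1; omega
  have : c = 0 := by
    by_contra hne
    rcases lt_or_gt_of_ne hne with h' | h'
    · nlinarith
    · nlinarith
  subst this; omega

theorem per (h : Cyc G l f) (i : ℤ) : f (i + l) = f i := (h.2.1 _ _).2 ⟨1, by ring⟩

theorem per' (h : Cyc G l f) {i j : ℤ} (hij : i = j + l) : f i = f j := by rw [hij, h.per]

theorem ne (h : Cyc G l f) {i j : ℤ} (hij : i ≠ j) (h1 : i - j < l) (h2 : j - i < l) :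
    f i ≠ f j := fun e => hij (h.inj e h1 h2)

/-- every vertex has an index in a given window -/
theorem win (h : Cyc G l f) (i a : ℤ) : ∃ j, a ≤ j ∧ j < a + l ∧ f j = f i := by
  have hl : (0 : ℤ) < l := by have := h.1; omega
  refine ⟨a + (i - a) % l, ?_, ?_, ?_⟩
  · have := Int.emod_nonneg (i - a) hl.ne'; omega
  · have := Int.emod_lt_of_pos (i - a) hl; omega
  · rw [h.2.1]
    have := Int.emod_add_mul_ediv (i - a) l
    refine ⟨-((i - a) / l), ?_⟩
    linarith

theorem arc (h : Cyc G l f) (a b : ℤ) (hab : a ≤ b) (hb : b < a + l) :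
    PO G (f a) ((Finset.Icc a b).image f) (f b) := by
  obtain ⟨m, rfl⟩ : ∃ m : ℕ, b = a + m := ⟨(b - a).toNat, by omega⟩
  apply PO.of_seq
  · intro i j _ _ _ _ hij
    exact h.inj hij (by omega) (by omega)
  · intro i _ _; exact h.2.2 i

theorem arc_card (h : Cyc G l f) (a b : ℤ) (hab : a ≤ b) (hb : b < a + l) :
    (((Finset.Icc a b).image f).card : ℤ) = b - a + 1 := by
  rw [Finset.card_image_of_injOn]
  · simp; omega
  · intro i hi j hj hij
    simp at hi hj
    exact h.inj hij (by omega) (by omega)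

theorem arc_full (h : Cyc G l f) (a b : ℤ) (hb : b = a + l - 1) :
    (Finset.Icc a b).image f = rg f := by
  ext v
  simp only [Finset.mem_image, Finset.mem_Icc, mem_rg]
  constructor
  · rintro ⟨i, _, rfl⟩; exact ⟨i, rfl⟩
  · rintro ⟨i, rfl⟩
    obtain ⟨j, h1, h2, h3⟩ := h.win i a
    exact ⟨j, ⟨h1, by omega⟩, h3⟩

theorem card_rg (h : Cyc G l f) : (rg f).card = l := by
  have := h.1
  have h2 := h.arc_card 0 (l - 1) (by omega) (by omega)
  rw [h.arc_full 0 (l - 1) (by ring)] at h2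
  omega

theorem neg (h : Cyc G l f) : Cyc G l (fun i => f (-i)) := by
  refine ⟨h.1, fun i j => ?_, fun i => ?_⟩
  · rw [h.2.1]
    constructor
    · rintro ⟨c, hc⟩; exact ⟨-c, by linarith⟩
    · rintro ⟨c, hc⟩; exact ⟨-c, by linarith⟩
  · have := h.2.2 (-(i+1))
    have e : -(i+1) + 1 = -i := by ring
    rw [e] at this
    exact this.symm

theorem shift (h : Cyc G l f) (c : ℤ) : Cyc G l (fun i => f (i + c)) := by
  refine ⟨h.1, fun i j => ?_, fun i => ?_⟩
  · rw [h.2.1]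
    have : i + c - (j + c) = i - j := by ring
    rw [this]
  · have := h.2.2 (i + c)
    have e : i + c + 1 = i + 1 + c := by ring
    rwa [e] at this

theorem rg_neg : rg (fun i => f (-i)) = rg f := by
  ext v; simp only [mem_rg]
  exact ⟨fun ⟨i, hi⟩ => ⟨-i, hi⟩, fun ⟨i, hi⟩ => ⟨-i, by simpa using hi⟩⟩

theorem rg_shift (c : ℤ) : rg (fun i => f (i + c)) = rg f := by
  ext v; simp only [mem_rg]
  exact ⟨fun ⟨i, hi⟩ => ⟨i + c, hi⟩, fun ⟨i, hi⟩ => ⟨i - c, by simpa using hi⟩⟩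

theorem mono {H : SimpleGraph V} (hGH : G ≤ H) (h : Cyc G l f) : Cyc H l f :=
  ⟨h.1, h.2.1, fun i => hGH (h.2.2 i)⟩

/-- a shift map on the cycle -/
theorem exists_shift_map (h : Cyc G l f) (c : ℤ) : ∃ s : V → V, (∀ i, s (f i) = f (i + c)) := by
  classical
  refine ⟨fun v => if hv : ∃ i, f i = v then f (hv.choose + c) else v, fun i => ?_⟩
  have hv : ∃ j, f j = f i := ⟨i, rfl⟩
  simp only [hv, dif_pos]
  have := (h.2.1 _ _).1 hv.choose_spec
  rw [h.2.1]
  have e : hv.choose + c - (i + c) = hv.choose - i := by ring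
  rwa [e]

theorem shift_inj (h : Cyc G l f) {i j : ℤ} (c : ℤ) : f (i + c) = f (j + c) ↔ f i = f j := by
  rw [h.2.1, h.2.1]
  have e : i + c - (j + c) = i - j := by ring
  rw [e]

end Cyc

/-- Closing a path to a cycle. -/
theorem PO.close {G : SimpleGraph V} {a b : V} {S : Finset V} (h : PO G a S b)
    (hba : G.Adj b a) (hS : 3 ≤ S.card) :
    ∃ f, Cyc G S.card f ∧ rg f = S := by
  obtain ⟨g, h0, h1, h2, h3, h4⟩ := h.seq
  have hl : (0 : ℤ) < S.card := by omega
  have hb : ∀ i : ℤ, (i % S.card).toNat < S.card := fun i => by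
    have := Int.emod_lt_of_pos i hl
    have := Int.emod_nonneg i hl.ne'
    omega
  refine ⟨fun i => g (i % S.card).toNat, ⟨hS, fun i j => ?_, fun i => ?_⟩, ?_⟩
  · constructor
    · intro hij
      have := h2 _ _ (hb i) (hb j) hij
      have a1 := Int.emod_nonneg i hl.ne'
      have a2 := Int.emod_nonneg j hl.ne'
      exact Int.ModEq.dvd (n := S.card) (a := j) (b := i) (by unfold Int.ModEq; omega)
    · intro hd
      have h5 : j ≡ i [ZMOD S.card] := (Int.modEq_iff_dvd).2 hd
      have : i % S.card = j % S.card := h5.symm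
      simp only [this]
  · have a1 := Int.emod_nonneg i hl.ne'
    have a3 := Int.emod_lt_of_pos i hl
    by_cases hlast : i % S.card = S.card - 1
    · have e : (i + 1) % S.card = 0 := by
        rw [Int.add_emod, hlast]
        rcases eq_or_lt_of_le hS with h' | h'
        · rw [← h']; norm_num
        · rw [Int.emod_eq_of_lt (a := 1) (by omega) (by omega)]; simp
      simp only [hlast, e]
      have e2 : ((S.card : ℤ) - 1).toNat = S.card - 1 := by omega
      rw [e2]; simpa [h0, h1] using hba
    · have e : (i + 1) % S.card = i % S.card + 1 := by
        rw [Int.add_emod, Int.emod_eq_of_lt (a := 1) (by omega) (by omega)]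
        exact Int.emod_eq_of_lt (by omega) (by omega)
      simp only [e]
      have e2 : (i % S.card + 1).toNat = (i % S.card).toNat + 1 := by omega
      rw [e2]
      exact h3 _ (by omega)
  · ext v
    rw [mem_rg, h4]
    constructor
    · rintro ⟨i, rfl⟩; exact ⟨_, hb i, rfl⟩
    · rintro ⟨i, hi, rfl⟩
      refine ⟨i, ?_⟩
      have : ((i : ℤ) % S.card).toNat = i := by
        rw [Int.emod_eq_of_lt (by omega) (by omega)]; simp
      simp only [this]

end ldsproof

section ldsproof
variable {V : Type*} [Fintype V] [DecidableEq V]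

theorem PO.close' {G : SimpleGraph V} {a b : V} {S : Finset V} {l : ℕ} (h : PO G a S b)
    (hba : G.Adj b a) (hc : S.card = l) (hS : 3 ≤ l) :
    ∃ f, Cyc G l f ∧ rg f = S := by
  subst hc; exact h.close hba hS

namespace Cyc
variable {G : SimpleGraph V} {l : ℕ} {f : ℤ → V}

theorem mem_arc (h : Cyc G l f) {a b i : ℤ} (h1 : a ≤ i) (h2 : i ≤ b) :
    f i ∈ (Finset.Icc a b).image f :=
  Finset.mem_image_of_mem _ (Finset.mem_Icc.2 ⟨h1, h2⟩)

theorem not_mem_arc (h : Cyc G l f) {a b i : ℤ} (h1 : b < i) (h2 : i < a + l) :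
    f i ∉ (Finset.Icc a b).image f := by
  simp only [Finset.mem_image, Finset.mem_Icc, not_exists, not_and]
  intro j hj e
  have := h.inj e (by omega) (by omega)
  omega

theorem arc_sub (a b : ℤ) : (Finset.Icc a b).image f ⊆ rg f := by
  intro v; simp only [Finset.mem_image, mem_rg]
  rintro ⟨i, _, hi⟩; exact ⟨i, hi⟩

theorem arc_disj (h : Cyc G l f) {a b c d : ℤ} (h1 : b < c) (h2 : d < a + l) :
    Disjoint ((Finset.Icc a b).image f) ((Finset.Icc c d).image f) := by
  rw [Finset.disjoint_left]
  simp only [Finset.mem_image, Finset.mem_Icc, not_exists, not_and]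
  rintro v ⟨i, hi, rfl⟩ j hj e
  have := h.inj e (by omega) (by omega)
  omega

theorem arc_union (h : Cyc G l f) {a b c d : ℤ} (h1 : c = b + 1) (hab : a ≤ c) (hcd : b ≤ d)
    (h2 : d = a + l - 1) :
    ((Finset.Icc a b).image f) ∪ ((Finset.Icc c d).image f) = rg f := by
  rw [← Finset.image_union, ← h.arc_full a d h2]
  congr 1
  ext x; simp only [Finset.mem_union, Finset.mem_Icc]; omega

/-- two distinct vertices: choose indices in order -/
theorem order (h : Cyc G l f) (i j : ℤ) (hne : f i ≠ f j) :
    ∃ j', j' < i ∧ i < j' + l ∧ f j' = f j := by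
  obtain ⟨j', h1, h2, h3⟩ := h.win j (i - l)
  refine ⟨j', by omega, ?_, h3⟩
  rcases eq_or_lt_of_le h1 with h' | h'
  · exfalso; apply hne; rw [← h3, ← h']
    exact h.per' (by ring)
  · omega

end Cyc

/-- insertion step of Jackson's lemma -/
theorem jackson_ins {H : SimpleGraph V} {X Y : Finset V} {K m : ℕ} (hd : Disjoint X Y)
    (hb : ∀ u v, H.Adj u v → (u ∈ X ∧ v ∈ Y) ∨ (u ∈ Y ∧ v ∈ X))
    (hK : ∀ x ∈ X, K ≤ (nb H x).card) (hY : Y.card + 2 ≤ 2 * K)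
    {f : ℤ → V} (hf : Cyc H (2 * m) f) {z : V} (hzY : z ∈ Y) (hz : z ∈ rg f)
    (hm : (rg f ∩ Y).card = m) (hmK : m + 1 ≤ K) {v : V} (hvX : v ∈ X) (hv : v ∉ rg f) :
    ∃ g, Cyc H (2 * m + 2) g ∧ rg g ∩ X = insert v (rg f ∩ X) ∧ z ∈ rg g := by
  have hXY : ∀ {x}, x ∈ X → x ∉ Y := fun hx hy => Finset.disjoint_left.1 hd hx hy
  have nbX : ∀ {x}, x ∈ X → nb H x ⊆ Y := by
    intro x hx y hy
    rcases hb x y (mem_nb.1 hy) with h | h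
    · exact h.2
    · exact absurd h.1 (hXY hx)
  have adjX : ∀ {x y}, H.Adj x y → x ∈ X → y ∈ Y := fun h hx => nbX hx (mem_nb.2 h)
  have adjY : ∀ {x y}, H.Adj x y → x ∈ Y → y ∈ X := by
    intro x y h hx
    rcases hb x y h with h | h
    · exact absurd hx (hXY h.1)
    · exact h.2
  have h3 := hf.1
  have hcard := hf.card_rg
  by_cases hT : nb H v ∩ rg f = ∅
  · obtain ⟨j, hj⟩ := mem_rg.1 hz
    have hi : f (j + 1) ∈ X := adjY (hf.2.2 j) (hj ▸ hzY)
    have hi1 : f (j + 1 + 1) ∈ Y := adjX (hf.2.2 _) hi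
    have hi2 : f (j + 1 + 1 + 1) ∈ X := adjY (hf.2.2 _) hi1
    have hout : ∀ u, H.Adj v u → u ∉ rg f := by
      intro u hu hu'
      have : u ∈ nb H v ∩ rg f := by simp [hu]; simpa using hu'
      rw [hT] at this; simp at this
    have hcom : ∀ x ∈ X, 2 ≤ (nb H x ∩ nb H v).card := by
      intro x hx
      have h1 := Finset.card_union_add_card_inter (nb H x) (nb H v)
      have h2 := Finset.card_le_card (Finset.union_subset (nbX hx) (nbX hvX))
      have := hK x hx; have := hK v hvX
      omega
    obtain ⟨u, hu⟩ := Finset.card_pos.1 (lt_of_lt_of_le Nat.zero_lt_two (hcom _ hi))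
    obtain ⟨u', hu', huu⟩ := Finset.exists_mem_ne (hcom _ hi2) u
    simp only [Finset.mem_inter, mem_nb] at hu hu'
    have huS := hout u hu.2
    have huS' := hout u' hu'.2
    have huY := adjX hu.2 hvX
    have huY' := adjX hu'.2 hvX
    have hvu : v ≠ u := fun e => hXY hvX (e ▸ huY)
    have hvu' : v ≠ u' := fun e => hXY hvX (e ▸ huY')
    have hA := hf.arc (j + 3) (j + 1 + 2 * m) (by omega) (by push_cast; omega)
    have hAc := hf.arc_card (j + 3) (j + 1 + 2 * m) (by omega) (by push_cast; omega)
    have hsub := Cyc.arc_sub (f := f) (j + 3) (j + 1 + 2 * m)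
    have e1 : f (j + 1 + 2 * m) = f (j + 1) := hf.per' (by push_cast; ring)
    set A := (Finset.Icc (j + 3) (j + 1 + 2 * m)).image f with hAdef
    have hB := (hA.snoc (c := u) (by rw [e1]; exact hu.1) (fun h => huS (hsub h))).snoc (c := v)
      hu.2.symm (by simp only [Finset.mem_insert, not_or]; exact ⟨hvu, fun h => hv (hsub h)⟩)
    have hC := hB.snoc (c := u') hu'.2 (by
      simp only [Finset.mem_insert, not_or]; exact ⟨hvu'.symm, huu, fun h => huS' (hsub h)⟩)
    obtain ⟨g, hg, hg'⟩ := hC.close' (l := 2 * m + 2) (by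
        have e : j + 3 = j + 1 + 1 + 1 := by ring
        rw [e]; exact hu'.1.symm) (by
        rw [Finset.card_insert_of_notMem, Finset.card_insert_of_notMem, Finset.card_insert_of_notMem]
        · omega
        · exact fun h => huS (hsub h)
        · simp only [Finset.mem_insert, not_or]; exact ⟨hvu, fun h => hv (hsub h)⟩
        · simp only [Finset.mem_insert, not_or]; exact ⟨hvu'.symm, huu, fun h => huS' (hsub h)⟩)
        (by omega)
    refine ⟨g, hg, ?_, ?_⟩
    · rw [hg']
      ext x
      simp only [Finset.mem_inter, Finset.mem_insert]
      constructor
      · rintro ⟨rfl | rfl | rfl | h, hx⟩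
        · exact absurd huY' (hXY hx)
        · simp
        · exact absurd huY (hXY hx)
        · exact Or.inr ⟨hsub h, hx⟩
      · rintro (rfl | ⟨h, hx⟩)
        · simp [hvX]
        · refine ⟨?_, hx⟩
          right; right; right
          obtain ⟨i, rfl⟩ := mem_rg.1 h
          obtain ⟨i', h1, h2, h3⟩ := hf.win i (j + 2)
          rw [← h3]
          refine hf.mem_arc ?_ (by push_cast at h2; omega)
          rcases eq_or_lt_of_le h1 with h' | h'
          · exfalso; apply hXY hx; rw [← h3, ← h']
            have e : j + 2 = j + 1 + 1 := by ring
            rw [e]; exact hi1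
          · omega
    · rw [hg']
      have : f (j + 2 * m) = z := by rw [← hj]; exact hf.per' (by push_cast; ring)
      rw [← this]
      simp only [Finset.mem_insert]
      right; right; right
      exact hf.mem_arc (by omega) (by omega)
  · -- T nonempty
    have hfin : ∀ (P : Finset V) (a b u : V), P = insert u (insert v (rg f)) → u ∈ Y → u ∉ rg f →
        PO H a P b → H.Adj b a →
        ∃ g, Cyc H (2 * m + 2) g ∧ rg g ∩ X = insert v (rg f ∩ X) ∧ z ∈ rg g := by
      intro P a b u hP huY hu hp hba
      obtain ⟨g, hg, hg'⟩ := hp.close' (l := 2 * m + 2) hba (by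
        rw [hP, Finset.card_insert_of_notMem, Finset.card_insert_of_notMem hv]
        · omega
        · simp only [Finset.mem_insert, not_or]; exact ⟨fun e => hXY hvX (e ▸ huY), hu⟩) (by omega)
      refine ⟨g, hg, ?_, ?_⟩
      · rw [hg', hP]
        ext x
        simp only [Finset.mem_inter, Finset.mem_insert]
        constructor
        · rintro ⟨rfl | rfl | h, hx⟩
          · exact absurd huY (hXY hx)
          · simp
          · exact Or.inr ⟨h, hx⟩
        · rintro (rfl | ⟨h, hx⟩)
          · simp [hvX]
          · exact ⟨Or.inr (Or.inr h), hx⟩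
      · rw [hg', hP]; simp only [Finset.mem_insert]; exact Or.inr (Or.inr hz)
    obtain ⟨s, hs⟩ := hf.exists_shift_map 1
    set T := nb H v ∩ rg f with hTdef
    have hTY : ∀ {i}, f i ∈ T → f i ∈ Y := fun h => nbX hvX (Finset.mem_inter.1 h).1
    have hTadj : ∀ {i}, f i ∈ T → H.Adj v (f i) := fun h => mem_nb.1 (Finset.mem_inter.1 h).1
    by_contra hno
    -- shared with v
    have c1 : ∀ i u, f i ∈ T → u ∉ rg f → H.Adj v u → H.Adj (f (i + 1)) u → False := by
      intro i u hi hu hvu hiu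
      apply hno
      have hA := hf.arc (i + 1) (i + 2 * m) (by omega) (by push_cast; omega)
      rw [hf.arc_full _ _ (by push_cast; ring)] at hA
      have e1 : f (i + 2 * m) = f i := hf.per' (by push_cast; ring)
      rw [e1] at hA
      have hB := (hA.snoc (hTadj hi).symm hv).snoc (c := u) hvu (by
        simp only [Finset.mem_insert, not_or]; exact ⟨hvu.ne', hu⟩)
      exact hfin _ _ _ u rfl (adjX hvu hvX) hu hB hiu.symm
    have c2 : ∀ i j u, f i ∈ T → f j ∈ T → f i ≠ f j → u ∉ rg f → H.Adj (f (i + 1)) u →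
        H.Adj (f (j + 1)) u → False := by
      intro i j0 u hi hj0 hne hu hiu hju0
      apply hno
      obtain ⟨j, hj1, hj2, hj3⟩ := hf.order i j0 hne
      have hju : H.Adj (f (j + 1)) u := by
        rw [(hf.shift_inj 1).2 hj3]; exact hju0
      have hj : f j ∈ T := by rw [hj3]; exact hj0
      have huY : u ∈ Y := adjX hiu (adjY (hf.2.2 i) (hTY hi))
      have hA := (hf.arc (j + 1) i (by omega) (by push_cast at *; omega)).rev
      have hA' := hf.arc (i + 1) (j + 2 * m) (by push_cast at *; omega) (by push_cast; omega)
      have e1 : f (j + 2 * m) = f j := hf.per' (by push_cast; ring)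
      have hU := hf.arc_union (a := j + 1) (b := i) (c := i + 1) (d := j + 2 * m) rfl (by omega)
        (by push_cast at *; omega) (by push_cast; ring)
      have hD := hf.arc_disj (a := j + 1) (b := i) (c := i + 1) (d := j + 2 * m) (by omega)
        (by push_cast; omega)
      have s1 := Cyc.arc_sub (f := f) (j + 1) i
      have s2 := Cyc.arc_sub (f := f) (i + 1) (j + 2 * m)
      have hvu : v ≠ u := fun e => hXY hvX (e ▸ huY)
      have hB := (PO.cons (hTadj hi) (fun h => hv (s1 h)) hA).snoc (c := u) hju (by
        simp only [Finset.mem_insert, not_or]; exact ⟨hvu.symm, fun h => hu (s1 h)⟩)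
      have hC := hB.append hA' hiu.symm (by
        simp only [Finset.disjoint_insert_left]
        exact ⟨fun h => hu (s2 h), fun h => hv (s2 h), hD⟩)
      refine hfin _ _ _ u ?_ huY hu hC (by rw [e1]; exact (hTadj hj).symm)
      rw [Finset.insert_union, Finset.insert_union, hU]
    have hvT : v ∉ T.image s := by
      intro h
      obtain ⟨w, hw, hw'⟩ := Finset.mem_image.1 h
      obtain ⟨i, rfl⟩ := mem_rg.1 (Finset.mem_inter.1 hw).2
      rw [hs] at hw'
      exact hv (hw' ▸ mem_rg.2 ⟨_, rfl⟩)
    have hsinj : (T.image s).card = T.card := by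
      apply Finset.card_image_of_injOn
      intro x hx y hy hxy
      obtain ⟨i, rfl⟩ := mem_rg.1 (Finset.mem_inter.1 hx).2
      obtain ⟨j, rfl⟩ := mem_rg.1 (Finset.mem_inter.1 hy).2
      rw [hs, hs] at hxy
      exact (hf.shift_inj 1).1 hxy
    have hdisj : ∀ x ∈ insert v (T.image s), ∀ y ∈ insert v (T.image s), x ≠ y →
        Disjoint (nb H x \ rg f) (nb H y \ rg f) := by
      intro x hx y hy hxy
      rw [Finset.disjoint_left]
      intro u hu hu'
      simp only [Finset.mem_sdiff, mem_nb] at hu hu'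
      have key : ∀ y ∈ T.image s, ∃ i, f i ∈ T ∧ f (i + 1) = y := by
        intro y hy
        obtain ⟨w, hw, rfl⟩ := Finset.mem_image.1 hy
        obtain ⟨i, rfl⟩ := mem_rg.1 (Finset.mem_inter.1 hw).2
        exact ⟨i, hw, (hs i).symm⟩
      rcases Finset.mem_insert.1 hx with rfl | hx <;> rcases Finset.mem_insert.1 hy with rfl | hy
      · exact hxy rfl
      · obtain ⟨i, hi, rfl⟩ := key y hy
        exact c1 i u hi hu.2 hu.1 hu'.1
      · obtain ⟨i, hi, rfl⟩ := key x hx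
        exact c1 i u hi hu.2 hu'.1 hu.1
      · obtain ⟨i, hi, rfl⟩ := key x hx
        obtain ⟨j, hj, rfl⟩ := key y hy
        exact c2 i j u hi hj (fun e => hxy ((hf.shift_inj 1).2 e)) hu.2 hu.1 hu'.1
    have hcb := Finset.card_biUnion hdisj
    have hsubY : (insert v (T.image s)).biUnion (fun x => nb H x \ rg f) ⊆ Y \ rg f := by
      intro u hu
      obtain ⟨x, hx, hxu⟩ := Finset.mem_biUnion.1 hu
      simp only [Finset.mem_sdiff, mem_nb] at hxu ⊢
      refine ⟨?_, hxu.2⟩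
      rcases Finset.mem_insert.1 hx with rfl | hx
      · exact adjX hxu.1 hvX
      · obtain ⟨w, hw, rfl⟩ := Finset.mem_image.1 hx
        obtain ⟨i, rfl⟩ := mem_rg.1 (Finset.mem_inter.1 hw).2
        rw [hs] at hxu
        exact adjX hxu.1 (adjY (hf.2.2 i) (hTY hw))
    have hle := Finset.card_le_card hsubY
    rw [hcb, Finset.sum_insert hvT] at hle
    have hsum : (T.image s).card * (K - m) ≤ ∑ x ∈ T.image s, (nb H x \ rg f).card := by
      rw [← smul_eq_mul]
      apply Finset.card_nsmul_le_sum
      intro x hx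
      have hxX : x ∈ X := by
        obtain ⟨w, hw, rfl⟩ := Finset.mem_image.1 hx
        obtain ⟨i, rfl⟩ := mem_rg.1 (Finset.mem_inter.1 hw).2
        rw [hs]; exact adjY (hf.2.2 i) (hTY hw)
      have a1 := hK x hxX
      have a2 : (nb H x ∩ rg f).card ≤ m := by
        rw [← hm]; apply Finset.card_le_card
        intro y hy
        simp only [Finset.mem_inter] at hy ⊢
        exact ⟨hy.2, nbX hxX hy.1⟩
      have a3 := Finset.card_sdiff_add_card_inter (nb H x) (rg f)
      omega
    have a1 := hK v hvX
    have a2 := Finset.card_sdiff_add_card_inter (nb H v) (rg f)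
    have a3 := Finset.card_sdiff_add_card_inter Y (rg f)
    rw [Finset.inter_comm, hm] at a3
    have a4 : 1 ≤ T.card := Finset.card_pos.2 (Finset.nonempty_of_ne_empty hT)
    rw [hsinj] at hsum
    rw [← hTdef] at a2
    obtain ⟨d, hdd⟩ : ∃ d, K = m + 1 + d := ⟨K - m - 1, by omega⟩
    obtain ⟨t, htt⟩ : ∃ t, T.card = t + 1 := ⟨T.card - 1, by omega⟩
    have : K - m = d + 1 := by omega
    rw [this, htt] at hsum
    have : (t + 1) * (d + 1) = t * d + t + d + 1 := by ring
    have : 0 ≤ t * d := Nat.zero_le _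
    omega

end ldsproof

section ldsproof
variable {V : Type*} [Fintype V] [DecidableEq V]

/-- Jackson's lemma (cycle through all of `X` and a given vertex `z` of `Y`). -/
theorem jackson_aux {H : SimpleGraph V} {X Y : Finset V} {K : ℕ} (hd : Disjoint X Y)
    (hb : ∀ u v, H.Adj u v → (u ∈ X ∧ v ∈ Y) ∨ (u ∈ Y ∧ v ∈ X))
    (hK : ∀ x ∈ X, K ≤ (nb H x).card) (hY : Y.card + 2 ≤ 2 * K)
    (hX2 : 2 ≤ X.card) (hXK : X.card ≤ K) {z : V} (hzY : z ∈ Y) (hz : 2 ≤ (nb H z).card) :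
    ∃ f, Cyc H (2 * X.card) f ∧ X ⊆ rg f ∧ z ∈ rg f := by
  have hXY : ∀ {x}, x ∈ X → x ∉ Y := fun hx hy => Finset.disjoint_left.1 hd hx hy
  have nbX : ∀ {x}, x ∈ X → nb H x ⊆ Y := by
    intro x hx y hy
    rcases hb x y (mem_nb.1 hy) with h | h
    · exact h.2
    · exact absurd h.1 (hXY hx)
  have adjX : ∀ {x y}, H.Adj x y → x ∈ X → y ∈ Y := fun h hx => nbX hx (mem_nb.2 h)
  have adjY : ∀ {x y}, H.Adj x y → x ∈ Y → y ∈ X := by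
    intro x y h hx
    rcases hb x y h with h | h
    · exact absurd hx (hXY h.1)
    · exact h.2
  have key : ∀ m, 2 ≤ m → m ≤ X.card → ∃ f, Cyc H (2 * m) f ∧ (rg f ∩ X).card = m ∧ z ∈ rg f := by
    intro m hm
    induction m, hm using Nat.le_induction with
    | base =>
      intro _
      obtain ⟨x1, h1, x2, h2, h12⟩ := Finset.one_lt_card.1 (lt_of_lt_of_le Nat.one_lt_two hz)
      rw [mem_nb] at h1 h2
      have hx1 := adjY h1 hzY
      have hx2 := adjY h2 hzY
      have hcom : 2 ≤ (nb H x1 ∩ nb H x2).card := by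
        have a1 := Finset.card_union_add_card_inter (nb H x1) (nb H x2)
        have a2 := Finset.card_le_card (Finset.union_subset (nbX hx1) (nbX hx2))
        have := hK x1 hx1; have := hK x2 hx2
        omega
      obtain ⟨y, hy, hyz⟩ := Finset.exists_mem_ne hcom z
      simp only [Finset.mem_inter, mem_nb] at hy
      have hyY := adjX hy.1 hx1
      have n1 : x1 ≠ y := hy.1.ne
      have n2 : x2 ≠ y := hy.2.ne
      have n3 : z ≠ x1 := h1.ne
      have n4 : z ≠ x2 := h2.ne
      have hP := ((PO.single (G := H) x1).snoc (c := z) h1.symm (by simp [n3])).snoc (c := x2) h2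
        (by simp [n4.symm, h12.symm])
      have hP' := hP.snoc (c := y) hy.2 (by simp [n1.symm, n2.symm, hyz])
      obtain ⟨g, hg, hg'⟩ := hP'.close' (l := 2 * 2) hy.1.symm (by
        rw [Finset.card_insert_of_notMem, Finset.card_insert_of_notMem,
          Finset.card_insert_of_notMem, Finset.card_singleton]
        · simp [n3]
        · simp [n4.symm, h12.symm]
        · simp [n1.symm, n2.symm, hyz]) (by norm_num)
      refine ⟨g, hg, ?_, by rw [hg']; simp⟩
      rw [hg']
      have : (insert y (insert x2 (insert z {x1})) : Finset V) ∩ X = {x1, x2} := by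
        ext w
        simp only [Finset.mem_inter, Finset.mem_insert, Finset.mem_singleton]
        constructor
        · rintro ⟨rfl | rfl | rfl | rfl, hw⟩
          · exact absurd hyY (hXY hw)
          · simp
          · exact absurd hzY (hXY hw)
          · simp
        · rintro (rfl | rfl)
          · simp [hx1]
          · simp [hx2]
      rw [this]; exact Finset.card_pair h12
    | succ m hm ih =>
      intro hmX
      obtain ⟨f, hf, hfX, hfz⟩ := ih (by omega)
      have hsub : rg f ⊆ X ∪ Y := by
        intro w hw
        obtain ⟨i, rfl⟩ := mem_rg.1 hw
        rcases hb _ _ (hf.2.2 i) with h | h <;> simp [h.1]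
      have hYm : (rg f ∩ Y).card = m := by
        have e : rg f = (rg f ∩ X) ∪ (rg f ∩ Y) := by
          rw [← Finset.inter_union_distrib_left]; exact (Finset.inter_eq_left.2 hsub).symm
        have hc := hf.card_rg
        rw [e, Finset.card_union_of_disjoint] at hc
        · omega
        · exact Finset.disjoint_of_subset_left Finset.inter_subset_right
            (Finset.disjoint_of_subset_right Finset.inter_subset_right hd)
      obtain ⟨v, hvX, hv⟩ : ∃ v ∈ X, v ∉ rg f ∩ X := by
        by_contra hcon
        push Not at hcon
        have := Finset.card_le_card (show X ⊆ rg f ∩ X from hcon)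
        omega
      have hv' : v ∉ rg f := fun h => hv (Finset.mem_inter.2 ⟨h, hvX⟩)
      obtain ⟨g, hg, hg', hgz⟩ := jackson_ins hd hb hK hY hf hzY hfz hYm (by omega) hvX hv'
      refine ⟨g, hg, ?_, hgz⟩
      rw [hg', Finset.card_insert_of_notMem hv, hfX]
  obtain ⟨f, hf, hfX, hfz⟩ := key X.card hX2 le_rfl
  refine ⟨f, hf, ?_, hfz⟩
  have := Finset.eq_of_subset_of_card_le (Finset.inter_subset_right (s₁ := rg f) (s₂ := X)) hfX.ge
  rw [← this]; exact Finset.inter_subset_left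

/-- bipartite subgraph between `X` and `Y` -/
def bip (G : SimpleGraph V) (X Y : Finset V) : SimpleGraph V where
  Adj u v := G.Adj u v ∧ ((u ∈ X ∧ v ∈ Y) ∨ (u ∈ Y ∧ v ∈ X))
  symm := ⟨fun u v h => ⟨h.1.symm, by tauto⟩⟩
  loopless := ⟨fun u h => G.loopless.irrefl u h.1⟩

theorem bip_adj {G : SimpleGraph V} {X Y : Finset V} {u v : V} :
    (bip G X Y).Adj u v ↔ G.Adj u v ∧ ((u ∈ X ∧ v ∈ Y) ∨ (u ∈ Y ∧ v ∈ X)) := Iff.rfl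

theorem bip_le (G : SimpleGraph V) (X Y : Finset V) : bip G X Y ≤ G := fun _ _ h => h.1

theorem nb_bip_left {G : SimpleGraph V} {X Y : Finset V} (hd : Disjoint X Y) {x : V} (hx : x ∈ X) :
    nb (bip G X Y) x = nb G x ∩ Y := by
  ext y
  have := Finset.disjoint_left.1 hd hx
  simp only [mem_nb, bip_adj, Finset.mem_inter]; tauto

theorem nb_bip_right {G : SimpleGraph V} {X Y : Finset V} (hd : Disjoint X Y) {x : V} (hx : x ∈ Y) :
    nb (bip G X Y) x = nb G x ∩ X := by
  ext y
  have := Finset.disjoint_right.1 hd hx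
  simp only [mem_nb, bip_adj, Finset.mem_inter]; tauto

theorem jackson_z {G : SimpleGraph V} {X Y : Finset V} {K : ℕ} (hd : Disjoint X Y)
    (hK : ∀ x ∈ X, K ≤ (nb G x ∩ Y).card) (hY : Y.card + 2 ≤ 2 * K)
    (hX2 : 2 ≤ X.card) (hXK : X.card ≤ K) {z : V} (hzY : z ∈ Y) (hz : 2 ≤ (nb G z ∩ X).card) :
    ∃ f, Cyc (bip G X Y) (2 * X.card) f ∧ X ⊆ rg f ∧ z ∈ rg f := by
  apply jackson_aux (H := bip G X Y) hd (fun u v h => h.2) (fun x hx => ?_) hY hX2 hXK hzY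
  · rw [nb_bip_right hd hzY]; exact hz
  · rw [nb_bip_left hd hx]; exact hK x hx

theorem jackson {G : SimpleGraph V} {X Y : Finset V} {K : ℕ} (hd : Disjoint X Y)
    (hK : ∀ x ∈ X, K ≤ (nb G x ∩ Y).card) (hY : Y.card + 2 ≤ 2 * K)
    (hX2 : 2 ≤ X.card) (hXK : X.card ≤ K) :
    ∃ f, Cyc (bip G X Y) (2 * X.card) f ∧ X ⊆ rg f := by
  obtain ⟨x1, h1, x2, h2, h12⟩ := Finset.one_lt_card.1 (lt_of_lt_of_le Nat.one_lt_two hX2)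
  have a1 := Finset.card_union_add_card_inter (nb G x1 ∩ Y) (nb G x2 ∩ Y)
  have a2 := Finset.card_le_card (Finset.union_subset (Finset.inter_subset_right (s₁ := nb G x1) (s₂ := Y))
    (Finset.inter_subset_right (s₁ := nb G x2) (s₂ := Y)))
  have := hK x1 h1; have := hK x2 h2
  obtain ⟨z, hz⟩ := Finset.card_pos.1 (show 0 < ((nb G x1 ∩ Y) ∩ (nb G x2 ∩ Y)).card by omega)
  simp only [Finset.mem_inter, mem_nb] at hz
  have h2 : 2 ≤ (nb G z ∩ X).card := by
    rw [← Finset.card_pair h12]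
    apply Finset.card_le_card
    intro w
    simp only [Finset.mem_insert, Finset.mem_singleton, Finset.mem_inter, mem_nb]
    rintro (rfl | rfl)
    · exact ⟨hz.1.1.symm, h1⟩
    · exact ⟨hz.2.1.symm, h2⟩
  obtain ⟨f, hf, hfX, _⟩ := jackson_z hd hK hY hX2 hXK hz.1.2 h2
  exact ⟨f, hf, hfX⟩

end ldsproof

section ldsproof
variable {V : Type*} [Fintype V] [DecidableEq V]

/-- path form of the linked double star with `2k-1` path vertices, `n` and `2` leaves -/
def HasS (k n : ℕ) (G : SimpleGraph V) : Prop :=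
  ∃ (a b : V) (S A B : Finset V), PO G a S b ∧ S.card = 2 * k - 1 ∧ A.card = n ∧ B.card = 2 ∧
    A ⊆ nb G a ∧ B ⊆ nb G b ∧ Disjoint A S ∧ Disjoint B S ∧ Disjoint A B

theorem hasS_leaf {k n : ℕ} {G : SimpleGraph V} {a b : V} {S B : Finset V} (h : PO G a S b)
    (hS : S.card = 2 * k - 1) (hB : B.card = 2) (hBb : B ⊆ nb G b) (hBS : Disjoint B S)
    {A : Finset V} (hA : n ≤ A.card) (hAa : A ⊆ nb G a) (hAS : Disjoint A S) (hAB : Disjoint A B) :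
    HasS k n G := by
  obtain ⟨A', hA', hc⟩ := Finset.exists_subset_card_eq hA
  exact ⟨a, b, S, A', B, h, hS, hc, hB, hA'.trans hAa, hBb,
    Finset.disjoint_of_subset_left hA' hAS, hBS, Finset.disjoint_of_subset_left hA' hAB⟩

end ldsproof

section ldsproof
variable {V : Type*} [Fintype V] [DecidableEq V]

theorem compl_count (G : SimpleGraph V) {x : V} {Z : Finset V} (hx : x ∉ Z) :
    (nb Gᶜ x ∩ Z).card + (nb G x ∩ Z).card = Z.card := by
  rw [← Finset.card_union_of_disjoint]
  · congr 1
    ext w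
    simp only [Finset.mem_union, Finset.mem_inter, mem_nb, SimpleGraph.compl_adj]
    constructor
    · tauto
    · intro hw
      have : x ≠ w := fun e => hx (e ▸ hw)
      tauto
  · rw [Finset.disjoint_left]
    intro w
    simp only [Finset.mem_inter, mem_nb, SimpleGraph.compl_adj]
    tauto

theorem factA1 {k n : ℕ} (hk : 5 ≤ k) {G : SimpleGraph V} {f : ℤ → V} {C : Finset V}
    (hf : Cyc G (2 * k) f) (hC : rg f = C) (hno : ¬ HasS k n G) {i : ℤ}
    (hi : n + 1 ≤ (nb G (f i) ∩ Cᶜ).card) {w : V} (hw : w ∉ C) : ¬ G.Adj (f (i + 2)) w := by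
  intro hadj
  apply hno
  subst hC
  have hA := (hf.arc (i + 2) (i + 2 * k) (by omega) (by push_cast; omega)).rev
  have hAc := hf.arc_card (i + 2) (i + 2 * k) (by omega) (by push_cast; omega)
  have e1 : f (i + 2 * k) = f i := hf.per' (by push_cast; ring)
  have hsub := Cyc.arc_sub (f := f) (i + 2) (i + 2 * k)
  rw [e1] at hA
  have hn := hf.not_mem_arc (a := i + 2) (b := i + 2 * k) (i := i + 1 + 2 * k) (by omega)
    (by push_cast; omega)
  have e2 : f (i + 1 + 2 * k) = f (i + 1) := hf.per' (by push_cast; ring)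
  rw [e2] at hn
  have hw1 : f (i + 1) ≠ w := fun e => hw (e ▸ mem_rg.2 ⟨_, rfl⟩)
  refine hasS_leaf hA (by omega) (Finset.card_pair hw1) ?_ ?_
    (A := (nb G (f i) ∩ (rg f)ᶜ).erase w) ?_ ?_ ?_ ?_
  · intro x
    simp only [Finset.mem_insert, Finset.mem_singleton, mem_nb]
    rintro (rfl | rfl)
    · have := hf.2.2 (i + 1)
      have e : i + 1 + 1 = i + 2 := by ring
      rw [e] at this
      exact this.symm
    · exact hadj
  · rw [Finset.disjoint_left]
    intro x
    simp only [Finset.mem_insert, Finset.mem_singleton]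
    rintro (rfl | rfl)
    · exact hn
    · exact fun h => hw (hsub h)
  · have := Finset.pred_card_le_card_erase (s := nb G (f i) ∩ (rg f)ᶜ) (a := w)
    omega
  · exact (Finset.erase_subset _ _).trans Finset.inter_subset_left
  · rw [Finset.disjoint_left]
    intro x hx h
    have := Finset.mem_of_mem_erase hx
    simp only [Finset.mem_inter, Finset.mem_compl] at this
    exact this.2 (hsub h)
  · rw [Finset.disjoint_right]
    intro x
    simp only [Finset.mem_insert, Finset.mem_singleton, Finset.mem_erase, Finset.mem_inter,
      Finset.mem_compl]
    rintro (rfl | rfl)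
    · intro h; exact h.2.2 (mem_rg.2 ⟨_, rfl⟩)
    · simp

theorem factA1' {k n : ℕ} (hk : 5 ≤ k) {G : SimpleGraph V} {f : ℤ → V} {C : Finset V}
    (hf : Cyc G (2 * k) f) (hC : rg f = C) (hno : ¬ HasS k n G) {i : ℤ}
    (hi : n + 1 ≤ (nb G (f i) ∩ Cᶜ).card) {w : V} (hw : w ∉ C) : ¬ G.Adj (f (i - 2)) w := by
  have := factA1 (i := -i) hk hf.neg (Cyc.rg_neg.trans hC) hno (by simpa using hi) hw
  have e : -(-i + 2) = i - 2 := by ring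
  simpa only [e] using this

theorem factA3 {k n : ℕ} (hk : 5 ≤ k) (hn : 2 ≤ n) (hnk : n + 3 ≤ k) {G : SimpleGraph V}
    {Z X0 : Finset V}
    (hZ : Z.card = k + n) {e e2 u : V} (he : e ∉ Z) (he2 : e2 ∉ Z) (hee : e ≠ e2)
    (fe : ∀ w ∈ Z, G.Adj e w) (fe2 : ∀ w ∈ Z, G.Adj e2 w) (hu : u ∉ Z) (hue : u ≠ e)
    (hue2 : u ≠ e2) (hadj : G.Adj e u) (hX : Disjoint X0 Z) (heX : e ∉ X0) (heX2 : e2 ∉ X0)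
    (huX : u ∉ X0) (hXc : X0.card = k - 2) (hXk : ∀ x ∈ X0, k ≤ (nb G x ∩ Z).card) :
    HasS k n G := by
  obtain ⟨f, hf, hfX⟩ := jackson hX hXk (by omega) (by omega) (by omega)
  have hsub : rg f ⊆ X0 ∪ Z := by
    intro w hw
    obtain ⟨i, rfl⟩ := mem_rg.1 hw
    rcases (hf.2.2 i).2 with h | h <;> simp [h.1]
  have hno : ∀ {x}, x ∉ X0 → x ∉ Z → x ∉ rg f := fun h1 h2 h => by
    rcases Finset.mem_union.1 (hsub h) with h | h
    · exact h1 h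
    · exact h2 h
  have hcr := hf.card_rg
  have hZr : (rg f ∩ Z).card ≤ k - 2 := by
    have h1 : rg f ∩ Z ⊆ rg f \ X0 := by
      intro w hw
      simp only [Finset.mem_inter, Finset.mem_sdiff] at hw ⊢
      exact ⟨hw.1, fun h => Finset.disjoint_left.1 hX h hw.2⟩
    have h2 := Finset.card_le_card h1
    rw [Finset.card_sdiff_of_subset hfX] at h2
    omega
  obtain ⟨x, hx⟩ := Finset.card_pos.1 (show 0 < X0.card by omega)
  obtain ⟨i, rfl⟩ := mem_rg.1 (hfX hx)
  have hy : f (i + 1) ∈ Z := by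
    rcases (hf.2.2 i).2 with h | h
    · exact h.2
    · exact absurd h.1 (Finset.disjoint_left.1 hX hx)
  have hP := (hf.arc (i + 1) (i + (2 * X0.card : ℕ)) (by have := hf.1; omega) (by omega)).mono
    (bip_le _ _ _)
  rw [hf.arc_full _ _ (by ring), hf.per] at hP
  obtain ⟨y', hy', hyr⟩ : ∃ y' ∈ nb G (f i) ∩ Z, y' ∉ rg f := by
    by_contra hcon
    push Not at hcon
    have : nb G (f i) ∩ Z ⊆ rg f ∩ Z := fun w hw =>
      Finset.mem_inter.2 ⟨hcon w hw, (Finset.mem_inter.1 hw).2⟩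
    have := Finset.card_le_card this
    have := hXk _ hx
    omega
  simp only [Finset.mem_inter, mem_nb] at hy'
  have hne : e ≠ y' := fun h => he (h ▸ hy'.2)
  have hne2 : e2 ≠ y' := fun h => he2 (h ▸ hy'.2)
  have hQ := hP.snoc hy'.1 hyr
  have her := hno heX he
  have her2 := hno heX2 he2
  have hn2 : e2 ∉ insert y' (rg f) := by simp only [Finset.mem_insert, not_or]; exact ⟨hne2, her2⟩
  have hR := hQ.snoc (c := e2) (fe2 _ hy'.2).symm hn2
  have hn1 : e ∉ insert e2 (insert y' (rg f)) := by
    simp only [Finset.mem_insert, not_or]; exact ⟨hee, hne, her⟩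
  have hT := PO.cons (fe _ hy) hn1 hR
  have hlo : n + 1 ≤ (Z \ insert y' (rg f)).card := by
    have a1 := Finset.card_sdiff_add_card_inter Z (insert y' (rg f))
    have a2 : (Z ∩ insert y' (rg f)).card ≤ (rg f ∩ Z).card + 1 := by
      refine le_trans (Finset.card_le_card ?_) (Finset.card_insert_le y' (rg f ∩ Z))
      intro w; simp only [Finset.mem_inter, Finset.mem_insert]; tauto
    omega
  obtain ⟨B, hB, hBc⟩ := Finset.exists_subset_card_eq (show 2 ≤ (Z \ insert y' (rg f)).card by omega)
  have hBZ : ∀ w ∈ Z \ insert y' (rg f), w ∉ insert e (insert e2 (insert y' (rg f))) := by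
    intro w hw
    simp only [Finset.mem_sdiff] at hw
    simp only [Finset.mem_insert, not_or] at hw ⊢
    exact ⟨fun h => he (h ▸ hw.1), fun h => he2 (h ▸ hw.1), hw.2⟩
  have huZ : u ∉ (Z \ insert y' (rg f)) \ B := by
    simp only [Finset.mem_sdiff]; tauto
  refine hasS_leaf hT ?_ hBc ?_ ?_ (A := insert u ((Z \ insert y' (rg f)) \ B)) ?_ ?_ ?_ ?_
  · rw [Finset.card_insert_of_notMem hn1, Finset.card_insert_of_notMem hn2,
      Finset.card_insert_of_notMem hyr]
    omega
  · intro w hw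
    exact mem_nb.2 (fe2 _ (Finset.mem_sdiff.1 (hB hw)).1)
  · rw [Finset.disjoint_left]
    intro w hw; exact hBZ w (hB hw)
  · rw [Finset.card_insert_of_notMem huZ, Finset.card_sdiff_of_subset hB]
    omega
  · intro w hw
    rw [Finset.mem_insert] at hw
    rcases hw with rfl | hw
    · exact mem_nb.2 hadj
    · simp only [Finset.mem_sdiff] at hw
      exact mem_nb.2 (fe _ hw.1.1)
  · rw [Finset.disjoint_left]
    intro w hw
    rw [Finset.mem_insert] at hw
    rcases hw with rfl | hw
    · simp only [Finset.mem_insert, not_or]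
      exact ⟨hue, hue2, fun h => hu (h ▸ hy'.2), hno huX hu⟩
    · exact hBZ w (Finset.mem_sdiff.1 hw).1
  · rw [Finset.disjoint_left]
    intro w hw hwB
    rw [Finset.mem_insert] at hw
    rcases hw with rfl | hw
    · exact hu (Finset.mem_sdiff.1 (hB hwB)).1
    · exact (Finset.mem_sdiff.1 hw).2 hwB

theorem factAR {k n : ℕ} (hk : 5 ≤ k) {G : SimpleGraph V} {f : ℤ → V} {C : Finset V}
    (hf : Cyc G (2 * k) f) (hC : rg f = C) {i : ℤ}
    (h0 : n + 1 ≤ (nb G (f 0) ∩ Cᶜ).card) (hi : 2 ≤ (nb G (f i) ∩ Cᶜ).card)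
    (hi1 : 1 ≤ i) (hi2 : i ≤ 2 * k - 3) (hadj : G.Adj (f (-2)) (f (i - 1))) : HasS k n G := by
  subst hC
  have hA := hf.arc i (2 * k - 2) (by omega) (by push_cast; omega)
  have hAc := hf.arc_card i (2 * k - 2) (by omega) (by push_cast; omega)
  have hA' := (hf.arc 0 (i - 1) (by omega) (by push_cast; omega)).rev
  have hAc' := hf.arc_card 0 (i - 1) (by omega) (by push_cast; omega)
  have e1 : f (2 * k - 2) = f (-2) := hf.per' (by push_cast; ring)
  have e2 : f (2 * k - 1) = f (-1) := hf.per' (by push_cast; ring)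
  have hD := (hf.arc_disj (a := 0) (b := i - 1) (c := i) (d := 2 * k - 2) (by omega)
    (by push_cast; omega)).symm
  have s1 := Cyc.arc_sub (f := f) i (2 * k - 2)
  have s2 := Cyc.arc_sub (f := f) 0 (i - 1)
  have n1 := hf.not_mem_arc (a := i) (b := 2 * k - 2) (i := 2 * k - 1) (by omega)
    (by push_cast; omega)
  have n2 := hf.not_mem_arc (a := 0) (b := i - 1) (i := 2 * k - 1) (by omega)
    (by push_cast; omega)
  rw [e1] at hA
  have hP := (hA.append hA' hadj hD).rev
  obtain ⟨B, hB, hBc⟩ := Finset.exists_subset_card_eq hi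
  have hBC : ∀ w ∈ B, w ∉ rg f := fun w hw => by
    have := (Finset.mem_inter.1 (hB hw)).2
    simpa only [Finset.mem_compl] using this
  have hna : f (2 * k - 1) ∉ (nb G (f 0) ∩ (rg f)ᶜ) \ B := by
    simp only [Finset.mem_sdiff, Finset.mem_inter, Finset.mem_compl]
    intro h; exact h.1.2 (mem_rg.2 ⟨_, rfl⟩)
  refine hasS_leaf hP ?_ hBc ?_ ?_
    (A := insert (f (2 * k - 1)) ((nb G (f 0) ∩ (rg f)ᶜ) \ B)) ?_ ?_ ?_ ?_
  · rw [Finset.card_union_of_disjoint hD]; omega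
  · exact fun w hw => (Finset.mem_inter.1 (hB hw)).1
  · rw [Finset.disjoint_left]
    intro w hw h
    rcases Finset.mem_union.1 h with h | h
    · exact hBC w hw (s1 h)
    · exact hBC w hw (s2 h)
  · rw [Finset.card_insert_of_notMem hna]
    have := Finset.le_card_sdiff B (nb G (f 0) ∩ (rg f)ᶜ)
    omega
  · intro w hw
    rcases Finset.mem_insert.1 hw with rfl | hw
    · rw [e2, mem_nb]
      have := hf.2.2 (-1)
      simpa using this.symm
    · exact (Finset.mem_inter.1 (Finset.mem_sdiff.1 hw).1).1
  · rw [Finset.disjoint_left]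
    intro w hw h
    rcases Finset.mem_insert.1 hw with rfl | hw
    · rcases Finset.mem_union.1 h with h | h
      · exact n1 h
      · exact n2 h
    · have h5 := (Finset.mem_inter.1 (Finset.mem_sdiff.1 hw).1).2
      rw [Finset.mem_compl] at h5
      rcases Finset.mem_union.1 h with h | h
      · exact h5 (s1 h)
      · exact h5 (s2 h)
  · rw [Finset.disjoint_left]
    intro w hw h
    rcases Finset.mem_insert.1 hw with rfl | hw
    · exact hBC _ h (mem_rg.2 ⟨_, rfl⟩)
    · exact (Finset.mem_sdiff.1 hw).2 h

theorem factB {k n : ℕ} (hk : 5 ≤ k) (hnk : n + 3 ≤ k) {G : SimpleGraph V} {Z F : Finset V}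
    (hd : Disjoint F Z) (hF : 2 * k - 1 ≤ F.card) (hZ : Z.card = k + n)
    (hFk : ∀ x ∈ F, k ≤ (nb G x ∩ Z).card) :
    ∃ g, Cyc G (2 * k) g ∧ (∀ i, (g i ∈ F ∧ g (i + 1) ∈ Z) ∨ (g i ∈ Z ∧ g (i + 1) ∈ F)) ∧
      g 0 ∈ Z ∧ n + 1 ≤ (nb G (g 0) ∩ (rg g)ᶜ ∩ F).card := by
  classical
  obtain ⟨z, hz, hzn⟩ : ∃ z ∈ Z, n + 3 ≤ (nb G z ∩ F).card := by
    by_contra hcon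
    push Not at hcon
    have h1 : ∑ x ∈ F, (nb G x ∩ Z).card = ∑ z ∈ Z, (nb G z ∩ F).card := by
      have := Finset.sum_card_bipartiteAbove_eq_sum_card_bipartiteBelow (s := F) (t := Z) (G.Adj)
      convert this using 2
      · congr 1; ext w; simp [Finset.mem_bipartiteAbove]; tauto
      · congr 1; ext w; simp [Finset.mem_bipartiteBelow, SimpleGraph.adj_comm]; tauto
    have h2 := Finset.card_nsmul_le_sum F (fun x => (nb G x ∩ Z).card) k hFk
    have h3 := Finset.sum_le_card_nsmul Z (fun z => (nb G z ∩ F).card) (n + 2)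
      (fun z hz => by have := hcon z hz; omega)
    rw [smul_eq_mul] at h2 h3
    rw [hZ] at h3
    have h4 : (2 * k - 1) * k ≤ F.card * k := Nat.mul_le_mul_right _ hF
    have h5 : (k + n) * (n + 2) ≤ (2 * k - 3) * (n + 2) := Nat.mul_le_mul_right _ (by omega)
    have h6 : (2 * k - 3) * (n + 2) ≤ (2 * k - 3) * k := Nat.mul_le_mul_left _ (by omega)
    have h7 : (2 * k - 3) * k < (2 * k - 1) * k := Nat.mul_lt_mul_of_pos_right (by omega) (by omega)
    omega
  obtain ⟨L, hL, hLc⟩ := Finset.exists_subset_card_eq (show n + 1 ≤ (nb G z ∩ F).card by omega)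
  have h1 : 2 ≤ ((nb G z ∩ F) \ L).card := by
    rw [Finset.card_sdiff_of_subset hL]; omega
  obtain ⟨P, hP, hPc⟩ := Finset.exists_subset_card_eq h1
  have hLF : L ⊆ F := hL.trans Finset.inter_subset_right
  have hPF : P ⊆ F \ L := hP.trans (Finset.sdiff_subset_sdiff Finset.inter_subset_right le_rfl)
  obtain ⟨X, hPX, hXF, hXc⟩ := Finset.exists_subsuperset_card_eq hPF (n := k) (by omega) (by
    rw [Finset.card_sdiff_of_subset hLF]; omega)
  have hXF' : X ⊆ F := hXF.trans Finset.sdiff_subset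
  have hdX : Disjoint X Z := Finset.disjoint_of_subset_left hXF' hd
  obtain ⟨f, hf, _, hfz⟩ := jackson_z (K := k) hdX (fun x hx => hFk x (hXF' hx)) (by omega) (by omega)
    (by omega) hz (by
      rw [← hPc]; apply Finset.card_le_card
      intro w hw
      refine Finset.mem_inter.2 ⟨?_, hPX hw⟩
      exact (Finset.mem_inter.1 (Finset.mem_sdiff.1 (hP hw)).1).1)
  obtain ⟨j, rfl⟩ := mem_rg.1 hfz
  rw [hXc] at hf
  have hg := hf.shift j
  refine ⟨fun i => f (i + j), hg.mono (bip_le _ _ _), fun i => ?_, by simpa using hz, ?_⟩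
  · rcases (hg.2.2 i).2 with h | h
    · exact Or.inl ⟨hXF' h.1, h.2⟩
    · exact Or.inr ⟨h.1, hXF' h.2⟩
  · rw [Cyc.rg_shift, ← hLc]
    apply Finset.card_le_card
    intro w hw
    simp only [Finset.mem_inter, Finset.mem_compl, zero_add]
    refine ⟨⟨(Finset.mem_inter.1 (hL hw)).1, ?_⟩, hLF hw⟩
    intro h
    obtain ⟨i, rfl⟩ := mem_rg.1 h
    rcases (hf.2.2 i).2 with h | h
    · exact (Finset.mem_sdiff.1 (hXF h.1)).2 hw
    · exact Finset.disjoint_left.1 hd (hLF hw) h.1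

end ldsproof

section ldsproof
variable {V : Type*} [Fintype V] [DecidableEq V]

/-- vertices of `C` with many neighbours outside -/
noncomputable def Dset (G : SimpleGraph V) (n : ℕ) (C : Finset V) : Finset V :=
  C.filter (fun x => n + 1 ≤ (nb G x ∩ Cᶜ).card)

theorem factA_D {k n : ℕ} (hk : 5 ≤ k) {G : SimpleGraph V} {f : ℤ → V} {C : Finset V}
    (hf : Cyc G (2 * k) f) (hC : rg f = C) (hno : ¬ HasS k n G) {i : ℤ}
    (hi : f i ∈ Dset G n C) : f (i + 2) ∉ Dset G n C ∧ f (i - 2) ∉ Dset G n C := by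
  have hi' := (Finset.mem_filter.1 hi).2
  constructor
  · intro h
    have h' := (Finset.mem_filter.1 h).2
    obtain ⟨w, hw⟩ := Finset.card_pos.1 (lt_of_lt_of_le (Nat.succ_pos _) h')
    simp only [Finset.mem_inter, Finset.mem_compl, mem_nb] at hw
    exact factA1 hk hf hC hno hi' hw.2 hw.1
  · intro h
    have h' := (Finset.mem_filter.1 h).2
    obtain ⟨w, hw⟩ := Finset.card_pos.1 (lt_of_lt_of_le (Nat.succ_pos _) h')
    simp only [Finset.mem_inter, Finset.mem_compl, mem_nb] at hw
    exact factA1' hk hf hC hno hi' hw.2 hw.1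

theorem factA_Dcard {k n : ℕ} (hk : 5 ≤ k) {G : SimpleGraph V} {f : ℤ → V} {C : Finset V}
    (hf : Cyc G (2 * k) f) (hC : rg f = C) (hno : ¬ HasS k n G) :
    (Dset G n C).card ≤ k ∧
    ((Dset G n C).card = k → ∀ i, f i ∉ Dset G n C → f (i - 2) ∈ Dset G n C) := by
  obtain ⟨s, hs⟩ := hf.exists_shift_map 2
  set D := Dset G n C with hD
  have hDC : D ⊆ C := Finset.filter_subset _ _
  have hix : ∀ x ∈ D, ∃ i, f i = x := fun x hx => mem_rg.1 (hC ▸ hDC hx)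
  have hinj : (D.image s).card = D.card := by
    apply Finset.card_image_of_injOn
    intro x hx y hy hxy
    obtain ⟨i, rfl⟩ := hix x hx
    obtain ⟨j, rfl⟩ := hix y hy
    rw [hs, hs] at hxy
    exact (hf.shift_inj 2).1 hxy
  have hdis : Disjoint D (D.image s) := by
    rw [Finset.disjoint_right]
    intro y hy
    obtain ⟨x, hx, rfl⟩ := Finset.mem_image.1 hy
    obtain ⟨i, rfl⟩ := hix x hx
    rw [hs]
    exact (factA_D hk hf hC hno hx).1
  have hsub : D ∪ D.image s ⊆ C := by
    apply Finset.union_subset hDC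
    intro y hy
    obtain ⟨x, hx, rfl⟩ := Finset.mem_image.1 hy
    obtain ⟨i, rfl⟩ := hix x hx
    rw [hs, ← hC]; exact mem_rg.2 ⟨_, rfl⟩
  have hCc : C.card = 2 * k := by rw [← hC]; exact hf.card_rg
  have hle := Finset.card_le_card hsub
  have hun := Finset.card_union_of_disjoint hdis
  refine ⟨by omega, fun hk' i hi => ?_⟩
  have heq := Finset.eq_of_subset_of_card_le hsub (by omega)
  have hmem : f i ∈ D ∪ D.image s := by rw [heq, ← hC]; exact mem_rg.2 ⟨_, rfl⟩
  rcases Finset.mem_union.1 hmem with h | h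
  · exact absurd h hi
  · obtain ⟨x, hx, hxi⟩ := Finset.mem_image.1 h
    obtain ⟨j, rfl⟩ := hix x hx
    rw [hs] at hxi
    have e : f (i - 2) = f j := by
      apply (hf.shift_inj 2).1
      rw [hxi]; congr 1; ring
    rw [e]; exact hx

theorem factA_red {k n : ℕ} (hk : 5 ≤ k) (hn : 2 ≤ n) (hnk : n + 3 ≤ k)
    (hV : Fintype.card V = 3 * k + n) {G : SimpleGraph V} {f : ℤ → V} {C : Finset V}
    (hf : Cyc G (2 * k) f) (hC : rg f = C) (hno : ¬ HasS k n G) (hno' : ¬ HasS k n Gᶜ)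
    (h0 : f 0 ∈ Dset G n C) {u : V} (huC : u ∈ C) (hu2 : u ≠ f 2) (hu2' : u ≠ f (-2))
    (hu : u ∈ Dset G n C ∨ (Dset G n C).card < k) : G.Adj (f (-2)) u := by
  by_contra hadj
  apply hno'
  have h0' := (Finset.mem_filter.1 h0).2
  have hCc : C.card = 2 * k := by rw [← hC]; exact hf.card_rg
  have hZ : (Cᶜ).card = k + n := by rw [Finset.card_compl, hV, hCc]; omega
  have hmem : ∀ i, f i ∈ C := fun i => by rw [← hC]; exact mem_rg.2 ⟨_, rfl⟩
  have hne : f (-2) ≠ f 2 := hf.ne (by norm_num) (by push_cast; omega) (by push_cast; omega)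
  have hDle := (factA_Dcard hk hf hC hno).1
  have hsize : k - 2 ≤ (C \ (Dset G n C ∪ {f (-2), f 2, u})).card := by
    have a1 := Finset.le_card_sdiff (Dset G n C ∪ {f (-2), f 2, u}) C
    have a2 := Finset.card_union_le (Dset G n C) {f (-2), f 2, u}
    have a3 : ({f (-2), f 2, u} : Finset V).card ≤ 3 := Finset.card_le_three
    rcases hu with hu | hu
    · have a4 : Dset G n C ∪ {f (-2), f 2, u} = Dset G n C ∪ {f (-2), f 2} := by
        ext w; simp only [Finset.mem_union, Finset.mem_insert, Finset.mem_singleton]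
        constructor
        · rintro (h | h | h | rfl) <;> tauto
        · tauto
      have a5 := Finset.card_union_le (Dset G n C) {f (-2), f 2}
      have a6 : ({f (-2), f 2} : Finset V).card ≤ 2 := Finset.card_le_two
      rw [a4] at a1 ⊢
      omega
    · omega
  obtain ⟨X0, hX0, hX0c⟩ := Finset.exists_subset_card_eq hsize
  have hX : ∀ x ∈ X0, x ∈ C ∧ x ∉ Dset G n C ∧ x ≠ f (-2) ∧ x ≠ f 2 ∧ x ≠ u := by
    intro x hx
    have := hX0 hx
    simpa only [Finset.mem_sdiff, Finset.mem_union, Finset.mem_insert, Finset.mem_singleton, not_or]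
      using this
  have hfull : ∀ i, (∀ w ∉ C, ¬ G.Adj (f i) w) → ∀ w ∈ Cᶜ, Gᶜ.Adj (f i) w := by
    intro i hi w hw
    rw [Finset.mem_compl] at hw
    rw [SimpleGraph.compl_adj]
    exact ⟨fun e => hw (e ▸ hmem i), hi w hw⟩
  refine factA3 hk hn hnk (Z := Cᶜ) (X0 := X0) hZ (e := f (-2)) (e2 := f 2) (u := u) (by simp [hmem])
    (by simp [hmem]) hne (hfull _ fun w hw => ?_) (hfull _ fun w hw => ?_) (by simpa using huC) hu2'
    hu2 ?_ ?_ (fun h => (hX _ h).2.2.1 rfl) (fun h => (hX _ h).2.2.2.1 rfl)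
    (fun h => (hX _ h).2.2.2.2 rfl) hX0c ?_
  · have := factA1' (i := 0) hk hf hC hno h0' hw
    simpa using this
  · have := factA1 (i := 0) hk hf hC hno h0' hw
    simpa using this
  · rw [SimpleGraph.compl_adj]; exact ⟨hu2'.symm, hadj⟩
  · rw [Finset.disjoint_left]
    intro x hx; simpa using (hX x hx).1
  · intro x hx
    obtain ⟨h1, h2, _⟩ := hX x hx
    have := compl_count G (x := x) (Z := Cᶜ) (by simpa using h1)
    have h3 : ¬ (n + 1 ≤ (nb G x ∩ Cᶜ).card) := fun h => h2 (Finset.mem_filter.2 ⟨h1, h⟩)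
    omega

theorem factA_stepR {k n : ℕ} (hk : 5 ≤ k) (hn : 2 ≤ n) (hnk : n + 3 ≤ k)
    (hV : Fintype.card V = 3 * k + n) {G : SimpleGraph V} {f : ℤ → V} {C : Finset V}
    (hf : Cyc G (2 * k) f) (hC : rg f = C) (hno : ¬ HasS k n G) (hno' : ¬ HasS k n Gᶜ)
    (h0 : f 0 ∈ Dset G n C) {i : ℤ} (hi1 : 1 ≤ i) (hi2 : i ≤ 2 * k - 3) (hi3 : i ≠ 3)
    (hu : f (i - 1) ∈ Dset G n C ∨ (Dset G n C).card < k) : (nb G (f i) ∩ Cᶜ).card ≤ 1 := by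
  by_contra hcon
  apply hno
  refine factAR hk hf hC (i := i) (Finset.mem_filter.1 h0).2 (by omega) hi1 hi2 ?_
  apply factA_red hk hn hnk hV hf hC hno hno' h0 _ _ _ hu
  · rw [← hC]; exact mem_rg.2 ⟨_, rfl⟩
  · exact hf.ne (by omega) (by push_cast; omega) (by push_cast; omega)
  · exact hf.ne (by omega) (by push_cast; omega) (by push_cast; omega)

theorem factA_step4 {k n : ℕ} (hk : 5 ≤ k) (hn : 2 ≤ n) (hnk : n + 3 ≤ k)
    (hV : Fintype.card V = 3 * k + n) {G : SimpleGraph V} {f : ℤ → V} {C : Finset V}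
    (hf : Cyc G (2 * k) f) (hC : rg f = C) (hno : ¬ HasS k n G) (hno' : ¬ HasS k n Gᶜ)
    (h0 : f 0 ∈ Dset G n C) (h3 : f 3 ∈ Dset G n C) (h4 : f 4 ∈ Dset G n C) : False := by
  have := factA_stepR hk hn hnk hV hf hC hno hno' h0 (i := 4) (by omega) (by omega) (by omega)
    (Or.inl (by simpa using h3))
  have h4' := (Finset.mem_filter.1 h4).2
  omega

theorem factA {k n : ℕ} (hk : 5 ≤ k) (hn : 2 ≤ n) (hnk : n + 3 ≤ k)
    (hV : Fintype.card V = 3 * k + n) {G : SimpleGraph V} {f : ℤ → V}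
    (hf : Cyc G (2 * k) f) {i : ℤ} (hi : n + 1 ≤ (nb G (f i) ∩ (rg f)ᶜ).card) :
    HasS k n G ∨ HasS k n Gᶜ := by
  by_contra hcon
  rw [not_or] at hcon
  obtain ⟨hno, hno'⟩ := hcon
  -- shift
  obtain ⟨f, hf, h0⟩ : ∃ g, Cyc G (2 * k) g ∧ n + 1 ≤ (nb G (g 0) ∩ (rg g)ᶜ).card :=
    ⟨fun j => f (j + i), hf.shift i, by rw [Cyc.rg_shift]; simpa using hi⟩
  obtain ⟨C, hC⟩ : ∃ C, rg f = C := ⟨_, rfl⟩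
  rw [hC] at h0
  have hmem : ∀ i, f i ∈ C := fun i => by rw [← hC]; exact mem_rg.2 ⟨_, rfl⟩
  have hfD : f 0 ∈ Dset G n C := Finset.mem_filter.2 ⟨hmem 0, h0⟩
  have hCc : C.card = 2 * k := by rw [← hC]; exact hf.card_rg
  have hZ : (Cᶜ).card = k + n := by rw [Finset.card_compl, hV, hCc]; omega
  have hfn := hf.neg
  have hCn : rg (fun i => f (-i)) = C := Cyc.rg_neg.trans hC
  have hfDn : (fun i => f (-i)) 0 ∈ Dset G n C := by simpa using hfD
  obtain ⟨hDle, hDeq⟩ := factA_Dcard hk hf hC hno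
  have d2 := factA_D hk hf hC hno hfD
  rcases eq_or_lt_of_le hDle with hD | hD
  · have q := hDeq hD
    have qn := (factA_Dcard hk hfn hCn hno).2 hD
    by_cases h3 : f 3 ∈ Dset G n C
    · refine factA_step4 hk hn hnk hV hf hC hno hno' hfD h3 ?_
      have := qn (-2) (by simpa using d2.1)
      simpa using this
    · have h1 : f 1 ∈ Dset G n C := by have := q 3 h3; norm_num at this; exact this
      have hm1 : f (-1) ∉ Dset G n C := by
        have := (factA_D hk hf hC hno h1).2; norm_num at this; exact this
      have hm3 : f (-3) ∈ Dset G n C := by have := q (-1) hm1; norm_num at this; exact this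
      have hm4 : f (-4) ∈ Dset G n C := by
        have := q (-2) (by simpa using d2.2); norm_num at this; exact this
      exact factA_step4 hk hn hnk hV hfn hCn hno hno' hfDn hm3 hm4
  · have hone : ∀ i, f i ≠ f 0 → (nb G (f i) ∩ Cᶜ).card ≤ 1 := by
      intro i0 hne
      obtain ⟨i, hi1, hi2, hi3⟩ := hf.win i0 0
      rw [← hi3] at hne ⊢
      have hi0 : i ≠ 0 := fun e => hne (by rw [e])
      push_cast at hi2
      have hzero : ∀ j, (∀ w ∉ C, ¬ G.Adj (f j) w) → (nb G (f j) ∩ Cᶜ).card ≤ 1 := by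
        intro j hj
        have : nb G (f j) ∩ Cᶜ = ∅ := by
          rw [Finset.eq_empty_iff_forall_notMem]
          intro w hw
          simp only [Finset.mem_inter, Finset.mem_compl, mem_nb] at hw
          exact hj w hw.2 hw.1
        rw [this]; simp
      by_cases c2 : i = 2 * k - 2
      · have e : f i = f (-2) := hf.per' (by push_cast; omega)
        rw [e]
        apply hzero
        intro w hw
        have := factA1' (i := 0) hk hf hC hno h0 hw
        simpa using this
      by_cases c3 : i = 2 * k - 1
      · have e : f i = f (-1) := hf.per' (by push_cast; omega)
        rw [e]
        exact factA_stepR hk hn hnk hV hfn hCn hno hno' hfDn (i := 1) (by omega) (by omega)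
          (by omega) (Or.inr hD)
      by_cases c4 : i = 3
      · have e : f i = f (-(2 * k - 3)) := hf.per' (by push_cast; omega)
        rw [e]
        exact factA_stepR hk hn hnk hV hfn hCn hno hno' hfDn (i := 2 * k - 3) (by omega) (by omega)
          (by omega) (Or.inr hD)
      · exact factA_stepR hk hn hnk hV hf hC hno hno' hfD (i := i) (by omega) (by omega)
          (by omega) (Or.inr hD)
    have hFk : ∀ x ∈ C.erase (f 0), (nb G x ∩ Cᶜ).card ≤ 1 := by
      intro x hx
      obtain ⟨h1, h2⟩ := Finset.mem_erase.1 hx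
      rw [← hC] at h2
      obtain ⟨i, rfl⟩ := mem_rg.1 h2
      exact hone i h1
    obtain ⟨g, hg, _, hgZ, hgn⟩ := factB (G := Gᶜ) (Z := Cᶜ) (F := C.erase (f 0)) hk hnk (by
        rw [Finset.disjoint_left]; intro x hx; simpa using (Finset.mem_erase.1 hx).2) (by
        rw [Finset.card_erase_of_mem (hmem 0)]; omega) hZ (by
        intro x hx
        have h1 := hFk x hx
        have := compl_count G (x := x) (Z := Cᶜ) (by simpa using (Finset.mem_erase.1 hx).2)
        omega)
    rename_i halt
    have hg0 : n + 1 ≤ (nb Gᶜ (g 0) ∩ (rg g)ᶜ).card :=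
      hgn.trans (Finset.card_le_card Finset.inter_subset_left)
    obtain ⟨x, hx⟩ := Finset.card_pos.1 (lt_of_lt_of_le (Nat.succ_pos _) hgn)
    simp only [Finset.mem_inter, Finset.mem_compl, mem_nb] at hx
    obtain ⟨⟨_, hxg⟩, hxF⟩ := hx
    have p1 := factA1 (i := 0) hk hg rfl hno' hg0 hxg
    have p2 := factA1' (i := 0) hk hg rfl hno' hg0 hxg
    have hnotboth : ∀ y, y ∈ C.erase (f 0) → y ∉ Cᶜ := fun y hy => by
      simpa using (Finset.mem_erase.1 hy).2
    have z2 : g (0 + 2) ∈ Cᶜ := by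
      rcases halt 0 with h | h
      · exact absurd hgZ (hnotboth _ h.1)
      · rcases halt (0 + 1) with h' | h'
        · exact h'.2
        · exact absurd h'.1 (hnotboth _ h.2)
    have z2' : g (0 - 2) ∈ Cᶜ := by
      rcases halt (-1) with h | h
      · rcases halt (-2) with h' | h'
        · exact absurd h'.2 (hnotboth _ h.1)
        · exact h'.1
      · exact absurd hgZ (hnotboth _ h.2)
    have hadj : ∀ y, y ∈ rg g → ¬ Gᶜ.Adj y x → G.Adj x y := by
      intro y hy h
      rw [SimpleGraph.compl_adj, not_and, not_not] at h
      exact (h (fun e => hxg (e ▸ hy))).symm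
    have hne : g (0 + 2) ≠ g (0 - 2) :=
      hg.ne (by norm_num) (by push_cast; omega) (by push_cast; omega)
    have h2 : 2 ≤ (nb G x ∩ Cᶜ).card := by
      rw [← Finset.card_pair hne]
      apply Finset.card_le_card
      intro y
      simp only [Finset.mem_insert, Finset.mem_singleton]
      rintro (rfl | rfl)
      · exact Finset.mem_inter.2 ⟨mem_nb.2 (hadj _ (mem_rg.2 ⟨_, rfl⟩) p1), z2⟩
      · exact Finset.mem_inter.2 ⟨mem_nb.2 (hadj _ (mem_rg.2 ⟨_, rfl⟩) p2), z2'⟩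
    have := hFk x hxF
    omega

theorem main_of_cycle {k n : ℕ} (hk : 5 ≤ k) (hn : 2 ≤ n) (hnk : n + 3 ≤ k)
    (hV : Fintype.card V = 3 * k + n) {G : SimpleGraph V} {f : ℤ → V}
    (hf : Cyc G (2 * k) f) : HasS k n G ∨ HasS k n Gᶜ := by
  by_cases h : ∃ i, n + 1 ≤ (nb G (f i) ∩ (rg f)ᶜ).card
  · obtain ⟨i, hi⟩ := h
    exact factA hk hn hnk hV hf hi
  · push Not at h
    have hCc := hf.card_rg
    have hZ : ((rg f)ᶜ).card = k + n := by rw [Finset.card_compl, hV, hCc]; omega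
    obtain ⟨g, hg, _, _, hgn⟩ := factB (G := Gᶜ) (Z := (rg f)ᶜ) (F := rg f) hk hnk
      disjoint_compl_right (by omega) hZ (by
        intro x hx
        have := compl_count G (x := x) (Z := (rg f)ᶜ) (by simpa using hx)
        obtain ⟨i, rfl⟩ := mem_rg.1 hx
        have := h i
        omega)
    have := factA hk hn hnk hV hg (i := 0)
      (hgn.trans (Finset.card_le_card Finset.inter_subset_left))
    rw [compl_compl] at this
    exact this.symm

end ldsproof

section ldsproof
variable {V : Type*} [Fintype V] [DecidableEq V]

/-- there is a monochromatic cycle of length `l` -/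
def MonoC (G : SimpleGraph V) (l : ℕ) : Prop := (∃ f, Cyc G l f) ∨ (∃ f, Cyc Gᶜ l f)

theorem MonoC.compl {G : SimpleGraph V} {l : ℕ} (h : MonoC Gᶜ l) : MonoC G l := by
  unfold MonoC at *
  rw [compl_compl] at h
  exact h.symm

theorem Cyc.skip {G : SimpleGraph V} {L : ℕ} {f : ℤ → V} (hf : Cyc G L f) (i : ℤ) (r L' : ℕ)
    (hr : 1 ≤ r) (hL : L' + r = L + 1) (hL3 : 3 ≤ L') (hadj : G.Adj (f i) (f (i + r))) :
    ∃ g, Cyc G L' g := by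
  have hA := hf.arc (i + r) (i + L) (by omega) (by omega)
  have hc := hf.arc_card (i + r) (i + L) (by omega) (by omega)
  rw [hf.per] at hA
  obtain ⟨g, hg, _⟩ := hA.close' (l := L') hadj (by omega) hL3
  exact ⟨g, hg⟩

theorem descend_odd {G : SimpleGraph V} {l : ℕ} (hl : 4 ≤ l) {f : ℤ → V} (hf : Cyc G (2 * l + 1) f) :
    MonoC G (2 * l) := by
  by_cases h1 : ∃ i, G.Adj (f i) (f (i + (2 : ℕ)))
  · obtain ⟨i, hi⟩ := h1
    exact Or.inl (hf.skip i 2 (2 * l) (by omega) (by omega) (by omega) hi)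
  push Not at h1
  have hg : Cyc Gᶜ (2 * l + 1) (fun i => f (2 * i)) := by
    refine ⟨hf.1, fun i j => ?_, fun i => ?_⟩
    · rw [hf.2.1]
      have e : 2 * i - 2 * j = 2 * (i - j) := by ring
      rw [e]
      constructor
      · intro h
        refine IsCoprime.dvd_of_dvd_mul_left ?_ h
        exact ⟨1, -(l : ℤ), by push_cast; ring⟩
      · exact fun h => Dvd.dvd.mul_left h 2
    · rw [SimpleGraph.compl_adj]
      refine ⟨hf.ne (by omega) (by push_cast; omega) (by push_cast; omega), ?_⟩
      have := h1 (2 * i)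
      have e : 2 * (i + 1) = 2 * i + (2 : ℕ) := by push_cast; ring
      simp only [e]; exact this
  by_cases h2 : ∃ i : ℤ, Gᶜ.Adj (f (2 * i)) (f (2 * (i + (2 : ℕ))))
  · obtain ⟨i, hi⟩ := h2
    exact Or.inr (hg.skip i 2 (2 * l) (by omega) (by omega) (by omega) hi)
  push Not at h2
  have h4 : ∀ i, G.Adj (f i) (f (i + 4)) := by
    have hev : ∀ j, G.Adj (f (2 * j)) (f (2 * j + 4)) := by
      intro j
      have := h2 j
      rw [SimpleGraph.compl_adj, not_and, not_not] at this
      have e : 2 * (j + (2 : ℕ)) = 2 * j + 4 := by push_cast; ring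
      rw [e] at this
      exact this (hf.ne (by omega) (by push_cast; omega) (by push_cast; omega))
    intro i
    rcases Int.even_or_odd' i with ⟨j, rfl | rfl⟩
    · exact hev j
    · have := hev (j + l + 1)
      have e1 : f (2 * (j + l + 1)) = f (2 * j + 1) := hf.per' (by push_cast; ring)
      have e2 : f (2 * (j + l + 1) + 4) = f (2 * j + 1 + 4) := hf.per' (by push_cast; ring)
      rwa [e1, e2] at this
  left
  have A0 := hf.arc 0 0 (by omega) (by push_cast; omega)
  have A1 := hf.arc 4 5 (by omega) (by push_cast; omega)
  have A2 := hf.arc 1 3 (by omega) (by push_cast; omega)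
  have A3 := hf.arc 7 (2 * l) (by omega) (by push_cast; omega)
  have c0 := hf.arc_card 0 0 (by omega) (by push_cast; omega)
  have c1 := hf.arc_card 4 5 (by omega) (by push_cast; omega)
  have c2 := hf.arc_card 1 3 (by omega) (by push_cast; omega)
  have c3 := hf.arc_card 7 (2 * l) (by omega) (by push_cast; omega)
  have d01 := hf.arc_disj (a := 0) (b := 0) (c := 4) (d := 5) (by omega) (by push_cast; omega)
  have d02 := hf.arc_disj (a := 0) (b := 0) (c := 1) (d := 3) (by omega) (by push_cast; omega)
  have d03 := hf.arc_disj (a := 0) (b := 0) (c := 7) (d := 2 * l) (by omega) (by push_cast; omega)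
  have d12 := (hf.arc_disj (a := 1) (b := 3) (c := 4) (d := 5) (by omega) (by push_cast; omega)).symm
  have d13 := hf.arc_disj (a := 4) (b := 5) (c := 7) (d := 2 * l) (by omega) (by push_cast; omega)
  have d23 := hf.arc_disj (a := 1) (b := 3) (c := 7) (d := 2 * l) (by omega) (by push_cast; omega)
  have D2 := Finset.disjoint_union_left.2 ⟨d02, d12⟩
  have D3 := Finset.disjoint_union_left.2 ⟨Finset.disjoint_union_left.2 ⟨d03, d13⟩, d23⟩
  have P := ((A0.append A1 (h4 0) d01).append A2 (h4 1).symm D2).append A3 (h4 3) D3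
  obtain ⟨g, hg, _⟩ := P.close' (l := 2 * l) (by
    have := hf.2.2 (2 * l)
    have e : f (2 * l + 1) = f 0 := hf.per' (by push_cast; ring)
    rwa [e] at this) (by
    rw [Finset.card_union_of_disjoint D3, Finset.card_union_of_disjoint D2,
      Finset.card_union_of_disjoint d01]
    omega) (by omega)
  exact ⟨g, hg⟩

theorem descend_even {G : SimpleGraph V} {l : ℕ} (hl : 6 ≤ l) {f : ℤ → V} (hf : Cyc G (2 * l) f) :
    MonoC G (2 * l - 2) := by
  by_cases h1 : ∃ i, G.Adj (f i) (f (i + (3 : ℕ)))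
  · obtain ⟨i, hi⟩ := h1
    exact Or.inl (hf.skip i 3 (2 * l - 2) (by omega) (by omega) (by omega) hi)
  push Not at h1
  by_cases h2 : ∃ i j : ℤ, i + 2 ≤ j ∧ j + 2 ≤ i + 2 * l ∧ G.Adj (f i) (f (i + 2)) ∧
      G.Adj (f j) (f (j + 2))
  · obtain ⟨i, j, hij, hji, hi, hj⟩ := h2
    left
    have A1 := hf.arc (i + 2) j (by omega) (by push_cast; omega)
    have A2 := hf.arc (j + 2) (i + 2 * l) (by omega) (by push_cast; omega)
    have c1 := hf.arc_card (i + 2) j (by omega) (by push_cast; omega)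
    have c2 := hf.arc_card (j + 2) (i + 2 * l) (by omega) (by push_cast; omega)
    have d := hf.arc_disj (a := i + 2) (b := j) (c := j + 2) (d := i + 2 * l) (by omega)
      (by push_cast; omega)
    have P := A1.append A2 hj d
    obtain ⟨g, hg, _⟩ := P.close' (l := 2 * l - 2) (by
      have e : f (i + 2 * l) = f i := hf.per' (by push_cast; ring)
      rw [e]; exact hi) (by rw [Finset.card_union_of_disjoint d]; omega) (by omega)
    exact ⟨g, hg⟩
  push Not at h2
  obtain ⟨c, hc⟩ : ∃ c : ℤ, ∀ i : ℤ, 0 ≤ i → i ≤ 2 * l - 3 → ¬ G.Adj (f (i + c)) (f (i + c + 2)) := by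
    by_cases h3 : ∃ i, G.Adj (f i) (f (i + 2))
    · obtain ⟨i0, hi0⟩ := h3
      have hmod : ∀ j, f (j - 2 * l) = f j := fun j => (hf.per' (by push_cast; ring)).symm
      by_cases h4 : G.Adj (f (i0 - 1)) (f (i0 - 1 + 2))
      · refine ⟨i0 + 1, fun i hi1 hi2 hadj => ?_⟩
        by_cases h6 : i = 0
        · subst h6
          exact h2 (i0 - 1) (0 + (i0 + 1)) (by omega) (by omega) h4 hadj
        · exact h2 i0 (i + (i0 + 1)) (by omega) (by omega) hi0 hadj
      · refine ⟨i0 + 2, fun i hi1 hi2 hadj => ?_⟩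
        by_cases h5 : i = 2 * l - 3
        · apply h4
          have e1 : f (i + (i0 + 2)) = f (i0 - 1) := hf.per' (by push_cast; omega)
          have e2 : f (i + (i0 + 2) + 2) = f (i0 - 1 + 2) := hf.per' (by push_cast; omega)
          rwa [e1, e2] at hadj
        · exact h2 i0 (i + (i0 + 2)) (by omega) (by omega) hi0 hadj
    · push Not at h3
      exact ⟨0, fun i _ _ => h3 _⟩
  right
  have hg := hf.shift c
  set g : ℤ → V := fun i => f (i + c) with hgdef
  have b3 : ∀ i, Gᶜ.Adj (g i) (g (i + 3)) := by
    intro i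
    rw [SimpleGraph.compl_adj]
    refine ⟨hg.ne (by omega) (by push_cast; omega) (by push_cast; omega), ?_⟩
    have := h1 (i + c)
    have e : i + 3 + c = i + c + (3 : ℕ) := by push_cast; ring
    simp only [hgdef, e]; exact this
  have b2 : ∀ i : ℤ, 0 ≤ i → i ≤ 2 * l - 3 → Gᶜ.Adj (g i) (g (i + 2)) := by
    intro i hi1 hi2
    rw [SimpleGraph.compl_adj]
    refine ⟨hg.ne (by omega) (by push_cast; omega) (by push_cast; omega), ?_⟩
    have := hc i hi1 hi2
    have e : i + 2 + c = i + c + 2 := by ring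
    simp only [hgdef, e]; exact this
  have ev_inj : ∀ i j : ℤ, 0 ≤ i → i ≤ 0 + (l - 2 : ℕ) → 0 ≤ j → j ≤ 0 + (l - 2 : ℕ) →
      g (2 * i) = g (2 * j) → i = j := by
    intro i j _ _ _ _ h
    have := hg.inj h (by push_cast; omega) (by push_cast; omega)
    omega
  have od_inj : ∀ i j : ℤ, 1 ≤ i → i ≤ 1 + (l - 2 : ℕ) → 1 ≤ j → j ≤ 1 + (l - 2 : ℕ) →
      g (2 * i + 1) = g (2 * j + 1) → i = j := by
    intro i j _ _ _ _ h
    have := hg.inj h (by push_cast; omega) (by push_cast; omega)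
    omega
  have E := PO.of_seq (G := Gᶜ) (fun i => g (2 * i)) 0 (l - 2) ev_inj (by
    intro i h1 h2
    have := b2 (2 * i) (by omega) (by omega)
    have e : 2 * (i + 1) = 2 * i + 2 := by ring
    simp only [e]; exact this)
  have O := (PO.of_seq (G := Gᶜ) (fun i => g (2 * i + 1)) 1 (l - 2) od_inj (by
    intro i h1 h2
    have := b2 (2 * i + 1) (by omega) (by omega)
    have e : 2 * (i + 1) + 1 = 2 * i + 1 + 2 := by ring
    simp only [e]; exact this)).rev
  have hd : Disjoint ((Finset.Icc (0 : ℤ) (0 + (l - 2 : ℕ))).image (fun i => g (2 * i)))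
      ((Finset.Icc (1 : ℤ) (1 + (l - 2 : ℕ))).image (fun i => g (2 * i + 1))) := by
    rw [Finset.disjoint_left]
    intro v hv hv'
    simp only [Finset.mem_image, Finset.mem_Icc] at hv hv'
    obtain ⟨i, hi, rfl⟩ := hv
    obtain ⟨j, hj, hj'⟩ := hv'
    have := hg.inj hj' (by push_cast; omega) (by push_cast; omega)
    omega
  have P := E.append O (by
    have := b3 (2 * (0 + (l - 2 : ℕ)))
    have e : 2 * (0 + ((l - 2 : ℕ) : ℤ)) + 3 = 2 * (1 + (l - 2 : ℕ)) + 1 := by ring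
    rw [e] at this
    exact this) hd
  obtain ⟨q, hq, _⟩ := P.close' (l := 2 * l - 2) (by
    have := (b3 0).symm
    simpa using this) (by
    rw [Finset.card_union_of_disjoint hd, Finset.card_image_of_injOn, Finset.card_image_of_injOn]
    · simp only [Int.card_Icc]; omega
    · intro i hi j hj hij
      simp only [Finset.coe_Icc, Set.mem_Icc] at hi hj
      exact od_inj i j hi.1 hi.2 hj.1 hj.2 hij
    · intro i hi j hj hij
      simp only [Finset.coe_Icc, Set.mem_Icc] at hi hj
      exact ev_inj i j hi.1 hi.2 hj.1 hj.2 hij) (by omega)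
  exact ⟨q, hq⟩

theorem descend {G : SimpleGraph V} {k : ℕ} (hk : 5 ≤ k) : ∀ L, 2 * k ≤ L → MonoC G L →
    MonoC G (2 * k) := by
  intro L
  induction L using Nat.strong_induction_on with
  | _ L ih =>
    intro hL hM
    rcases eq_or_lt_of_le hL with h | h
    · rw [h]; exact hM
    rcases Nat.even_or_odd' L with ⟨l, rfl | rfl⟩
    · refine ih (2 * l - 2) (by omega) (by omega) ?_
      rcases hM with ⟨f, hf⟩ | ⟨f, hf⟩
      · exact descend_even (by omega) hf
      · exact (descend_even (by omega) hf).compl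
    · refine ih (2 * l) (by omega) (by omega) ?_
      rcases hM with ⟨f, hf⟩ | ⟨f, hf⟩
      · exact descend_odd (by omega) hf
      · exact (descend_odd (by omega) hf).compl

/-- a monochromatic `C4` -/
theorem exists_C4 {G : SimpleGraph V} (hV : 17 ≤ Fintype.card V) : MonoC G 4 := by
  classical
  -- four-cycle from two common neighbours
  have mk : ∀ (H : SimpleGraph V) (x x' y y' : V), x ≠ x' → y ≠ y' → H.Adj x y → H.Adj x y' →
      H.Adj x' y → H.Adj x' y' → ∃ f, Cyc H 4 f := by
    intro H x x' y y' hx hy h1 h2 h3 h4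
    have n1 := h1.ne; have n2 := h2.ne; have n3 := h3.ne; have n4 := h4.ne
    have P := (((PO.single (G := H) x).snoc (c := y) h1 (by simp [n1.symm])).snoc (c := x') h3.symm
      (by simp [n3, hx.symm])).snoc (c := y') h4 (by simp [n4.symm, hy.symm, n2.symm])
    obtain ⟨f, hf, _⟩ := P.close' (l := 4) h2.symm (by
      rw [Finset.card_insert_of_notMem, Finset.card_insert_of_notMem,
          Finset.card_insert_of_notMem, Finset.card_singleton]
      · simp [n1.symm]
      · simp [n3, hx.symm]
      · simp [n4.symm, hy.symm, n2.symm]) (by norm_num)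
    exact ⟨f, hf⟩
  obtain ⟨X, -, hX⟩ := Finset.exists_subset_card_eq (s := (Finset.univ : Finset V)) (n := 3)
    (by rw [Finset.card_univ]; omega)
  obtain ⟨x1, x2, x3, h12, h13, h23, rfl⟩ := Finset.card_eq_three.1 hX
  have hW : 14 ≤ (({x1, x2, x3} : Finset V)ᶜ).card := by
    rw [Finset.card_compl, hX]; omega
  set W := ({x1, x2, x3} : Finset V)ᶜ with hWdef
  let φ : V → Bool × Bool × Bool := fun y => (decide (G.Adj x1 y), decide (G.Adj x2 y),
    decide (G.Adj x3 y))
  obtain ⟨y, hy, y', hy', hne, hφ⟩ := Finset.exists_ne_map_eq_of_card_lt_of_maps_to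
    (s := W) (t := (Finset.univ : Finset (Bool × Bool × Bool))) (f := φ) (by
      have : (Finset.univ : Finset (Bool × Bool × Bool)).card = 8 := by decide
      omega) (fun y _ => Finset.mem_univ _)
  simp only [hWdef, Finset.mem_compl, Finset.mem_insert, Finset.mem_singleton, not_or] at hy hy'
  simp only [φ, Prod.mk.injEq, decide_eq_decide] at hφ
  obtain ⟨e1, e2, e3⟩ := hφ
  have red : ∀ x x', x ≠ x' → G.Adj x y → G.Adj x' y → (G.Adj x y ↔ G.Adj x y') →
      (G.Adj x' y ↔ G.Adj x' y') → MonoC G 4 := by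
    intro x x' hx h h' e e'
    exact Or.inl (mk G x x' y y' hx hne h (e.1 h) h' (e'.1 h'))
  have blue : ∀ x x', x ≠ x' → ¬ G.Adj x y → ¬ G.Adj x' y → (G.Adj x y ↔ G.Adj x y') →
      (G.Adj x' y ↔ G.Adj x' y') → y ≠ x → y ≠ x' → y' ≠ x → y' ≠ x' → MonoC G 4 := by
    intro x x' hx h h' e e' a1 a2 a3 a4
    refine Or.inr (mk Gᶜ x x' y y' hx hne ?_ ?_ ?_ ?_) <;> rw [SimpleGraph.compl_adj]
    · exact ⟨a1.symm, h⟩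
    · exact ⟨a3.symm, fun q => h (e.2 q)⟩
    · exact ⟨a2.symm, h'⟩
    · exact ⟨a4.symm, fun q => h' (e'.2 q)⟩
  by_cases q1 : G.Adj x1 y <;> by_cases q2 : G.Adj x2 y <;> by_cases q3 : G.Adj x3 y
  · exact red x1 x2 h12 q1 q2 e1 e2
  · exact red x1 x2 h12 q1 q2 e1 e2
  · exact red x1 x3 h13 q1 q3 e1 e3
  · exact blue x2 x3 h23 q2 q3 e2 e3 hy.2.1 hy.2.2 hy'.2.1 hy'.2.2
  · exact red x2 x3 h23 q2 q3 e2 e3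
  · exact blue x1 x3 h13 q1 q3 e1 e3 hy.1 hy.2.2 hy'.1 hy'.2.2
  · exact blue x1 x2 h12 q1 q2 e1 e2 hy.1 hy.2.1 hy'.1 hy'.2.1
  · exact blue x1 x2 h12 q1 q2 e1 e2 hy.1 hy.2.1 hy'.1 hy'.2.1

end ldsproof

section ldsproof
variable {V : Type*} [Fintype V] [DecidableEq V]

theorem clique_path1 {H : SimpleGraph V} (b : V) (T : Finset V) (hb : b ∉ T)
    (hT : ∀ x ∈ insert b T, ∀ y ∈ insert b T, x ≠ y → H.Adj x y) :
    ∃ a, PO H a (insert b T) b := by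
  induction T using Finset.induction_on with
  | empty => exact ⟨b, by simpa using PO.single (G := H) b⟩
  | insert x T hx ih =>
    simp only [Finset.mem_insert, not_or] at hb
    have hsub : insert b T ⊆ insert b (insert x T) :=
      Finset.insert_subset_insert _ (Finset.subset_insert _ _)
    obtain ⟨a, ha⟩ := ih hb.2 (fun u hu v hv => hT u (hsub hu) v (hsub hv))
    have hx' : x ∉ insert b T := by simp only [Finset.mem_insert, not_or]; exact ⟨Ne.symm hb.1, hx⟩
    have := PO.cons (hT x (by simp) a (hsub ha.left_mem) (fun e => hx' (e ▸ ha.left_mem))) hx' ha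
    rw [Finset.insert_comm] at this
    exact ⟨x, this⟩

theorem clique_path {H : SimpleGraph V} {S : Finset V} {b : V} (hb : b ∈ S)
    (hS : ∀ x ∈ S, ∀ y ∈ S, x ≠ y → H.Adj x y) : ∃ a, PO H a S b := by
  have e := Finset.insert_erase hb
  have := clique_path1 (H := H) b (S.erase b) (Finset.notMem_erase _ _) (by rw [e]; exact hS)
  rwa [e] at this

theorem clique_path2 {H : SimpleGraph V} {S : Finset V} {a b : V} (ha : a ∈ S) (hb : b ∈ S)
    (hab : a ≠ b) (hS : ∀ x ∈ S, ∀ y ∈ S, x ≠ y → H.Adj x y) : PO H a S b := by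
  obtain ⟨x, hx⟩ := clique_path (H := H) (S := S.erase a) (b := b)
    (Finset.mem_erase.2 ⟨hab.symm, hb⟩)
    (fun u hu v hv => hS u (Finset.mem_of_mem_erase hu) v (Finset.mem_of_mem_erase hv))
  have hx1 := Finset.mem_erase.1 hx.left_mem
  have := PO.cons (hS a ha x hx1.2 hx1.1.symm) (Finset.notMem_erase _ _) hx
  rwa [Finset.insert_erase ha] at this

theorem alt_path {H : SimpleGraph V} (W : Finset V) : ∀ (B : Finset V) (c : V), c ∈ B →
    Disjoint B W → W.card < B.card → (∀ x ∈ B, ∀ y ∈ B, x ≠ y → H.Adj x y) →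
    (∀ w ∈ W, ∀ b ∈ B, H.Adj w b) → ∃ b ∈ B, PO H b (B ∪ W) c := by
  induction W using Finset.induction_on with
  | empty =>
    intro B c hc _ _ hB _
    obtain ⟨a, ha⟩ := clique_path hc hB
    exact ⟨a, ha.left_mem, by simpa using ha⟩
  | insert w W hw ih =>
    intro B c hc hd hcard hB hW
    rw [Finset.card_insert_of_notMem hw] at hcard
    rw [Finset.disjoint_insert_right] at hd
    obtain ⟨b0, hb0, hbc⟩ := Finset.exists_mem_ne (show 1 < B.card by omega) c
    have hsub : B.erase b0 ⊆ B := Finset.erase_subset _ _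
    obtain ⟨b, hb, hP⟩ := ih (B.erase b0) c (Finset.mem_erase.2 ⟨hbc.symm, hc⟩)
      (Finset.disjoint_of_subset_left hsub hd.2) (by rw [Finset.card_erase_of_mem hb0]; omega)
      (fun x hx y hy => hB x (hsub hx) y (hsub hy))
      (fun u hu v hv => hW u (Finset.mem_insert_of_mem hu) v (hsub hv))
    have hww : w ∉ B.erase b0 ∪ W := by
      simp only [Finset.mem_union, not_or]; exact ⟨fun h => hd.1 (hsub h), hw⟩
    have h1 := PO.cons (hW w (by simp) b (hsub hb)) hww hP
    have hbb : b0 ∉ insert w (B.erase b0 ∪ W) := by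
      simp only [Finset.mem_insert, Finset.mem_union, not_or]
      exact ⟨fun e => hd.1 (e ▸ hb0), Finset.notMem_erase _ _,
        fun h => Finset.disjoint_left.1 hd.2 hb0 h⟩
    have h2 := PO.cons (hW w (by simp) b0 hb0).symm hbb h1
    refine ⟨b0, hb0, ?_⟩
    have e : insert b0 (insert w (B.erase b0 ∪ W)) = B ∪ insert w W := by
      rw [Finset.insert_comm, ← Finset.insert_union, Finset.insert_erase hb0,
        ← Finset.union_insert]
    rwa [e] at h2

theorem blue_long {H : SimpleGraph V} {C Z1 Z2 : Finset V} {l h0 : ℕ} (hC : C.card = l)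
    (hl : 4 ≤ l) (hh : h0 = l / 2) (dC1 : Disjoint Z1 C) (dC2 : Disjoint Z2 C)
    (d12 : Disjoint Z1 Z2) (hZ2 : Z2.card ≤ h0)
    (hJ : ∀ w ∈ Z2, l - h0 + 1 ≤ (nb H w ∩ C).card)
    (E1 : ∀ x ∈ Z1, ∀ y ∈ Z1, x ≠ y → H.Adj x y)
    (E2 : ∀ w ∈ Z2, ¬ (∀ c ∈ C, H.Adj w c) → ∀ z ∈ Z1, H.Adj z w)
    (B : V → Finset V) (BC : ∀ z ∈ Z1, B z ⊆ C) (Bc : ∀ z ∈ Z1, (B z).card = h0)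
    (Bcl : ∀ z ∈ Z1, ∀ x ∈ B z, ∀ y ∈ B z, x ≠ y → H.Adj x y)
    (Bz : ∀ z ∈ Z1, ∀ x ∈ B z, H.Adj z x)
    (E6 : ∃ z ∈ Z1, ∃ z' ∈ Z1, z ≠ z' ∧ ∃ c ∈ B z, H.Adj z' c) :
    ∃ L, Z1.card + Z2.card + h0 ≤ L + 1 ∧ ∃ g, Cyc H L g := by
  obtain ⟨z, hz, z', hz', hzz, c, hc, hcz⟩ := E6
  have hZ1 : 2 ≤ Z1.card := by
    rw [← Finset.card_pair hzz]
    apply Finset.card_le_card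
    intro x; simp only [Finset.mem_insert, Finset.mem_singleton]
    rintro (rfl | rfl) <;> assumption
  have dB1 : Disjoint Z1 (B z) := Finset.disjoint_of_subset_right (BC z hz) dC1
  have dB2 : Disjoint Z2 (B z) := Finset.disjoint_of_subset_right (BC z hz) dC2
  have E5 : ∀ a ∈ Z2, ∃ c ∈ B z, H.Adj c a := by
    intro a ha
    have h1 := hJ a ha
    have h2 : 0 < ((nb H a ∩ C) ∩ B z).card := by
      have a1 := Finset.card_union_add_card_inter (nb H a ∩ C) (B z)
      have a2 := Finset.card_le_card
        (Finset.union_subset (Finset.inter_subset_right (s₁ := nb H a) (s₂ := C)) (BC z hz))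
      have := Bc z hz
      omega
    obtain ⟨x, hx⟩ := Finset.card_pos.1 h2
    simp only [Finset.mem_inter, mem_nb] at hx
    exact ⟨x, hx.2, hx.1.1.symm⟩
  by_cases hZ3 : ∀ w ∈ Z2, ∀ c ∈ C, H.Adj w c
  · -- case I
    obtain ⟨W, hW, hWc⟩ := Finset.exists_subset_card_eq (show min Z2.card (h0 - 1) ≤ Z2.card by omega)
    have hd1 : Disjoint (B z) W := (Finset.disjoint_of_subset_left hW dB2).symm
    obtain ⟨b, hb, hP⟩ := alt_path (H := H) W (B z) c hc hd1 (by rw [Bc z hz]; omega) (Bcl z hz)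
      (fun w hw b hb => hZ3 w (hW hw) b (BC z hz hb))
    have hQ := clique_path2 hz' hz hzz.symm E1
    have hd : Disjoint Z1 (B z ∪ W) :=
      Finset.disjoint_union_right.2 ⟨dB1, Finset.disjoint_of_subset_right hW d12⟩
    have hR := hQ.append hP (Bz z hz b hb) hd
    have hcard : (Z1 ∪ (B z ∪ W)).card = Z1.card + (h0 + min Z2.card (h0 - 1)) := by
      rw [Finset.card_union_of_disjoint hd, Finset.card_union_of_disjoint hd1, Bc z hz, hWc]
    obtain ⟨g, hg, _⟩ := hR.close' hcz.symm hcard (by omega)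
    exact ⟨_, by omega, g, hg⟩
  · push Not at hZ3
    obtain ⟨w0, hw0, hw0'⟩ := hZ3
    have hw0'' : ¬ (∀ c ∈ C, H.Adj w0 c) := by push Not; exact hw0'
    obtain ⟨y, hY⟩ := clique_path hz E1
    by_cases h1 : Z2.card = 1
    · -- case II
      obtain ⟨a, ha⟩ := Finset.card_eq_one.1 h1
      rw [ha, Finset.mem_singleton] at hw0
      subst hw0
      have haZ : w0 ∈ Z2 := by rw [ha]; simp
      obtain ⟨c', hc', hca⟩ := E5 w0 haZ
      obtain ⟨b, hb⟩ := clique_path hc' (Bcl z hz)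
      have hR := hY.append hb (Bz z hz b hb.left_mem) dB1
      have hn : w0 ∉ Z1 ∪ B z := by
        simp only [Finset.mem_union, not_or]
        exact ⟨Finset.disjoint_right.1 d12 haZ, Finset.disjoint_left.1 dB2 haZ⟩
      have hS := PO.cons (E2 w0 haZ hw0'' y hY.left_mem).symm hn hR
      have hcard : (insert w0 (Z1 ∪ B z)).card = Z1.card + h0 + 1 := by
        rw [Finset.card_insert_of_notMem hn, Finset.card_union_of_disjoint dB1, Bc z hz]
      obtain ⟨g, hg, _⟩ := hS.close' hca hcard (by omega)
      exact ⟨_, by omega, g, hg⟩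
    · -- case III
      have h2 : 2 ≤ Z2.card := by
        have : 0 < Z2.card := Finset.card_pos.2 ⟨_, hw0⟩
        omega
      obtain ⟨g, hg, hgZ⟩ := jackson (G := H) dC2 hJ (by omega) h2 (by omega)
      have altZ : ∀ i, g i ∈ Z2 → g (i + 1) ∈ C := by
        intro i hi
        rcases (hg.2.2 i).2 with h | h
        · exact h.2
        · exact absurd h.1 (Finset.disjoint_left.1 dC2 hi)
      have altC : ∀ i, g i ∈ C → g (i + 1) ∈ Z2 := by
        intro i hi
        rcases (hg.2.2 i).2 with h | h
        · exact absurd hi (Finset.disjoint_left.1 dC2 h.1)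
        · exact h.2
      have alt2 : ∀ i, g i ∈ Z2 → g (i + 2) ∈ Z2 := by
        intro i hi
        have := altC _ (altZ i hi)
        have e : i + 1 + 1 = i + 2 := by ring
        rwa [e] at this
      have hrg : rg g ⊆ Z2 ∪ C := by
        intro w hw
        obtain ⟨i, rfl⟩ := mem_rg.1 hw
        rcases (hg.2.2 i).2 with h | h <;> simp [h.1]
      have hrc := hg.card_rg
      have hQc : (rg g ∩ C).card = Z2.card := by
        have e : rg g ∩ C = rg g \ Z2 := by
          ext w
          simp only [Finset.mem_inter, Finset.mem_sdiff]
          constructor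
          · exact fun h => ⟨h.1, fun h' => Finset.disjoint_left.1 dC2 h' h.2⟩
          · intro h
            refine ⟨h.1, ?_⟩
            rcases Finset.mem_union.1 (hrg h.1) with h' | h'
            · exact absurd h' h.2
            · exact h'
        rw [e, Finset.card_sdiff_of_subset hgZ]; omega
      have key : ∃ i c, g i ∈ Z2 ∧ ¬ (∀ c ∈ C, H.Adj (g i) c) ∧ c ∈ B z ∧ H.Adj c (g (i + 2)) ∧
          (c ∉ rg g ∨ c = g (i + 1)) := by
        obtain ⟨i0, rfl⟩ := mem_rg.1 (hgZ hw0)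
        by_cases k1 : B z ⊆ rg g
        · have hBQ : B z = rg g ∩ C := by
            apply Finset.eq_of_subset_of_card_le
            · exact Finset.subset_inter k1 (BC z hz)
            · rw [hQc, Bc z hz]; exact hZ2
          refine ⟨i0, g (i0 + 1), hw0, hw0'', ?_, ?_, Or.inr rfl⟩
          · rw [hBQ]; exact Finset.mem_inter.2 ⟨mem_rg.2 ⟨_, rfl⟩, altZ _ hw0⟩
          · have := (hg.2.2 (i0 + 1)).1
            have e : i0 + 1 + 1 = i0 + 2 := by ring
            rwa [e] at this
        · obtain ⟨c0, hc0, hc0'⟩ := Finset.not_subset.1 k1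
          by_cases k2 : ∃ j, g j ∈ B z
          · obtain ⟨j, hj⟩ := k2
            by_cases k3 : ∀ w ∈ Z2, ¬ (∀ c ∈ C, H.Adj w c)
            · have hjC := BC z hz hj
              have hm : g (j - 1) ∈ Z2 := by
                rcases (hg.2.2 (j - 1)).2 with h | h
                · exact h.1
                · have e : j - 1 + 1 = j := by ring
                  rw [e] at h
                  exact absurd hjC (Finset.disjoint_left.1 dC2 h.2)
              refine ⟨j - 1, g j, hm, k3 _ hm, hj, ?_, Or.inr (by congr 1; ring)⟩
              have := (hg.2.2 j).1
              have e : j - 1 + 2 = j + 1 := by ring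
              rwa [e]
            · by_contra hcon
              apply k3
              have step : ∀ m : ℕ, g (i0 + 2 * m) ∈ Z2 ∧ ¬ (∀ c ∈ C, H.Adj (g (i0 + 2 * m)) c) := by
                intro m
                induction m with
                | zero => simpa using ⟨hw0, hw0'⟩
                | succ m ih =>
                  have e : i0 + 2 * ((m + 1 : ℕ) : ℤ) = i0 + 2 * m + 2 := by push_cast; ring
                  rw [e]
                  refine ⟨alt2 _ ih.1, fun hall => hcon ?_⟩
                  exact ⟨i0 + 2 * m, c0, ih.1, ih.2, hc0, (hall c0 (BC z hz hc0)).symm, Or.inl hc0'⟩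
              intro w hw
              obtain ⟨j, rfl⟩ := mem_rg.1 (hgZ hw)
              obtain ⟨j', q1, q2, q3⟩ := hg.win j i0
              rw [← q3] at hw ⊢
              obtain ⟨m, hm⟩ : ∃ m : ℕ, j' - i0 = m := ⟨(j' - i0).toNat, by omega⟩
              rcases Nat.even_or_odd' m with ⟨r, hr | hr⟩
              · have e : j' = i0 + 2 * r := by omega
                rw [e]; exact (step r).2
              · exfalso
                have e : j' = i0 + 2 * r + 1 := by omega
                rw [e] at hw
                exact Finset.disjoint_left.1 dC2 hw (altZ _ (step r).1)
          · obtain ⟨c1, hc1, hc1'⟩ := E5 _ (alt2 _ hw0)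
            refine ⟨i0, c1, hw0, hw0'', hc1, hc1', Or.inl fun h => k2 ?_⟩
            obtain ⟨j, rfl⟩ := mem_rg.1 h
            exact ⟨j, hc1⟩
      obtain ⟨i, c', hi, hi', hc', hadj, hcg⟩ := key
      have hA := (hg.arc (i + 2) (i + (2 * Z2.card : ℕ)) (by omega) (by omega)).mono (bip_le _ _ _)
      have hAc := hg.arc_card (i + 2) (i + (2 * Z2.card : ℕ)) (by omega) (by omega)
      have hAs := Cyc.arc_sub (f := g) (i + 2) (i + (2 * Z2.card : ℕ))
      rw [hg.per] at hA
      have hcA : c' ∉ (Finset.Icc (i + 2) (i + (2 * Z2.card : ℕ))).image g := by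
        rcases hcg with h | h
        · exact fun h' => h (hAs h')
        · rw [h, ← hg.per]
          exact hg.not_mem_arc (by omega) (by omega)
      set A := (Finset.Icc (i + 2) (i + (2 * Z2.card : ℕ))).image g with hAdef
      have hA1 : Disjoint A Z1 := by
        refine Finset.disjoint_of_subset_left (hAs.trans hrg) ?_
        exact Finset.disjoint_union_left.2 ⟨d12.symm, dC1.symm⟩
      set B' := insert c' (B z \ rg g) with hB'
      have hB'B : B' ⊆ B z := by
        intro w hw
        rcases Finset.mem_insert.1 hw with rfl | h
        · exact hc'
        · exact (Finset.mem_sdiff.1 h).1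
      obtain ⟨b, hb⟩ := clique_path (H := H) (S := B') (b := c') (by simp [hB'])
        (fun x hx y hy => Bcl z hz x (hB'B hx) y (hB'B hy))
      have hAB : Disjoint A B' := by
        rw [Finset.disjoint_right]
        intro w hw
        rcases Finset.mem_insert.1 hw with rfl | h
        · exact hcA
        · exact fun h' => (Finset.mem_sdiff.1 h).2 (hAs h')
      have h1B : Disjoint Z1 B' := Finset.disjoint_of_subset_right hB'B dB1
      have P1 := hA.append hY (E2 _ hi hi' y hY.left_mem).symm hA1
      have hdd := Finset.disjoint_union_left.2 ⟨hAB, h1B⟩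
      have P2 := P1.append hb (Bz z hz b (hB'B hb.left_mem)) hdd
      have hB'c : h0 - Z2.card ≤ B'.card := by
        have a1 : (B z \ rg g).card ≤ B'.card := Finset.card_le_card (Finset.subset_insert _ _)
        have a2 := Finset.card_sdiff_add_card_inter (B z) (rg g)
        have a3 : (B z ∩ rg g).card ≤ (rg g ∩ C).card := by
          apply Finset.card_le_card
          intro w hw
          simp only [Finset.mem_inter] at hw ⊢
          exact ⟨hw.2, BC z hz hw.1⟩
        have := Bc z hz
        omega
      have hcard : ((A ∪ Z1) ∪ B').card = A.card + Z1.card + B'.card := by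
        rw [Finset.card_union_of_disjoint hdd, Finset.card_union_of_disjoint hA1]
      obtain ⟨q, hq, _⟩ := P2.close' hadj hcard (by omega)
      exact ⟨_, by omega, q, hq⟩

end ldsproof

section ldsproof
variable {V : Type*} [Fintype V] [DecidableEq V]

theorem lc_a {G : SimpleGraph V} {l : ℕ} {f : ℤ → V} (hf : Cyc G l f) {z : V} (hz : z ∉ rg f)
    (i : ℤ) (h1 : G.Adj z (f i)) (h2 : G.Adj z (f (i + 1))) : ∃ g, Cyc G (l + 1) g := by
  have hl := hf.1
  have A := hf.arc (i + 1) (i + l) (by omega) (by omega)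
  rw [hf.arc_full (i + 1) (i + l) (by ring), hf.per] at A
  have P := A.snoc h1.symm hz
  obtain ⟨g, hg, _⟩ := P.close' (l := l + 1) h2
    (by rw [Finset.card_insert_of_notMem hz, hf.card_rg]) (by omega)
  exact ⟨g, hg⟩

theorem lc_b {G : SimpleGraph V} {l : ℕ} {f : ℤ → V} (hf : Cyc G l f) {z : V} (hz : z ∉ rg f)
    (i j : ℤ) (hne : f i ≠ f j) (h1 : G.Adj z (f i)) (h2 : G.Adj z (f j))
    (h3 : G.Adj (f (i + 1)) (f (j + 1))) : ∃ g, Cyc G (l + 1) g := by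
  have hl := hf.1
  obtain ⟨j', hj1, hj2, hj3⟩ := hf.order i j hne
  have hj4 : f (j' + 1) = f (j + 1) := (hf.shift_inj 1).2 hj3
  rw [← hj3] at h2
  rw [← hj4] at h3
  have A := (hf.arc (j' + 1) i (by omega) (by omega)).rev
  have B := hf.arc (i + 1) (j' + l) (by omega) (by omega)
  rw [hf.per] at B
  have d := hf.arc_disj (a := j' + 1) (b := i) (c := i + 1) (d := j' + l) (by omega) (by omega)
  have P := A.append B h3.symm d
  rw [hf.arc_union (by ring) (by omega) (by omega) (by ring)] at P
  have P' := P.snoc h2.symm hz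
  obtain ⟨g, hg, _⟩ := P'.close' (l := l + 1) h1
    (by rw [Finset.card_insert_of_notMem hz, hf.card_rg]) (by omega)
  exact ⟨g, hg⟩

theorem lc_c {G : SimpleGraph V} {l : ℕ} {f : ℤ → V} (hf : Cyc G l f) {z z' : V}
    (hz : z ∉ rg f) (hz' : z' ∉ rg f) (hzz : G.Adj z z') (i : ℤ) (r : ℕ) (hr : 1 ≤ r) (hr2 : r ≤ 2)
    (h1 : G.Adj z' (f i)) (h2 : G.Adj z (f (i + r))) : ∃ L, l < L ∧ ∃ g, Cyc G L g := by
  have hl := hf.1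
  have A := hf.arc (i + r) (i + l) (by omega) (by omega)
  have c := hf.arc_card (i + r) (i + l) (by omega) (by omega)
  have hs := Cyc.arc_sub (f := f) (i + r) (i + l)
  rw [hf.per] at A
  have m1 : z' ∉ (Finset.Icc (i + (r : ℤ)) (i + l)).image f := fun h => hz' (hs h)
  have P := A.snoc h1.symm m1
  have m2 : z ∉ insert z' ((Finset.Icc (i + (r : ℤ)) (i + l)).image f) := by
    rw [Finset.mem_insert, not_or]
    exact ⟨hzz.ne, fun h => hz (hs h)⟩
  have P' := P.snoc hzz.symm m2
  obtain ⟨g, hg, _⟩ := P'.close' (l := l + 3 - r) h2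
    (by rw [Finset.card_insert_of_notMem m2, Finset.card_insert_of_notMem m1]; omega) (by omega)
  exact ⟨_, by omega, g, hg⟩

theorem lc_c' {G : SimpleGraph V} {l : ℕ} {f : ℤ → V} (hf : Cyc G l f) {z z' : V}
    (hz : z ∉ rg f) (hz' : z' ∉ rg f) (hzz : G.Adj z z') (i : ℤ) (r : ℕ) (hr : 1 ≤ r) (hr2 : r ≤ 2)
    (h1 : G.Adj z' (f i)) (h2 : G.Adj z (f (i - r))) : ∃ L, l < L ∧ ∃ g, Cyc G L g := by
  refine lc_c hf.neg (z := z) (z' := z') (by rwa [Cyc.rg_neg]) (by rwa [Cyc.rg_neg]) hzz (-i) r hr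
    hr2 (by simpa using h1) ?_
  have e : -(-i + (r : ℤ)) = i - r := by ring
  simpa only [e] using h2

theorem long_core {G : SimpleGraph V} {k l : ℕ} (hk : 5 ≤ k) (hV : 3 * k + 2 ≤ Fintype.card V)
    {f : ℤ → V} (hf : Cyc G l f) (hl : 4 ≤ l) (hlk : l + 1 ≤ 2 * k)
    (mx : ∀ L, l < L → ¬ ∃ g, Cyc G L g) (mx' : ∀ L, l < L → ¬ ∃ g, Cyc Gᶜ L g) : False := by
  classical
  obtain ⟨h0, hh⟩ : ∃ h0, h0 = l / 2 := ⟨_, rfl⟩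
  obtain ⟨s, hs⟩ := hf.exists_shift_map 1
  have hC := hf.card_rg
  let T : V → Finset V := fun z => nb G z ∩ rg f
  have memT : ∀ z i, f i ∈ T z ↔ G.Adj z (f i) := by
    intro z i
    simp only [T, Finset.mem_inter, mem_nb, mem_rg]
    exact ⟨fun h => h.1, fun h => ⟨h, i, rfl⟩⟩
  have TC : ∀ z, T z ⊆ rg f := fun z => Finset.inter_subset_right
  let B : V → Finset V := fun z => (T z).image s
  have key : ∀ z, ∀ y ∈ B z, ∃ i, G.Adj z (f i) ∧ f (i + 1) = y := by
    intro z y hy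
    obtain ⟨w, hw, rfl⟩ := Finset.mem_image.1 hy
    obtain ⟨i, rfl⟩ := mem_rg.1 (TC z hw)
    exact ⟨i, (memT z i).1 hw, (hs i).symm⟩
  have BC : ∀ z, B z ⊆ rg f := by
    intro z y hy
    obtain ⟨i, _, rfl⟩ := key z y hy
    exact mem_rg.2 ⟨_, rfl⟩
  have Bcard : ∀ z, (B z).card = (T z).card := by
    intro z
    apply Finset.card_image_of_injOn
    intro x hx y hy e
    obtain ⟨i, rfl⟩ := mem_rg.1 (TC z hx)
    obtain ⟨j, rfl⟩ := mem_rg.1 (TC z hy)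
    rw [hs, hs] at e
    exact (hf.shift_inj 1).1 e
  have dTB : ∀ z, z ∉ rg f → Disjoint (T z) (B z) := by
    intro z hz
    rw [Finset.disjoint_right]
    intro y hy hy'
    obtain ⟨i, hi, rfl⟩ := key z y hy
    exact mx (l + 1) (by omega) (lc_a hf hz i hi ((memT z _).1 hy'))
  have Tle : ∀ z, z ∉ rg f → (T z).card ≤ h0 := by
    intro z hz
    have h1 := Finset.card_le_card (Finset.union_subset (TC z) (BC z))
    rw [Finset.card_union_of_disjoint (dTB z hz), Bcard, hC] at h1
    omega
  have cc : ∀ z z', z ∉ rg f → z' ∉ rg f → (T z).card = h0 → G.Adj z z' → ∀ i, ¬ G.Adj z' (f i) := by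
    intro z z' hz hz' hT hzz i hi
    have hU : (rg f \ (T z ∪ B z)).card ≤ 1 := by
      rw [Finset.card_sdiff_of_subset (Finset.union_subset (TC z) (BC z)),
        Finset.card_union_of_disjoint (dTB z hz), Bcard, hC]
      omega
    have inTB : ∀ j, f j ∈ T z ∪ B z → G.Adj z (f j) ∨ G.Adj z (f (j - 1)) := by
      intro j hj
      rcases Finset.mem_union.1 hj with h | h
      · exact Or.inl ((memT z j).1 h)
      · right
        obtain ⟨i', hi', e⟩ := key z _ h
        have e2 : f i' = f (j - 1) := by
          rw [← hf.shift_inj 1, e]; congr 1; ring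
        rwa [← e2]
    have bad : ¬ ∃ L, l < L ∧ ∃ g, Cyc G L g := fun ⟨L, h1, h2⟩ => mx L h1 h2
    have n1 : f (i + 2) ∉ T z ∪ B z := by
      intro h
      rcases inTB _ h with h | h
      · exact bad (lc_c hf hz hz' hzz i 2 (by omega) (by omega) hi (by exact_mod_cast h))
      · have e : i + 2 - 1 = i + (1 : ℕ) := by push_cast; ring
        rw [e] at h
        exact bad (lc_c hf hz hz' hzz i 1 (by omega) (by omega) hi h)
    have n2 : f (i - 1) ∉ T z ∪ B z := by
      intro h
      rcases inTB _ h with h | h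
      · exact bad (lc_c' hf hz hz' hzz i 1 (by omega) (by omega) hi (by exact_mod_cast h))
      · have e : i - 1 - 1 = i - (2 : ℕ) := by push_cast; ring
        rw [e] at h
        exact bad (lc_c' hf hz hz' hzz i 2 (by omega) (by omega) hi h)
    have := Finset.card_le_one.1 hU (f (i + 2)) (by simp only [Finset.mem_sdiff]; exact ⟨mem_rg.2 ⟨_, rfl⟩, n1⟩)
      (f (i - 1)) (by simp only [Finset.mem_sdiff]; exact ⟨mem_rg.2 ⟨_, rfl⟩, n2⟩)
    exact hf.ne (by omega) (by omega) (by omega) this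
  let Z : Finset V := (rg f)ᶜ
  let Z2 : Finset V := Z.filter (fun z => (T z).card + 1 ≤ h0)
  let Z1 : Finset V := Z \ Z2
  have mZ : ∀ z, z ∈ Z ↔ z ∉ rg f := fun z => Finset.mem_compl
  have m2 : ∀ z, z ∈ Z2 ↔ z ∉ rg f ∧ (T z).card + 1 ≤ h0 := by
    intro z; rw [Finset.mem_filter, mZ]
  have m1 : ∀ z, z ∈ Z1 → z ∉ rg f ∧ (T z).card = h0 := by
    intro z hz
    have h1 := Finset.mem_sdiff.1 hz
    have h2 := (mZ z).1 h1.1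
    refine ⟨h2, ?_⟩
    have h3 := Tle z h2
    by_contra h4
    exact h1.2 ((m2 z).2 ⟨h2, by omega⟩)
  have hZc : Z.card + l = Fintype.card V := by
    have := Finset.card_compl_add_card (rg f)
    rw [hC] at this; exact this
  have hZ12 : Z1.card + Z2.card = Z.card :=
    Finset.card_sdiff_add_card_eq_card (Finset.filter_subset _ _)
  have hJ : ∀ w ∈ Z2, l - h0 + 1 ≤ (nb Gᶜ w ∩ rg f).card := by
    intro w hw
    have h1 := (m2 w).1 hw
    have h2 := compl_count G h1.1
    rw [hC] at h2
    have h3 := h1.2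
    simp only [T] at h3
    omega
  have hZ2 : Z2.card ≤ h0 := by
    by_contra hcon
    obtain ⟨X, hX, hXc⟩ := Finset.exists_subset_card_eq (s := Z2) (n := h0 + 1) (by omega)
    have hd : Disjoint X (rg f) := by
      rw [Finset.disjoint_left]
      exact fun x hx => ((m2 x).1 (hX hx)).1
    obtain ⟨g, hg, _⟩ := jackson (G := Gᶜ) (X := X) (Y := rg f) (K := l - h0 + 1) hd
      (fun x hx => hJ x (hX hx)) (by omega) (by omega) (by omega)
    exact mx' (2 * X.card) (by omega) ⟨g, hg.mono (bip_le _ _ _)⟩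
  have hZ1 : 3 ≤ Z1.card := by omega
  have hne1 : ∀ z ∈ Z1, ∃ i, G.Adj z (f i) := by
    intro z hz
    have h1 := (m1 z hz).2
    obtain ⟨w, hw⟩ : (T z).Nonempty := Finset.card_pos.1 (by omega)
    obtain ⟨i, rfl⟩ := mem_rg.1 (TC z hw)
    exact ⟨i, (memT z i).1 hw⟩
  obtain ⟨L, hL, hg⟩ := blue_long (H := Gᶜ) (C := rg f) (Z1 := Z1) (Z2 := Z2) (l := l) (h0 := h0) hC hl hh
    (by rw [Finset.disjoint_left]; exact fun z hz => (m1 z hz).1)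
    (by rw [Finset.disjoint_left]; exact fun z hz => ((m2 z).1 hz).1)
    Finset.sdiff_disjoint hZ2 hJ
    (by
      intro x hx y hy hxy
      rw [SimpleGraph.compl_adj]
      refine ⟨hxy, fun h => ?_⟩
      obtain ⟨i, hi⟩ := hne1 y hy
      exact cc x y (m1 x hx).1 (m1 y hy).1 (m1 x hx).2 h i hi)
    (by
      intro w hw hnw z hz
      rw [SimpleGraph.compl_adj]
      refine ⟨?_, fun h => hnw fun c hc => ?_⟩
      · rintro rfl
        exact (Finset.mem_sdiff.1 hz).2 hw
      · rw [SimpleGraph.compl_adj]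
        refine ⟨?_, ?_⟩
        · rintro rfl
          exact ((m2 w).1 hw).1 hc
        · obtain ⟨i, rfl⟩ := mem_rg.1 hc
          exact cc z w (m1 z hz).1 ((m2 w).1 hw).1 (m1 z hz).2 h i)
    B (fun z _ => BC z) (fun z hz => by rw [Bcard]; exact (m1 z hz).2)
    (by
      intro z hz x hx y hy hxy
      rw [SimpleGraph.compl_adj]
      refine ⟨hxy, fun h => ?_⟩
      obtain ⟨i, hi, rfl⟩ := key z x hx
      obtain ⟨j, hj, rfl⟩ := key z y hy
      exact mx (l + 1) (by omega) (lc_b hf (m1 z hz).1 i j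
        (fun e => hxy ((hf.shift_inj 1).2 e)) hi hj h))
    (by
      intro z hz x hx
      rw [SimpleGraph.compl_adj]
      refine ⟨?_, fun h => ?_⟩
      · rintro rfl
        exact (m1 z hz).1 (BC z hx)
      · obtain ⟨i, hi, rfl⟩ := key z x hx
        exact mx (l + 1) (by omega) (lc_a hf (m1 z hz).1 i hi h))
    (by
      by_contra hcon
      push Not at hcon
      have heq : ∀ z ∈ Z1, ∀ z' ∈ Z1, z ≠ z' → B z = T z' := by
        intro z hz z' hz' hzz
        apply Finset.eq_of_subset_of_card_le
        · intro c hc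
          have h1 := hcon z hz z' hz' hzz c hc
          rw [SimpleGraph.compl_adj, not_and, not_not] at h1
          have hcC := BC z hc
          refine Finset.mem_inter.2 ⟨mem_nb.2 (h1 ?_), hcC⟩
          rintro rfl
          exact (m1 z' hz').1 hcC
        · rw [Bcard, (m1 z hz).2, (m1 z' hz').2]
      obtain ⟨z1, z2, z3, h1, h2, h3, h12, h13, h23⟩ := Finset.two_lt_card_iff.1 (show 2 < Z1.card by omega)
      have e1 := heq z1 h1 z2 h2 h12
      have e2 := heq z1 h1 z3 h3 h13
      have e3 := heq z2 h2 z3 h3 h23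
      have d := dTB z2 (m1 z2 h2).1
      rw [e3, ← e2, e1, disjoint_self] at d
      have := (m1 z2 h2).2
      rw [d] at this
      simp at this
      omega)
  exact mx' L (by omega) hg

theorem long_cycle {G : SimpleGraph V} {k : ℕ} (hk : 5 ≤ k) (hV : 3 * k + 2 ≤ Fintype.card V) :
    ∃ L, 2 * k ≤ L ∧ MonoC G L := by
  classical
  have bd : ∀ L, MonoC G L → L ≤ Fintype.card V := by
    rintro L (⟨g, hg⟩ | ⟨g, hg⟩) <;> rw [← hg.card_rg] <;> exact Finset.card_le_univ _
  have h4 : MonoC G 4 := exists_C4 (by omega)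
  obtain ⟨l, hl, hmax⟩ : ∃ l, MonoC G l ∧ ∀ L, MonoC G L → L ≤ l := by
    refine ⟨Nat.findGreatest (MonoC G) (Fintype.card V), ?_, ?_⟩
    · exact Nat.findGreatest_spec (bd 4 h4) h4
    · exact fun L hL => Nat.le_findGreatest (bd L hL) hL
  by_contra hcon
  push Not at hcon
  have hlk : l + 1 ≤ 2 * k := by
    by_contra h
    exact hcon l (by omega) hl
  have hl4 := hmax 4 h4
  have mx : ∀ L, l < L → ¬ ∃ g, Cyc G L g := fun L h1 h2 => by
    have := hmax L (Or.inl h2); omega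
  have mx' : ∀ L, l < L → ¬ ∃ g, Cyc Gᶜ L g := fun L h1 h2 => by
    have := hmax L (Or.inr h2); omega
  rcases hl with ⟨f, hf⟩ | ⟨f, hf⟩
  · exact long_core hk hV hf hl4 hlk mx mx'
  · exact long_core hk hV hf hl4 hlk mx' (by rwa [compl_compl])

theorem hasS_main {k n : ℕ} (hk : 5 ≤ k) (hn : 2 ≤ n) (hnk : n + 3 ≤ k)
    (hV : Fintype.card V = 3 * k + n) (G : SimpleGraph V) : HasS k n G ∨ HasS k n Gᶜ := by
  obtain ⟨L, hL, hG⟩ := long_cycle (G := G) hk (by omega)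
  rcases descend hk L hL hG with ⟨f, hf⟩ | ⟨f, hf⟩
  · exact main_of_cycle hk hn hnk hV hf
  · have := main_of_cycle hk hn hnk hV hf
    rw [compl_compl] at this
    exact this.symm

end ldsproof

theorem hasCopy_of_hasS {V : Type*} [Fintype V] [DecidableEq V] {p n : ℕ} {G : SimpleGraph V}
    (h : HasS (p + 1) n G) : HasCopy (LinkedDoubleStar (2 * p + 1) n 2) G := by
  obtain ⟨a, b, S, A, B, hP, hS, hA, hB, hAa, hBb, hAS, hBS, hAB⟩ := h
  obtain ⟨g, h0, h1, h2, h3, h4⟩ := hP.seq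
  have hS' : S.card = 2 * p + 1 := by omega
  rw [hS'] at h1 h2 h3 h4
  have e1 : 2 * p + 1 - 1 = 2 * p := by omega
  rw [e1] at h1
  let α := A.equivFinOfCardEq hA
  let β := B.equivFinOfCardEq hB
  have hg : ∀ i : Fin (2 * p + 1), g i ∈ S := fun i => (h4 _).2 ⟨i, i.2, rfl⟩
  have hα : ∀ i, ((α.symm i : A) : V) ∈ A := fun i => (α.symm i).2
  have hβ : ∀ i, ((β.symm i : B) : V) ∈ B := fun i => (β.symm i).2
  refine ⟨fun x => match x with
    | Sum.inl i => g i
    | Sum.inr (Sum.inl i) => (α.symm i : A)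
    | Sum.inr (Sum.inr i) => (β.symm i : B), ?_, ?_⟩
  · rintro (i | i | i) (j | j | j) hij <;> dsimp only at hij
    · exact congrArg _ (Fin.ext (h2 _ _ i.2 j.2 hij))
    · exact absurd (hg i) (fun h => Finset.disjoint_left.1 hAS (hα j) (hij ▸ h))
    · exact absurd (hg i) (fun h => Finset.disjoint_left.1 hBS (hβ j) (hij ▸ h))
    · exact absurd (hg j) (fun h => Finset.disjoint_left.1 hAS (hα i) (hij.symm ▸ h))
    · have := α.symm.injective (Subtype.ext hij)
      rw [this]
    · exact absurd (hβ j) (Finset.disjoint_left.1 hAB (hij ▸ hα i))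
    · exact absurd (hg j) (fun h => Finset.disjoint_left.1 hBS (hβ i) (hij.symm ▸ h))
    · exact absurd (hβ i) (Finset.disjoint_left.1 hAB (hij.symm ▸ hα j))
    · have := β.symm.injective (Subtype.ext hij)
      rw [this]
  · have key : ∀ x y : Fin (2 * p + 1) ⊕ Fin n ⊕ Fin 2, ldsRel (2 * p + 1) n 2 x y →
        G.Adj ((fun x => match x with
          | Sum.inl i => g i
          | Sum.inr (Sum.inl i) => (α.symm i : A)
          | Sum.inr (Sum.inr i) => (β.symm i : B) : Fin (2 * p + 1) ⊕ Fin n ⊕ Fin 2 → V) x)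
          ((fun x => match x with
          | Sum.inl i => g i
          | Sum.inr (Sum.inl i) => (α.symm i : A)
          | Sum.inr (Sum.inr i) => (β.symm i : B) : Fin (2 * p + 1) ⊕ Fin n ⊕ Fin 2 → V) y) := by
      rintro (i | i | i) (j | j | j) hij <;> simp only [ldsRel] at hij
      · have := h3 i (by have := j.2; omega)
        simp only [hij]; exact this
      · simp only [hij, h0]; exact mem_nb.1 (hAa (hα j))
      · simp only [hij, e1, h1]; exact mem_nb.1 (hBb (hβ j))
    intro x y hxy
    rw [LinkedDoubleStar, SimpleGraph.fromRel_adj] at hxy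
    rcases hxy.2 with h | h
    · exact key x y h
    · exact (key y x h).symm

/-- if `p ≥ 4` and `2 ≤ n ≤ p − 2` then `r(S_c(n,2)) ≤ n + 3p + 3`;
that is, every 2-coloring of `K_{n+3p+3}` contains a monochromatic `S_c(n,2)`. -/
theorem lds_upper_bound_two (p n : ℕ) (hp : 4 ≤ p) (hn2 : 2 ≤ n) (hnp : n ≤ p - 2) :
    ramseyLDS (2 * p + 1) n 2 ≤ n + 3 * p + 3 ∧
    IsRamseyLDS (2 * p + 1) n 2 (n + 3 * p + 3) := by
  have main : IsRamseyLDS (2 * p + 1) n 2 (n + 3 * p + 3) := by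
    intro G
    rcases hasS_main (k := p + 1) (n := n) (by omega) hn2 (by omega)
      (by rw [Fintype.card_fin]; omega) G with h | h
    · exact Or.inl (hasCopy_of_hasS h)
    · exact Or.inr (hasCopy_of_hasS h)
  exact ⟨Nat.sInf_le ⟨by omega, main⟩, main⟩
end
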